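/- Let f and g be commuting orientation-preserving C^∞ diffeomorphisms of [0,1] having no common fixed point in (0,1) at which both are infinitely tangent to the identity. Then either (a) there exist an orientation-preserving C^∞ diffeomorphism h of [0,1] and integers p, q with f = h^q and g = h^p, or (b) there exist a vector field ξ on [0,1], of class C¹ on [0,1] and C^∞ on (0,1), with complete flow φ^t, and a real number α such that f = φ¹ and g = φ^α. -/

import Mathlib

set_option autoImplicit false

open Set

/-- `f : ℝ → ℝ` represents (a smooth extension of) an orientation-preserving `C^∞`
diffeomorphism of the interval `[0,1]`. -/
def SmoothDiffeoI (f : ℝ → ℝ) : Prop :=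
  ContDiff ℝ (⊤ : ℕ∞) f ∧ f 0 = 0 ∧ f 1 = 1 ∧ (∀ x ∈ Icc (0 : ℝ) 1, 0 < deriv f x) ∧
    MapsTo f (Icc (0 : ℝ) 1) (Icc (0 : ℝ) 1)

/-- `f` is infinitely tangent to the identity at `p`. -/
def ITIat (f : ℝ → ℝ) (p : ℝ) : Prop :=
  f p = p ∧ ∀ n : ℕ, 1 ≤ n → iteratedDeriv n (fun x => f x - x) p = 0

/-- `finv` is a two-sided inverse of `f` on the set `s`. -/
def IsInverseOn (finv f : ℝ → ℝ) (s : Set ℝ) : Prop :=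
  (∀ x ∈ s, finv (f x) = x) ∧ ∀ x ∈ s, f (finv x) = x

/-- The `n`-th power (`n ∈ ℤ`) of the bijection `h` with inverse `hinv`. -/
def zpowIter (h hinv : ℝ → ℝ) (n : ℤ) : ℝ → ℝ :=
  if 0 ≤ n then h^[n.toNat] else hinv^[(-n).toNat]

/-- `φ` is the (complete) flow of the vector field `ξ` on the interval `[a,b]`. -/
def IsFlowOn (ξ : ℝ → ℝ) (φ : ℝ → ℝ → ℝ) (a b : ℝ) : Prop :=
  (∀ x ∈ Icc a b, φ 0 x = x) ∧
    ∀ x ∈ Icc a b, ∀ t : ℝ, φ t x ∈ Icc a b ∧ HasDerivAt (fun s => φ s x) (ξ (φ t x)) t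

open Filter
open scoped ContDiff Topology

/-! ### Hadamard lemma -/

lemma avg_hasDerivAt (n : ℕ) (g : ℝ → ℝ) (hg : ContDiff ℝ 1 g) (x : ℝ) :
    HasDerivAt (fun x => ∫ s in (0:ℝ)..1, s ^ n * g (s * x))
      (∫ s in (0:ℝ)..1, s ^ (n+1) * deriv g (s * x)) x := by
  have hgc : Continuous g := hg.continuous
  have hdc : Continuous (deriv g) := hg.continuous_deriv le_rfl
  -- bound of deriv g on a compact
  obtain ⟨C, hC⟩ := (isCompact_Icc (a := -(|x|+1)) (b := |x|+1)).exists_bound_of_continuousOn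
    hdc.continuousOn
  refine (intervalIntegral.hasDerivAt_integral_of_dominated_loc_of_deriv_le
    (F := fun x s => s ^ n * g (s * x)) (F' := fun x s => s ^ (n+1) * deriv g (s * x))
    (bound := fun _ => C) (s := Metric.ball x 1)
    (Metric.ball_mem_nhds x one_pos) ?_ ?_ ?_ ?_ ?_ ?_).2
  · exact Eventually.of_forall fun y => (by fun_prop : Continuous _).aestronglyMeasurable
  · exact (by fun_prop : Continuous _).intervalIntegrable _ _
  · exact (by fun_prop : Continuous _).aestronglyMeasurable
  · refine Eventually.of_forall fun s hs y hy => ?_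
    rw [uIoc_of_le zero_le_one] at hs
    have h1 : |s * y| ≤ |x| + 1 := by
      rw [abs_mul, abs_of_pos hs.1]
      have : |y - x| < 1 := by simpa [Real.dist_eq] using hy
      have h2 : |y| ≤ |x| + 1 := by
        have := abs_sub_abs_le_abs_sub y x
        linarith
      have := mul_le_mul hs.2 h2 (abs_nonneg y) zero_le_one
      linarith
    have h2 := hC (s * y) (abs_le.1 h1)
    have h3 : |s ^ (n+1)| ≤ 1 := by
      rw [abs_of_pos (pow_pos hs.1 _)]
      exact pow_le_one₀ hs.1.le hs.2
    rw [norm_mul]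
    calc _ ≤ 1 * C := mul_le_mul h3 h2 (norm_nonneg _) zero_le_one
      _ = C := one_mul C
  · simp
  · refine Eventually.of_forall fun s hs y hy => ?_
    have h1 : HasDerivAt (fun y => g (s * y)) (deriv g (s * y) * s) y := by
      have h2 : HasDerivAt (fun y => s * y) s y := by simpa using (hasDerivAt_id y).const_mul s
      exact ((hg.differentiable one_ne_zero (s * y)).hasDerivAt).comp y h2
    have := h1.const_mul (s ^ n)
    exact this.congr_deriv (by ring)


lemma avg_contDiff (j : ℕ) : ∀ (n : ℕ) (g : ℝ → ℝ), ContDiff ℝ ∞ g →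
    ContDiff ℝ j (fun x => ∫ s in (0:ℝ)..1, s ^ n * g (s * x)) := by
  induction j with
  | zero =>
    intro n g hg
    have : Differentiable ℝ (fun x => ∫ s in (0:ℝ)..1, s ^ n * g (s * x)) := fun x =>
      (avg_hasDerivAt n g (hg.of_le (by exact_mod_cast le_top)) x).differentiableAt
    exact contDiff_zero.2 this.continuous
  | succ j ih =>
    intro n g hg
    have h1 := fun x => avg_hasDerivAt n g (hg.of_le (by exact_mod_cast le_top)) x
    push_cast
    rw [contDiff_succ_iff_deriv]
    refine ⟨fun x => (h1 x).differentiableAt, by simp, ?_⟩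
    rw [funext fun x => (h1 x).deriv]
    exact ih (n+1) (deriv g) ((contDiff_infty_iff_deriv.1 hg).2)

/-- Hadamard lemma at the origin. -/
lemma hadamard0 (g : ℝ → ℝ) (hg : ContDiff ℝ ∞ g) (h0 : g 0 = 0) :
    ∃ k : ℝ → ℝ, ContDiff ℝ ∞ k ∧ ∀ x, g x = x * k x := by
  refine ⟨fun x => ∫ s in (0:ℝ)..1, s ^ 0 * deriv g (s * x), ?_, ?_⟩
  · exact contDiff_infty.2 fun j => avg_contDiff j 0 (deriv g) ((contDiff_infty_iff_deriv.1 hg).2)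
  · intro x
    have hd : Continuous (deriv g) := ((contDiff_infty_iff_deriv.1 hg).2).continuous
    have h1 : ∀ s ∈ uIcc (0:ℝ) 1, HasDerivAt (fun s => g (s * x)) (x * (s ^ 0 * deriv g (s * x))) s := by
      intro s _
      have h2 : HasDerivAt (fun s => s * x) x s := by simpa using (hasDerivAt_id s).mul_const x
      have := (((contDiff_infty_iff_deriv.1 hg).1 (s * x)).hasDerivAt).comp s h2
      exact this.congr_deriv (by ring)

    have h3 := intervalIntegral.integral_eq_sub_of_hasDerivAt h1
      ((by fun_prop : Continuous _).intervalIntegrable _ _)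
    rw [intervalIntegral.integral_const_mul] at h3
    rw [h3]; simp [h0]

lemma hadamard (p : ℝ) (g : ℝ → ℝ) (hg : ContDiff ℝ ∞ g) (h0 : g p = 0) :
    ∃ k : ℝ → ℝ, ContDiff ℝ ∞ k ∧ ∀ x, g x = (x - p) * k x := by
  obtain ⟨k, hk, hk2⟩ := hadamard0 (fun x => g (x + p)) (hg.comp (by fun_prop)) (by simpa using h0)
  refine ⟨fun x => k (x - p), hk.comp (by fun_prop), fun x => ?_⟩
  have := hk2 (x - p)
  simpa using this

/-- If `d = O(|x-p|^m)` on the right of `p` then `d` is divisible by `(x-p)^m`. -/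
lemma divides_of_bound (p : ℝ) (m : ℕ) : ∀ (d : ℝ → ℝ), ContDiff ℝ ∞ d →
    (∃ C, ∀ᶠ x in 𝓝[>] p, |d x| ≤ C * (x - p) ^ m) →
    ∃ B : ℝ → ℝ, ContDiff ℝ ∞ B ∧ ∀ x, d x = (x - p) ^ m * B x := by
  induction m with
  | zero => intro d hd _; exact ⟨d, hd, by simp⟩
  | succ m ih =>
    intro d hd ⟨C, hC⟩
    have h0 : d p = 0 := by
      have h1 : Tendsto (fun x => |d x|) (𝓝[>] p) (𝓝 |d p|) :=
        (hd.continuous.abs.tendsto p).mono_left nhdsWithin_le_nhds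
      have h2 : Tendsto (fun x => C * (x - p) ^ (m+1)) (𝓝[>] p) (𝓝 0) := by
        have : Tendsto (fun x => C * (x - p) ^ (m+1)) (𝓝 p) (𝓝 (C * (p - p) ^ (m+1))) :=
          (by fun_prop : Continuous fun x => C * (x - p) ^ (m+1)).tendsto p
        simpa using this.mono_left nhdsWithin_le_nhds
      have h3 := le_of_tendsto_of_tendsto h1 h2 hC
      exact abs_eq_zero.1 (le_antisymm h3 (abs_nonneg _))
    obtain ⟨k, hk, hk2⟩ := hadamard p d hd h0
    obtain ⟨B, hB, hB2⟩ := ih k hk ⟨C, by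
      filter_upwards [hC, self_mem_nhdsWithin] with x hx hxp
      have hxp' : 0 < x - p := sub_pos.2 hxp
      rw [hk2 x, abs_mul, abs_of_pos hxp'] at hx
      have : (x - p) * |k x| ≤ (x - p) * (C * (x - p) ^ m) := by rw [pow_succ] at hx; linarith
      exact le_of_mul_le_mul_left this hxp'⟩
    exact ⟨B, hB, fun x => by rw [hk2 x, hB2 x, pow_succ]; ring⟩

/-- All derivatives vanish: divisible by every power. -/
lemma divides_of_flat (p : ℝ) (m : ℕ) : ∀ (d : ℝ → ℝ), ContDiff ℝ ∞ d →
    (∀ n, iteratedDeriv n d p = 0) →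
    ∃ B : ℝ → ℝ, ContDiff ℝ ∞ B ∧ (∀ x, d x = (x - p) ^ m * B x) ∧ ∀ n, iteratedDeriv n B p = 0 := by
  induction m with
  | zero => intro d hd h; exact ⟨d, hd, by simp, h⟩
  | succ m ih =>
    intro d hd h
    obtain ⟨k, hk, hk2⟩ := hadamard p d hd (by simpa using h 0)
    have key : ∀ n, iteratedDeriv (n+1) d p = (n+1) * iteratedDeriv n k p := by
      intro n
      have e : d = (fun x => x - p) * k := funext hk2
      rw [e, iteratedDeriv_mul (by fun_prop) (hk.contDiffAt.of_le (by exact_mod_cast le_top))]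
      rw [Finset.sum_eq_single 1]
      · simp [iteratedDeriv_one]
      · intro i _ hi
        rcases i with _ | _ | i
        · simp
        · simp at hi
        · have : iteratedDeriv (i + 1 + 1) (fun x : ℝ => x - p) p = 0 := by
            rw [iteratedDeriv_succ']
            have : deriv (fun x : ℝ => x - p) = fun _ => 1 := by ext; simp
            rw [this, iteratedDeriv_const]; simp
          rw [this]; simp
      · simp
    obtain ⟨B, hB, hB2, hB3⟩ := ih k hk fun n => by
      have := key n
      rw [h (n+1)] at this
      have h2 : ((n:ℝ)+1) ≠ 0 := by positivity
      rcases mul_eq_zero.1 this.symm with h3 | h3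
      · exact absurd h3 h2
      · exact h3
    exact ⟨B, hB, fun x => by rw [hk2 x, hB2 x, pow_succ]; ring, hB3⟩

/-- finite order of vanishing -/
lemma finite_order (p : ℝ) (n : ℕ) : ∀ (d : ℝ → ℝ), ContDiff ℝ ∞ d →
    iteratedDeriv n d p ≠ 0 →
    ∃ (k : ℕ) (B : ℝ → ℝ), ContDiff ℝ ∞ B ∧ (∀ x, d x = (x - p) ^ k * B x) ∧ B p ≠ 0 := by
  induction n with
  | zero => intro d hd h; exact ⟨0, d, hd, by simp, by simpa using h⟩
  | succ n ih =>
    intro d hd h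
    by_cases h0 : d p = 0
    · obtain ⟨k, hk, hk2⟩ := hadamard p d hd h0
      have key : iteratedDeriv (n+1) d p = (n+1) * iteratedDeriv n k p := by
        have e : d = (fun x => x - p) * k := funext hk2
        rw [e, iteratedDeriv_mul (by fun_prop) (hk.contDiffAt.of_le (by exact_mod_cast le_top))]
        rw [Finset.sum_eq_single 1]
        · simp [iteratedDeriv_one]
        · intro i _ hi
          rcases i with _ | _ | i
          · simp
          · simp at hi
          · have : iteratedDeriv (i + 1 + 1) (fun x : ℝ => x - p) p = 0 := by
              rw [iteratedDeriv_succ']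
              have : deriv (fun x : ℝ => x - p) = fun _ => 1 := by ext; simp
              rw [this, iteratedDeriv_const]; simp
            rw [this]; simp
        · simp
      obtain ⟨m, B, hB, hB2, hB3⟩ := ih k hk (fun h3 => h (by rw [key, h3, mul_zero]))
      exact ⟨m+1, B, hB, fun x => by rw [hk2 x, hB2 x, pow_succ]; ring, hB3⟩
    · exact ⟨0, d, hd, by simp, h0⟩

/-! ### Contractions on `(0,b)` -/

structure Ctr (f : ℝ → ℝ) (b : ℝ) : Prop where
  smooth : ContDiff ℝ ∞ f
  dpos : ∀ x, 0 < deriv f x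
  zero : f 0 = 0
  bpos : 0 < b
  fixb : f b = b
  lt : ∀ x ∈ Ioo 0 b, f x < x

namespace Ctr
variable {f : ℝ → ℝ} {b : ℝ}

lemma smono (h : Ctr f b) : StrictMono f := strictMono_of_deriv_pos h.dpos

lemma cont (h : Ctr f b) : Continuous f := h.smooth.continuous

lemma hasD (h : Ctr f b) (x : ℝ) : HasDerivAt f (deriv f x) x :=
  ((contDiff_infty_iff_deriv.1 h.smooth).1 x).hasDerivAt

lemma smoothD (h : Ctr f b) : ContDiff ℝ ∞ (deriv f) := (contDiff_infty_iff_deriv.1 h.smooth).2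

lemma hasDD (h : Ctr f b) (x : ℝ) : HasDerivAt (deriv f) (deriv (deriv f) x) x :=
  ((contDiff_infty_iff_deriv.1 h.smoothD).1 x).hasDerivAt

lemma mem (h : Ctr f b) {x : ℝ} (hx : x ∈ Ioo 0 b) : f x ∈ Ioo 0 b :=
  ⟨by simpa [h.zero] using h.smono hx.1, by simpa [h.fixb] using h.smono hx.2⟩

lemma iter_mem (h : Ctr f b) {x : ℝ} (hx : x ∈ Ioo 0 b) (n : ℕ) : f^[n] x ∈ Ioo 0 b := by
  induction n with
  | zero => simpa using hx
  | succ n ih => rw [Function.iterate_succ_apply']; exact h.mem ih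

lemma iter_anti (h : Ctr f b) {x : ℝ} (hx : x ∈ Ioo 0 b) : Antitone (fun n => f^[n] x) := by
  refine antitone_nat_of_succ_le fun n => ?_
  rw [Function.iterate_succ_apply']
  exact (h.lt _ (h.iter_mem hx n)).le

lemma iter_le (h : Ctr f b) {x : ℝ} (hx : x ∈ Ioo 0 b) (n : ℕ) : f^[n] x ≤ x := by
  simpa using h.iter_anti hx (Nat.zero_le n)

lemma iter_tendsto (h : Ctr f b) {x : ℝ} (hx : x ∈ Ioo 0 b) :
    Tendsto (fun n => f^[n] x) atTop (𝓝 0) := by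
  have h1 : BddBelow (range fun n => f^[n] x) :=
    ⟨0, by rintro _ ⟨n, rfl⟩; exact (h.iter_mem hx n).1.le⟩
  have h2 := tendsto_atTop_ciInf (h.iter_anti hx) h1
  set l := ⨅ n, f^[n] x
  have hl0 : 0 ≤ l := ge_of_tendsto' h2 fun n => (h.iter_mem hx n).1.le
  have hlx : l ≤ x := le_of_tendsto' h2 fun n => h.iter_le hx n
  have h3 : f l = l := by
    have h4 : Tendsto (fun n => f^[n+1] x) atTop (𝓝 l) := h2.comp (tendsto_add_atTop_nat 1)
    have h5 : Tendsto (fun n => f (f^[n] x)) atTop (𝓝 (f l)) := (h.cont.tendsto l).comp h2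
    simp_rw [Function.iterate_succ_apply'] at h4
    exact tendsto_nhds_unique h5 h4
  have : l = 0 := by
    by_contra hne
    have := h.lt l ⟨lt_of_le_of_ne hl0 (Ne.symm hne), lt_of_le_of_lt hlx hx.2⟩
    linarith
  rwa [this] at h2

lemma summable_diff (h : Ctr f b) {x : ℝ} (hx : x ∈ Ioo 0 b) :
    HasSum (fun n => f^[n] x - f^[n+1] x) x := by
  rw [hasSum_iff_tendsto_nat_of_nonneg]
  · have : ∀ n, ∑ i ∈ Finset.range n, (f^[i] x - f^[i+1] x) = x - f^[n] x := by
      intro n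
      rw [Finset.sum_range_sub']; simp
    simp_rw [this]
    simpa using tendsto_const_nhds.sub (h.iter_tendsto hx)
  · intro n
    have := h.iter_anti hx (Nat.le_succ n)
    simpa using this

lemma diff_nonneg (h : Ctr f b) {x : ℝ} (hx : x ∈ Ioo 0 b) : 0 ≤ x - f x := by
  have := h.lt x hx; linarith

/-- basic summation bound -/
lemma sum_bound (h : Ctr f b) {x C : ℝ} (hx : x ∈ Ioo 0 b) (q : ℝ → ℝ)
    (hq : ∀ y ∈ Ioc 0 x, |q y| ≤ C * (y - f y)) :
    Summable (fun n => q (f^[n] x)) ∧ |∑' n, q (f^[n] x)| ≤ C * x := by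
  have h1 : ∀ n, ‖q (f^[n] x)‖ ≤ C * (f^[n] x - f^[n+1] x) := by
    intro n
    rw [Function.iterate_succ_apply']
    exact hq _ ⟨(h.iter_mem hx n).1, h.iter_le hx n⟩
  have h2 := (h.summable_diff hx).mul_left C
  exact ⟨Summable.of_norm_bounded h2.summable h1, tsum_of_norm_bounded h2 h1⟩

lemma iter_smono (h : Ctr f b) (n : ℕ) : StrictMono (f^[n]) := h.smono.iterate n

lemma unif_sum (h : Ctr f b) {c' c : ℝ} (hc' : c' ∈ Ioo 0 b) (hc : c ∈ Ioo 0 b) :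
    ∃ u : ℕ → ℝ, Summable u ∧ ∀ n, ∀ x ∈ Icc c' c, f^[n] x - f^[n+1] x ≤ u n := by
  obtain ⟨N, hN⟩ := ((h.iter_tendsto hc).eventually (gt_mem_nhds hc'.1)).exists
  refine ⟨fun n => ∑ j ∈ Finset.range (N+1), (f^[j+n] c - f^[j+n+1] c), ?_, ?_⟩
  · refine summable_sum fun j _ => ?_
    have := (summable_nat_add_iff j).2 (h.summable_diff hc).summable
    refine this.congr fun n => ?_
    rw [show n + j = j + n by ring]
  · intro n x hx
    have e : ∑ j ∈ Finset.range (N+1), (f^[j+n] c - f^[j+n+1] c) = f^[n] c - f^[N+1+n] c := by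
      have := Finset.sum_range_sub' (fun j => f^[j+n] c) (N+1)
      simp only [zero_add] at this
      rw [← this]
      refine Finset.sum_congr rfl fun j _ => ?_
      rw [show j + 1 + n = j + n + 1 by ring]
    simp only [e]
    have h1 : f^[n] x ≤ f^[n] c := (h.iter_smono n).monotone hx.2
    have h2 : f^[N+1+n] c ≤ f^[n+1] x := by
      rw [show N+1+n = (n+1)+N by ring, Function.iterate_add_apply]
      exact (h.iter_smono (n+1)).monotone (hN.le.trans hx.1)
    linarith

/-- the local boundedness condition `q = O(y - f y)` -/
def Osm (f : ℝ → ℝ) (b : ℝ) (q : ℝ → ℝ) : Prop :=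
  ∀ c ∈ Ioo 0 b, ∃ C, ∀ y ∈ Ioc 0 c, |q y| ≤ C * (y - f y)

lemma sum_summable (h : Ctr f b) {q : ℝ → ℝ} (hq : Osm f b q) {x : ℝ} (hx : x ∈ Ioo 0 b) :
    Summable (fun n => q (f^[n] x)) := by
  obtain ⟨C, hC⟩ := hq x hx
  exact (h.sum_bound hx q hC).1

lemma sum_cont (h : Ctr f b) {q : ℝ → ℝ} (hq : Osm f b q) (hqc : ContinuousOn q (Ioo 0 b)) :
    ContinuousOn (fun x => ∑' n, q (f^[n] x)) (Ioo 0 b) := by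
  intro x hx
  obtain ⟨c', hc'⟩ := exists_between hx.1
  obtain ⟨c, hc⟩ := exists_between hx.2
  have hc'm : c' ∈ Ioo 0 b := ⟨hc'.1, hc'.2.trans hx.2⟩
  have hcm : c ∈ Ioo 0 b := ⟨hx.1.trans hc.1, hc.2⟩
  obtain ⟨u, hu, hu2⟩ := h.unif_sum hc'm hcm
  obtain ⟨C, hC⟩ := hq c hcm
  have sub : Icc c' c ⊆ Ioo 0 b := fun y hy => ⟨hc'm.1.trans_le hy.1, hy.2.trans_lt hcm.2⟩
  have h1 : ContinuousOn (fun x => ∑' n, q (f^[n] x)) (Icc c' c) := by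
    refine continuousOn_tsum (u := fun n => |C| * u n) (fun n => ?_) (hu.mul_left _) ?_
    · exact hqc.comp (h.cont.iterate n).continuousOn fun y hy => h.iter_mem (sub hy) n
    · intro n y hy
      have hy' := sub hy
      have hnn : 0 ≤ f^[n] y - f^[n+1] y := by
        rw [Function.iterate_succ_apply']; exact h.diff_nonneg (h.iter_mem hy' n)
      have h2 := hC (f^[n] y) ⟨(h.iter_mem hy' n).1, (h.iter_le hy' n).trans hy.2⟩
      rw [← Function.iterate_succ_apply' f] at h2
      calc ‖q (f^[n] y)‖ ≤ C * (f^[n] y - f^[n+1] y) := h2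
        _ ≤ |C| * (f^[n] y - f^[n+1] y) := mul_le_mul_of_nonneg_right (le_abs_self C) hnn
        _ ≤ |C| * u n := mul_le_mul_of_nonneg_left (hu2 n y hy) (abs_nonneg C)
  exact (h1.continuousAt (Icc_mem_nhds hc'.2 hc.1)).continuousWithinAt

lemma sum_deriv (h : Ctr f b) {q r ρ : ℝ → ℝ} (hq : Osm f b q) (hr : Osm f b r)
    (hρ : ContinuousOn ρ (Ioo 0 b))
    (hd : ∀ n, ∀ x ∈ Ioo 0 b, HasDerivAt (fun x => q (f^[n] x)) (r (f^[n] x) * ρ x) x)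
    {x : ℝ} (hx : x ∈ Ioo 0 b) :
    HasDerivAt (fun x => ∑' n, q (f^[n] x)) ((∑' n, r (f^[n] x)) * ρ x) x := by
  obtain ⟨c', hc'⟩ := exists_between hx.1
  obtain ⟨c, hc⟩ := exists_between hx.2
  have hc'm : c' ∈ Ioo 0 b := ⟨hc'.1, hc'.2.trans hx.2⟩
  have hcm : c ∈ Ioo 0 b := ⟨hx.1.trans hc.1, hc.2⟩
  obtain ⟨u, hu, hu2⟩ := h.unif_sum hc'm hcm
  obtain ⟨C, hC⟩ := hr c hcm
  have sub : Icc c' c ⊆ Ioo 0 b := fun y hy => ⟨hc'm.1.trans_le hy.1, hy.2.trans_lt hcm.2⟩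
  obtain ⟨R, hR⟩ := isCompact_Icc.exists_bound_of_continuousOn (hρ.mono sub)
  rw [← tsum_mul_right]
  refine hasDerivAt_tsum_of_isPreconnected (u := fun n => |C| * u n * R) (t := Ioo c' c)
    (g := fun n x => q (f^[n] x)) (g' := fun n x => r (f^[n] x) * ρ x)
    ((hu.mul_left _).mul_right R) isOpen_Ioo isPreconnected_Ioo (fun n y hy => ?_) (fun n y hy => ?_)
    (y₀ := x) ⟨hc'.2, hc.1⟩ (h.sum_summable hq hx) ⟨hc'.2, hc.1⟩
  · exact hd n y (sub ⟨hy.1.le, hy.2.le⟩)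
  · have hyc : y ∈ Icc c' c := ⟨hy.1.le, hy.2.le⟩
    have hy' := sub hyc
    have hnn : 0 ≤ f^[n] y - f^[n+1] y := by
      rw [Function.iterate_succ_apply']; exact h.diff_nonneg (h.iter_mem hy' n)
    have h2 := hC (f^[n] y) ⟨(h.iter_mem hy' n).1, (h.iter_le hy' n).trans hyc.2⟩
    rw [← Function.iterate_succ_apply' f] at h2
    have h3 : ‖r (f^[n] y)‖ ≤ |C| * u n := 
      calc ‖r (f^[n] y)‖ ≤ C * (f^[n] y - f^[n+1] y) := h2
        _ ≤ |C| * (f^[n] y - f^[n+1] y) := mul_le_mul_of_nonneg_right (le_abs_self C) hnn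
        _ ≤ |C| * u n := mul_le_mul_of_nonneg_left (hu2 n y hyc) (abs_nonneg C)
    rw [norm_mul]
    exact mul_le_mul h3 (hR y hyc) (norm_nonneg _) ((norm_nonneg _).trans h3)

end Ctr

lemma abs_exp_sub_one_le' (s : ℝ) : |Real.exp s - 1| ≤ |s| * Real.exp |s| := by
  have h1 := Real.add_one_le_exp s
  have h2 := Real.add_one_le_exp (-s)
  have h3 : Real.exp (-s) * Real.exp s = 1 := by rw [← Real.exp_add]; simp
  have h4 : Real.exp s ≤ Real.exp |s| := Real.exp_le_exp.2 (le_abs_self s)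
  have h5 : 1 ≤ Real.exp |s| := Real.one_le_exp (abs_nonneg s)
  have h6 := Real.exp_pos s
  rw [abs_le]
  constructor
  · have : |s| * 1 ≤ |s| * Real.exp |s| := mul_le_mul_of_nonneg_left h5 (abs_nonneg s)
    have := neg_abs_le s
    linarith
  · have h7 : Real.exp s - 1 ≤ s * Real.exp s := by nlinarith
    have h8 : s * Real.exp s ≤ |s| * Real.exp |s| :=
      mul_le_mul (le_abs_self s) h4 h6.le (abs_nonneg s)
    linarith

namespace Ctr
variable {f : ℝ → ℝ} {b K : ℝ}

noncomputable def F (f : ℝ → ℝ) (x : ℝ) : ℝ := deriv (deriv f) x / deriv f x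

noncomputable def ell (f : ℝ → ℝ) (x : ℝ) : ℝ :=
  Real.log ((f (f x) - f x) / ((f x - x) * deriv f x))

noncomputable def LL (f : ℝ → ℝ) (x : ℝ) : ℝ := ∑' n, ell f (f^[n] x)

noncomputable def vf0 (f : ℝ → ℝ) (x : ℝ) : ℝ := (f x - x) * Real.exp (LL f x)

noncomputable def w0 (f : ℝ → ℝ) (x : ℝ) : ℝ :=
  (deriv f 0 - 1) - ∑' n, (fun y => F f y * vf0 f y) (f^[n] x)

noncomputable def xn (f : ℝ → ℝ) (n : ℕ) (x : ℝ) : ℝ :=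
  (f x - x) * Real.exp (∑ i ∈ Finset.range n, ell f (f^[i] x))

noncomputable def xd (f : ℝ → ℝ) : ℕ → ℝ → ℝ
  | 0, x => deriv f x - 1
  | n+1, x => xd f n (f x) - F f x * xn f (n+1) x

lemma F_smooth (h : Ctr f b) : ContDiff ℝ ∞ (F f) := by
  have := (contDiff_infty_iff_deriv.1 h.smoothD).2
  exact this.div h.smoothD fun x => (h.dpos x).ne'

lemma exists_K (h : Ctr f b) : ∃ K, 0 ≤ K ∧ ∀ x ∈ Icc 0 b, |F f x| ≤ K := by
  obtain ⟨C, hC⟩ := (isCompact_Icc (a := 0) (b := b)).exists_bound_of_continuousOn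
    h.F_smooth.continuous.continuousOn
  refine ⟨C, ?_, hC⟩
  exact (norm_nonneg _).trans (hC 0 ⟨le_rfl, h.bpos.le⟩)

lemma log_lip (h : Ctr f b) (hK : ∀ x ∈ Icc 0 b, |F f x| ≤ K) {x y : ℝ} (hx : x ∈ Icc 0 b)
    (hy : y ∈ Icc 0 b) : |Real.log (deriv f x) - Real.log (deriv f y)| ≤ K * |x - y| := by
  have := Convex.norm_image_sub_le_of_norm_hasDerivWithin_le (f := fun x => Real.log (deriv f x))
    (f' := F f) (C := K) (s := Icc 0 b) (x := y) (y := x) (fun z hz => ?_) hK (convex_Icc 0 b) hy hx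
  · exact this
  · exact ((h.hasDD z).log (h.dpos z).ne').hasDerivWithinAt

lemma ell_ratio (h : Ctr f b) {x : ℝ} (hx : x ∈ Ioo 0 b) :
    0 < (f (f x) - f x) / ((f x - x) * deriv f x) := by
  have h1 := h.lt x hx
  have h2 := h.lt _ (h.mem hx)
  have h3 := h.dpos x
  apply div_pos_of_neg_of_neg (by linarith)
  exact mul_neg_of_neg_of_pos (by linarith) h3

lemma exp_ell (h : Ctr f b) {x : ℝ} (hx : x ∈ Ioo 0 b) :
    Real.exp (ell f x) = (f (f x) - f x) / ((f x - x) * deriv f x) := Real.exp_log (h.ell_ratio hx)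

lemma ell_bound (h : Ctr f b) (hK : ∀ x ∈ Icc 0 b, |F f x| ≤ K) (hK0 : 0 ≤ K)
    {x : ℝ} (hx : x ∈ Ioo 0 b) :
    |ell f x| ≤ K * (x - f x) := by
  have h1 := h.lt x hx
  have h0 := h.mem hx
  obtain ⟨c, hc, hc2⟩ := exists_deriv_eq_slope f h1 h.cont.continuousOn
    (fun y _ => (h.hasD y).differentiableAt.differentiableWithinAt)
  have e : (f (f x) - f x) / ((f x - x) * deriv f x) = deriv f c / deriv f x := by
    rw [hc2]
    have : x - f x ≠ 0 := by linarith
    have h2 : f x - x ≠ 0 := by intro h; apply this; linarith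
    have := (h.dpos x).ne'
    field_simp
    ring
  have hcm : c ∈ Icc 0 b := ⟨(h0.1.trans hc.1).le, (hc.2.trans hx.2).le⟩
  rw [ell, e, Real.log_div (h.dpos c).ne' (h.dpos x).ne']
  refine (h.log_lip hK hcm ⟨hx.1.le, hx.2.le⟩).trans ?_
  refine mul_le_mul_of_nonneg_left ?_ hK0
  rw [abs_sub_comm, abs_of_pos (by linarith [hc.2])]
  linarith [hc.1]

lemma LL_summable (h : Ctr f b) {x : ℝ} (hx : x ∈ Ioo 0 b) :
    Summable fun n => ell f (f^[n] x) := by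
  obtain ⟨K, hK0, hK⟩ := h.exists_K
  exact (h.sum_bound hx (ell f) (C := K)
    fun y hy => h.ell_bound hK hK0 ⟨hy.1, hy.2.trans_lt hx.2⟩).1

lemma LL_bound (h : Ctr f b) (hK : ∀ x ∈ Icc 0 b, |F f x| ≤ K) (hK0 : 0 ≤ K)
    {x : ℝ} (hx : x ∈ Ioo 0 b) : |LL f x| ≤ K * x :=
  (h.sum_bound hx (ell f) (C := K)
    fun y hy => h.ell_bound hK hK0 ⟨hy.1, hy.2.trans_lt hx.2⟩).2

lemma LL_split (h : Ctr f b) {x : ℝ} (hx : x ∈ Ioo 0 b) (n : ℕ) :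
    LL f x = ∑ i ∈ Finset.range n, ell f (f^[i] x) + LL f (f^[n] x) := by
  rw [LL, LL, ← (h.LL_summable hx).sum_add_tsum_nat_add n]
  congr 1
  refine tsum_congr fun m => ?_
  rw [Function.iterate_add_apply]

lemma partial_bound (h : Ctr f b) (hK : ∀ x ∈ Icc 0 b, |F f x| ≤ K) (hK0 : 0 ≤ K)
    {x : ℝ} (hx : x ∈ Ioo 0 b) (n : ℕ) :
    |∑ i ∈ Finset.range n, ell f (f^[i] x)| ≤ K * b := by
  have h1 : |∑ i ∈ Finset.range n, ell f (f^[i] x)|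
      ≤ ∑ i ∈ Finset.range n, K * (f^[i] x - f^[i+1] x) := by
    refine (Finset.abs_sum_le_sum_abs _ _).trans (Finset.sum_le_sum fun i _ => ?_)
    rw [Function.iterate_succ_apply']
    exact h.ell_bound hK hK0 (h.iter_mem hx i)
  rw [← Finset.mul_sum, Finset.sum_range_sub' (fun i => f^[i] x)] at h1
  refine h1.trans (mul_le_mul_of_nonneg_left ?_ hK0)
  have := (h.iter_mem hx n).1
  simp only [Function.iterate_zero, id]
  linarith [hx.2]

lemma vf0_neg (h : Ctr f b) {x : ℝ} (hx : x ∈ Ioo 0 b) : vf0 f x < 0 :=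
  mul_neg_of_neg_of_pos (by linarith [h.lt x hx]) (Real.exp_pos _)

lemma vf0_inv (h : Ctr f b) {x : ℝ} (hx : x ∈ Ioo 0 b) : vf0 f (f x) = deriv f x * vf0 f x := by
  have h1 := h.LL_split hx 1
  simp at h1
  rw [vf0, vf0, h1, Real.exp_add, h.exp_ell hx]
  have h3 : f x - x ≠ 0 := by linarith [h.lt x hx]
  have := (h.dpos x).ne'
  field_simp

lemma xn_succ (h : Ctr f b) {x : ℝ} (hx : x ∈ Ioo 0 b) (n : ℕ) :
    xn f (n+1) x = xn f n (f x) / deriv f x := by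
  rw [xn, xn, Finset.sum_range_succ']
  simp only [Function.iterate_succ_apply, Function.iterate_zero, id]
  rw [Real.exp_add, h.exp_ell hx]
  have h3 : f x - x ≠ 0 := by linarith [h.lt x hx]
  have := (h.dpos x).ne'
  field_simp

lemma xn_bound (h : Ctr f b) (hK : ∀ x ∈ Icc 0 b, |F f x| ≤ K) (hK0 : 0 ≤ K)
    {x : ℝ} (hx : x ∈ Ioo 0 b) (n : ℕ) : |xn f n x| ≤ Real.exp (K * b) * (x - f x) := by
  rw [xn, abs_mul, abs_of_neg (by linarith [h.lt x hx]), abs_of_pos (Real.exp_pos _), mul_comm]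
  have := Real.exp_le_exp.2 ((le_abs_self _).trans (h.partial_bound hK hK0 hx n))
  have h2 := h.diff_nonneg hx
  have := mul_le_mul_of_nonneg_right this h2
  linarith

lemma vf0_bound (h : Ctr f b) (hK : ∀ x ∈ Icc 0 b, |F f x| ≤ K) (hK0 : 0 ≤ K)
    {x : ℝ} (hx : x ∈ Ioo 0 b) : |vf0 f x| ≤ Real.exp (K * b) * (x - f x) := by
  rw [vf0, abs_mul, abs_of_neg (by linarith [h.lt x hx]), abs_of_pos (Real.exp_pos _), mul_comm]
  have h3 : LL f x ≤ K * b := ((le_abs_self _).trans (h.LL_bound hK hK0 hx)).trans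
    (mul_le_mul_of_nonneg_left hx.2.le hK0)
  have := Real.exp_le_exp.2 h3
  have h2 := h.diff_nonneg hx
  have := mul_le_mul_of_nonneg_right this h2
  linarith

lemma xn_err (h : Ctr f b) (hK : ∀ x ∈ Icc 0 b, |F f x| ≤ K) (hK0 : 0 ≤ K)
    {x : ℝ} (hx : x ∈ Ioo 0 b) (n : ℕ) :
    |vf0 f x - xn f n x| ≤ (Real.exp (K * b) * (K * Real.exp (K * b))) * (x - f x) * f^[n] x := by
  have e : vf0 f x - xn f n x = xn f n x * (Real.exp (LL f (f^[n] x)) - 1) := by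
    rw [vf0, xn, h.LL_split hx n, Real.exp_add]; ring
  have hn := h.iter_mem hx n
  have h1 := h.LL_bound hK hK0 hn
  have h2 := abs_exp_sub_one_le' (LL f (f^[n] x))
  have h3 : Real.exp |LL f (f^[n] x)| ≤ Real.exp (K * b) :=
    Real.exp_le_exp.2 (h1.trans (mul_le_mul_of_nonneg_left hn.2.le hK0))
  have h4 : |Real.exp (LL f (f^[n] x)) - 1| ≤ (K * f^[n] x) * Real.exp (K * b) :=
    h2.trans (mul_le_mul h1 h3 (Real.exp_pos _).le (mul_nonneg hK0 hn.1.le))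
  rw [e, abs_mul]
  refine (mul_le_mul (h.xn_bound hK hK0 hx n) h4 (abs_nonneg _)
    (mul_nonneg (Real.exp_pos _).le (h.diff_nonneg hx))).trans (le_of_eq ?_)
  ring

lemma FV_bound (h : Ctr f b) (hK : ∀ x ∈ Icc 0 b, |F f x| ≤ K) (hK0 : 0 ≤ K)
    {x : ℝ} (hx : x ∈ Ioo 0 b) : |F f x * vf0 f x| ≤ (K * Real.exp (K * b)) * (x - f x) := by
  rw [abs_mul, mul_assoc]
  exact mul_le_mul (hK x ⟨hx.1.le, hx.2.le⟩) (h.vf0_bound hK hK0 hx) (abs_nonneg _) hK0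

lemma w0_bound (h : Ctr f b) (hK : ∀ x ∈ Icc 0 b, |F f x| ≤ K) (hK0 : 0 ≤ K)
    {x : ℝ} (hx : x ∈ Ioo 0 b) : |w0 f x - (deriv f 0 - 1)| ≤ (K * Real.exp (K * b)) * x := by
  have := (h.sum_bound hx (fun y => F f y * vf0 f y) (C := K * Real.exp (K * b))
    fun y hy => h.FV_bound hK hK0 ⟨hy.1, hy.2.trans_lt hx.2⟩).2
  rw [w0]
  rwa [sub_sub_cancel_left, abs_neg]

lemma w0_shift (h : Ctr f b) {x : ℝ} (hx : x ∈ Ioo 0 b) :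
    w0 f (f x) = w0 f x + F f x * vf0 f x := by
  obtain ⟨K, hK0, hK⟩ := h.exists_K
  have := (h.sum_bound hx (fun y => F f y * vf0 f y) (C := K * Real.exp (K * b))
    fun y hy => h.FV_bound hK hK0 ⟨hy.1, hy.2.trans_lt hx.2⟩).1
  rw [w0, w0, this.tsum_eq_zero_add]
  simp only [Function.iterate_succ_apply, Function.iterate_zero, id]
  ring

lemma xn_hasDeriv (h : Ctr f b) (n : ℕ) : ∀ x ∈ Ioo 0 b, HasDerivAt (xn f n) (xd f n x) x := by
  induction n with
  | zero =>
    intro x hx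
    have : xn f 0 = fun x => f x - x := by ext; simp [xn]
    rw [this]
    exact (h.hasD x).sub (hasDerivAt_id x)
  | succ n ih =>
    intro x hx
    have e : xn f (n+1) =ᶠ[𝓝 x] fun x => xn f n (f x) / deriv f x := by
      filter_upwards [isOpen_Ioo.mem_nhds hx] with y hy using h.xn_succ hy n
    refine HasDerivAt.congr_of_eventuallyEq ?_ e
    have h1 := ((ih (f x) (h.mem hx)).comp x (h.hasD x)).div (h.hasDD x) (h.dpos x).ne'
    refine h1.congr_deriv ?_
    rw [xd, h.xn_succ hx n, F]
    have := (h.dpos x).ne'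
    simp only [Function.comp]
    field_simp

lemma xd_err (h : Ctr f b) : ∃ C, ∀ n, ∀ x ∈ Ioo 0 b, |xd f n x - w0 f x| ≤ C * f^[n] x := by
  obtain ⟨K, hK0, hK⟩ := h.exists_K
  obtain ⟨D, hD⟩ := (isCompact_Icc (a := 0) (b := b)).exists_bound_of_continuousOn
    (contDiff_infty_iff_deriv.1 h.smoothD).2.continuous.continuousOn
  set C0 := D + K * Real.exp (K * b) with hC0
  set C1 := K * (Real.exp (K * b) * (K * Real.exp (K * b))) with hC1
  have hC1n : 0 ≤ C1 := by positivity
  have key : ∀ n, ∀ x ∈ Ioo 0 b, |xd f n x - w0 f x| ≤ (C0 + C1 * (x - f^[n] x)) * f^[n] x := by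
    intro n
    induction n with
    | zero =>
      intro x hx
      have h1 := h.w0_bound hK hK0 hx
      have h2 := Convex.norm_image_sub_le_of_norm_hasDerivWithin_le (f := deriv f)
        (f' := deriv (deriv f)) (C := D) (s := Icc 0 b) (x := 0) (y := x)
        (fun z hz => (h.hasDD z).hasDerivWithinAt) hD (convex_Icc 0 b) ⟨le_rfl, h.bpos.le⟩
        ⟨hx.1.le, hx.2.le⟩
      simp only [Real.norm_eq_abs, sub_zero, abs_of_pos hx.1] at h2
      simp only [xd, Function.iterate_zero, id, sub_self, mul_zero, add_zero]
      have h3 : deriv f x - 1 - w0 f x = (deriv f x - deriv f 0) - (w0 f x - (deriv f 0 - 1)) := by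
        ring
      rw [h3]
      refine (abs_sub _ _).trans ?_
      rw [hC0]; linarith
    | succ n ih =>
      intro x hx
      have hm := h.mem hx
      have h1 := ih (f x) hm
      have h2 := h.xn_err hK hK0 hx (n+1)
      have e : xd f (n+1) x - w0 f x = (xd f n (f x) - w0 f (f x))
          + F f x * (vf0 f x - xn f (n+1) x) := by
        rw [xd, h.w0_shift hx]; ring
      have h3 : |F f x * (vf0 f x - xn f (n+1) x)| ≤ C1 * (x - f x) * f^[n+1] x := by
        rw [abs_mul]
        refine (mul_le_mul (hK x ⟨hx.1.le, hx.2.le⟩) h2 (abs_nonneg _) hK0).trans (le_of_eq ?_)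
        rw [hC1]; ring
      rw [← Function.iterate_succ_apply] at h1
      rw [e]
      refine (abs_add_le _ _).trans ((add_le_add h1 h3).trans (le_of_eq ?_))
      ring
  refine ⟨C0 + C1 * b, fun n x hx => (key n x hx).trans ?_⟩
  refine mul_le_mul_of_nonneg_right ?_ (h.iter_mem hx n).1.le
  have : x - f^[n] x ≤ b := by linarith [hx.2, (h.iter_mem hx n).1]
  have := mul_le_mul_of_nonneg_left this hC1n
  linarith

lemma vf0_hasDeriv (h : Ctr f b) {x : ℝ} (hx : x ∈ Ioo 0 b) : HasDerivAt (vf0 f) (w0 f x) x := by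
  obtain ⟨c, hc⟩ := exists_between hx.2
  have hcm : c ∈ Ioo 0 b := ⟨hx.1.trans hc.1, hc.2⟩
  obtain ⟨C, hC⟩ := h.xd_err
  obtain ⟨K, hK0, hK⟩ := h.exists_K
  have sub : Ioo 0 c ⊆ Ioo 0 b := Ioo_subset_Ioo_right hc.2.le
  refine hasDerivAt_of_tendstoUniformlyOn (l := atTop) (f := xn f) (f' := xd f) (s := Ioo 0 c)
    isOpen_Ioo ?_ ?_ ?_ ⟨hx.1, hc.1⟩
  · rw [Metric.tendstoUniformlyOn_iff]
    intro ε hε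
    have ht : Tendsto (fun n => |C| * f^[n] c) atTop (𝓝 0) := by
      simpa using (h.iter_tendsto hcm).const_mul |C|
    filter_upwards [ht.eventually (gt_mem_nhds hε)] with n hn y hy
    rw [Real.dist_eq, abs_sub_comm]
    refine lt_of_le_of_lt ((hC n y (sub hy)).trans ?_) hn
    exact mul_le_mul (le_abs_self C) ((h.iter_smono n).monotone hy.2.le)
      (h.iter_mem (sub hy) n).1.le (abs_nonneg C)
  · exact Eventually.of_forall fun n y hy => h.xn_hasDeriv n y (sub hy)
  · intro y hy
    have hy' := sub hy
    have ht : Tendsto (fun n => (Real.exp (K * b) * (K * Real.exp (K * b))) * (y - f y) * f^[n] y)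
        atTop (𝓝 0) := by
      simpa using (h.iter_tendsto hy').const_mul
        ((Real.exp (K * b) * (K * Real.exp (K * b))) * (y - f y))
    have : Tendsto (fun n => vf0 f y - xn f n y) atTop (𝓝 0) :=
      squeeze_zero_norm (fun n => by rw [Real.norm_eq_abs]; exact h.xn_err hK hK0 hy' n) ht
    simpa using (tendsto_const_nhds (x := vf0 f y)).sub this

end Ctr

namespace Ctr
variable {f : ℝ → ℝ} {b : ℝ}

def Bdd (b : ℝ) (p : ℝ → ℝ) : Prop := ∀ c ∈ Ioo 0 b, ∃ C, ∀ x ∈ Ioc 0 c, |p x| ≤ C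

def BC (f : ℝ → ℝ) (b : ℝ) : ℕ → (ℝ → ℝ) → Prop
  | 0, p => ContinuousOn p (Ioo 0 b) ∧ Bdd b p
  | j+1, p => Bdd b p ∧ ∃ q, (∀ x ∈ Ioo 0 b, HasDerivAt p (q x / vf0 f x) x) ∧ BC f b j q

lemma Bdd.add {p q : ℝ → ℝ} (hp : Bdd b p) (hq : Bdd b q) : Bdd b (fun x => p x + q x) := by
  intro c hc
  obtain ⟨C, hC⟩ := hp c hc
  obtain ⟨D, hD⟩ := hq c hc
  exact ⟨C + D, fun x hx => (abs_add_le _ _).trans (add_le_add (hC x hx) (hD x hx))⟩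

lemma Bdd.mul {p q : ℝ → ℝ} (hp : Bdd b p) (hq : Bdd b q) : Bdd b (fun x => p x * q x) := by
  intro c hc
  obtain ⟨C, hC⟩ := hp c hc
  obtain ⟨D, hD⟩ := hq c hc
  refine ⟨C * D, fun x hx => ?_⟩
  rw [abs_mul]
  exact mul_le_mul (hC x hx) (hD x hx) (abs_nonneg _) ((abs_nonneg _).trans (hC x hx))

lemma Bdd.congr {p q : ℝ → ℝ} (hp : Bdd b p) (e : ∀ x ∈ Ioo 0 b, q x = p x) : Bdd b q := by
  intro c hc
  obtain ⟨C, hC⟩ := hp c hc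
  exact ⟨C, fun x hx => by rw [e x ⟨hx.1, hx.2.trans_lt hc.2⟩]; exact hC x hx⟩

lemma Bdd.const (a : ℝ) : Bdd b (fun _ => a) := fun _ _ => ⟨|a|, fun _ _ => le_rfl⟩

lemma BC.bdd {j : ℕ} {p : ℝ → ℝ} (hp : BC f b j p) : Bdd b p := by
  cases j with
  | zero => exact hp.2
  | succ j => exact hp.1

lemma BC.cont {j : ℕ} {p : ℝ → ℝ} (hp : BC f b j p) : ContinuousOn p (Ioo 0 b) := by
  cases j with
  | zero => exact hp.1
  | succ j =>
    obtain ⟨-, q, hq, -⟩ := hp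
    exact fun x hx => (hq x hx).continuousAt.continuousWithinAt

lemma BC.pred {j : ℕ} : ∀ {p : ℝ → ℝ}, BC f b (j+1) p → BC f b j p := by
  induction j with
  | zero => exact fun hp => ⟨hp.cont, hp.bdd⟩
  | succ j ih =>
    rintro p ⟨h1, q, h2, h3⟩
    exact ⟨h1, q, h2, ih h3⟩

lemma BC.congr {j : ℕ} {p q : ℝ → ℝ} (hp : BC f b j p) (e : ∀ x ∈ Ioo 0 b, q x = p x) :
    BC f b j q := by
  cases j with
  | zero => exact ⟨hp.1.congr e, hp.2.congr e⟩
  | succ j =>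
    obtain ⟨h1, r, h2, h3⟩ := hp
    refine ⟨h1.congr e, r, fun x hx => (h2 x hx).congr_of_eventuallyEq ?_, h3⟩
    filter_upwards [isOpen_Ioo.mem_nhds hx] with y hy using e y hy

lemma BC.const {j : ℕ} : ∀ (a : ℝ), BC f b j (fun _ => a) := by
  induction j with
  | zero => exact fun a => ⟨continuousOn_const, Bdd.const a⟩
  | succ j ih =>
    intro a
    exact ⟨Bdd.const a, fun _ => 0, fun x _ => by simpa using hasDerivAt_const x a, ih 0⟩

lemma BC.add {j : ℕ} : ∀ {p q : ℝ → ℝ}, BC f b j p → BC f b j q →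
    BC f b j (fun x => p x + q x) := by
  induction j with
  | zero => exact fun hp hq => ⟨hp.1.add hq.1, hp.2.add hq.2⟩
  | succ j ih =>
    rintro p q ⟨h1, p', h2, h3⟩ ⟨g1, q', g2, g3⟩
    exact ⟨h1.add g1, _, fun x hx => ((h2 x hx).add (g2 x hx)).congr_deriv (by rw [← add_div]),
      ih h3 g3⟩

lemma BC.mul {j : ℕ} : ∀ {p q : ℝ → ℝ}, BC f b j p → BC f b j q →
    BC f b j (fun x => p x * q x) := by
  induction j with
  | zero => exact fun hp hq => ⟨hp.1.mul hq.1, hp.2.mul hq.2⟩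
  | succ j ih =>
    rintro p q hp hq
    have hp0 := hp.pred
    have hq0 := hq.pred
    obtain ⟨h1, p', h2, h3⟩ := hp
    obtain ⟨g1, q', g2, g3⟩ := hq
    exact ⟨h1.mul g1, fun x => p' x * q x + p x * q' x,
      fun x hx => ((h2 x hx).mul (g2 x hx)).congr_deriv (by ring),
      (ih h3 hq0).add (ih hp0 g3)⟩

lemma BC.neg {j : ℕ} {p : ℝ → ℝ} (hp : BC f b j p) : BC f b j (fun x => - p x) :=
  ((BC.const (-1)).mul hp).congr (fun x _ => by ring)

lemma BC.sub {j : ℕ} {p q : ℝ → ℝ} (hp : BC f b j p) (hq : BC f b j q) :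
    BC f b j (fun x => p x - q x) :=
  (hp.add hq.neg).congr (fun x _ => by ring)

lemma vf0_ne (h : Ctr f b) {x : ℝ} (hx : x ∈ Ioo 0 b) : vf0 f x ≠ 0 := (h.vf0_neg hx).ne

lemma vf0_Osm (h : Ctr f b) {p : ℝ → ℝ} (hp : Bdd b p) : Osm f b (fun y => vf0 f y * p y) := by
  intro c hc
  obtain ⟨K, hK0, hK⟩ := h.exists_K
  obtain ⟨C, hC⟩ := hp c hc
  refine ⟨Real.exp (K * b) * C, fun y hy => ?_⟩
  rw [abs_mul]
  have h1 := h.vf0_bound hK hK0 ⟨hy.1, hy.2.trans_lt hc.2⟩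
  have := mul_le_mul h1 (hC y hy) (abs_nonneg _) ((abs_nonneg _).trans h1)
  linarith

lemma vf0_Bdd (h : Ctr f b) : Bdd b (vf0 f) := by
  intro c hc
  obtain ⟨K, hK0, hK⟩ := h.exists_K
  refine ⟨Real.exp (K * b) * b, fun y hy => ?_⟩
  have hy' : y ∈ Ioo 0 b := ⟨hy.1, hy.2.trans_lt hc.2⟩
  refine (h.vf0_bound hK hK0 hy').trans ?_
  refine mul_le_mul_of_nonneg_left ?_ (Real.exp_pos _).le
  linarith [(h.mem hy').1, hy'.2]

lemma eta_Bdd (h : Ctr f b) : Bdd b (fun x => vf0 f x / x) := by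
  intro c hc
  obtain ⟨K, hK0, hK⟩ := h.exists_K
  refine ⟨Real.exp (K * b), fun y hy => ?_⟩
  have hy' : y ∈ Ioo 0 b := ⟨hy.1, hy.2.trans_lt hc.2⟩
  rw [abs_div, abs_of_pos hy.1, div_le_iff₀ hy.1]
  refine (h.vf0_bound hK hK0 hy').trans ?_
  refine mul_le_mul_of_nonneg_left ?_ (Real.exp_pos _).le
  linarith [(h.mem hy').1]

lemma w0_Bdd (h : Ctr f b) : Bdd b (w0 f) := by
  intro c hc
  obtain ⟨K, hK0, hK⟩ := h.exists_K
  refine ⟨|deriv f 0 - 1| + (K * Real.exp (K * b)) * b, fun y hy => ?_⟩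
  have hy' : y ∈ Ioo 0 b := ⟨hy.1, hy.2.trans_lt hc.2⟩
  have h1 := h.w0_bound hK hK0 hy'
  have h2 : (K * Real.exp (K * b)) * y ≤ (K * Real.exp (K * b)) * b :=
    mul_le_mul_of_nonneg_left hy'.2.le (mul_nonneg hK0 (Real.exp_pos _).le)
  have h3 := abs_add_le (deriv f 0 - 1) (w0 f y - (deriv f 0 - 1))
  rw [show deriv f 0 - 1 + (w0 f y - (deriv f 0 - 1)) = w0 f y by ring] at h3
  linarith

lemma vf0_cont (h : Ctr f b) : ContinuousOn (vf0 f) (Ioo 0 b) :=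
  fun _ hx => (h.vf0_hasDeriv hx).continuousAt.continuousWithinAt

lemma BC_vf0 (h : Ctr f b) {j : ℕ} : BC f b j (w0 f) → BC f b (j+1) (vf0 f) := by
  induction j with
  | zero =>
    intro hw
    exact ⟨h.vf0_Bdd, fun x => w0 f x * vf0 f x, fun x hx => (h.vf0_hasDeriv hx).congr_deriv
      (by rw [mul_div_cancel_right₀ _ (h.vf0_ne hx)]), hw.mul ⟨h.vf0_cont, h.vf0_Bdd⟩⟩
  | succ j ih =>
    intro hw
    exact ⟨h.vf0_Bdd, fun x => w0 f x * vf0 f x, fun x hx => (h.vf0_hasDeriv hx).congr_deriv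
      (by rw [mul_div_cancel_right₀ _ (h.vf0_ne hx)]), hw.mul (ih hw.pred)⟩

lemma eta_hasDeriv (h : Ctr f b) {x : ℝ} (hx : x ∈ Ioo 0 b) : HasDerivAt (fun x => vf0 f x / x)
    ((w0 f x * (vf0 f x / x) - (vf0 f x / x) * (vf0 f x / x)) / vf0 f x) x := by
  refine ((h.vf0_hasDeriv hx).div (hasDerivAt_id x) hx.1.ne').congr_deriv ?_
  have := h.vf0_ne hx
  have := hx.1.ne'
  simp only [id]
  field_simp

lemma BC_eta (h : Ctr f b) {j : ℕ} : BC f b j (w0 f) → BC f b (j+1) (fun x => vf0 f x / x) := by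
  induction j with
  | zero =>
    intro hw
    have : BC f b 0 (fun x => vf0 f x / x) :=
      ⟨fun x hx => (h.eta_hasDeriv hx).continuousAt.continuousWithinAt, h.eta_Bdd⟩
    exact ⟨h.eta_Bdd, _, fun x hx => h.eta_hasDeriv hx, (hw.mul this).sub (this.mul this)⟩
  | succ j ih =>
    intro hw
    have := ih hw.pred
    exact ⟨h.eta_Bdd, _, fun x hx => h.eta_hasDeriv hx, (hw.mul this).sub (this.mul this)⟩

lemma smooth_Bdd {p : ℝ → ℝ} (hp : Continuous p) : Bdd b p := by
  intro c _
  obtain ⟨C, hC⟩ := (isCompact_Icc (a := 0) (b := c)).exists_bound_of_continuousOn hp.continuousOn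
  exact ⟨C, fun x hx => hC x ⟨hx.1.le, hx.2⟩⟩

lemma BC_smooth (h : Ctr f b) {j : ℕ} : ∀ {p : ℝ → ℝ}, ContDiff ℝ ∞ p → BC f b j (vf0 f) →
    BC f b (j+1) p := by
  induction j with
  | zero =>
    intro p hp hw
    have hp' := contDiff_infty_iff_deriv.1 hp
    refine ⟨smooth_Bdd hp.continuous, fun x => deriv p x * vf0 f x, fun x hx => ?_, ?_⟩
    · rw [mul_div_cancel_right₀ _ (h.vf0_ne hx)]; exact (hp'.1 x).hasDerivAt
    · exact BC.mul ⟨hp'.2.continuous.continuousOn, smooth_Bdd hp'.2.continuous⟩ hw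
  | succ j ih =>
    intro p hp hw
    have hp' := contDiff_infty_iff_deriv.1 hp
    refine ⟨smooth_Bdd hp.continuous, fun x => deriv p x * vf0 f x, fun x hx => ?_, ?_⟩
    · rw [mul_div_cancel_right₀ _ (h.vf0_ne hx)]; exact (hp'.1 x).hasDerivAt
    · exact (ih hp'.2 hw.pred).mul hw

lemma iter_hasDeriv (h : Ctr f b) (n : ℕ) {x : ℝ} (hx : x ∈ Ioo 0 b) :
    HasDerivAt (f^[n]) (vf0 f (f^[n] x) / vf0 f x) x := by
  induction n with
  | zero =>
    simp only [Function.iterate_zero, id]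
    rw [div_self (h.vf0_ne hx)]; exact hasDerivAt_id x
  | succ n ih =>
    rw [Function.iterate_succ']
    refine ((h.hasD (f^[n] x)).comp x ih).congr_deriv ?_
    rw [Function.comp_apply, h.vf0_inv (h.iter_mem hx n)]; ring

noncomputable def SM (f : ℝ → ℝ) (M : ℕ) (p : ℝ → ℝ) (x : ℝ) : ℝ :=
  (∑' n, (fun y => vf0 f y * (y ^ M * p y)) (f^[n] x)) / x ^ M

lemma SM_Bdd (h : Ctr f b) (M : ℕ) {p : ℝ → ℝ} (hp : Bdd b p) : Bdd b (SM f M p) := by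
  intro c hc
  obtain ⟨K, hK0, hK⟩ := h.exists_K
  obtain ⟨C, hC⟩ := hp c hc
  refine ⟨Real.exp (K * b) * C * b, fun x hx => ?_⟩
  have hx' : x ∈ Ioo 0 b := ⟨hx.1, hx.2.trans_lt hc.2⟩
  have hC0 : 0 ≤ C := (abs_nonneg _).trans (hC x hx)
  have := (h.sum_bound hx' (fun y => vf0 f y * (y ^ M * p y)) (C := Real.exp (K * b) * C * x ^ M)
    fun y hy => ?_).2
  · rw [SM, abs_div, abs_of_pos (pow_pos hx.1 M), div_le_iff₀ (pow_pos hx.1 M)]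
    refine this.trans ?_
    have h1 : 0 ≤ Real.exp (K * b) * C * x ^ M :=
      mul_nonneg (mul_nonneg (Real.exp_pos _).le hC0) (pow_pos hx.1 M).le
    have := mul_le_mul_of_nonneg_left hx'.2.le h1
    linarith
  · rw [abs_mul, abs_mul, abs_of_pos (pow_pos hy.1 M)]
    have h1 := h.vf0_bound hK hK0 ⟨hy.1, hy.2.trans_lt hx'.2⟩
    have h2 : y ^ M * |p y| ≤ x ^ M * C := mul_le_mul (pow_le_pow_left₀ hy.1.le hy.2 M)
      (hC y ⟨hy.1, hy.2.trans hx.2⟩) (abs_nonneg _) (pow_pos hx.1 M).le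
    have h3 := mul_le_mul h1 h2 (mul_nonneg (pow_pos hy.1 M).le (abs_nonneg _))
      ((abs_nonneg _).trans h1)
    linarith

lemma pow_Bdd (M : ℕ) : Bdd b (fun x => x ^ M) := smooth_Bdd (by fun_prop)

lemma SM_cont (h : Ctr f b) (M : ℕ) {p : ℝ → ℝ} (hp : Bdd b p) (hc : ContinuousOn p (Ioo 0 b)) :
    ContinuousOn (SM f M p) (Ioo 0 b) := by
  refine ContinuousOn.div ?_ (by fun_prop) fun x hx => (pow_pos hx.1 M).ne'
  refine h.sum_cont (h.vf0_Osm ((pow_Bdd M).mul hp)) ?_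
  exact h.vf0_cont.mul (ContinuousOn.mul (by fun_prop) hc)

lemma SM_hasDeriv (h : Ctr f b) (M : ℕ) {p p' : ℝ → ℝ} (hp : Bdd b p) (hp' : Bdd b p')
    (hd : ∀ x ∈ Ioo 0 b, HasDerivAt p (p' x / vf0 f x) x) {x : ℝ} (hx : x ∈ Ioo 0 b) :
    HasDerivAt (SM f M p) ((SM f M (fun x => (w0 f x + M * (vf0 f x / x)) * p x + p' x) x +
      -(M * (vf0 f x / x) * SM f M p x)) / vf0 f x) x := by
  have key := h.sum_deriv (q := fun y => vf0 f y * (y ^ M * p y))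
    (r := fun y => vf0 f y * (y ^ M * ((w0 f y + M * (vf0 f y / y)) * p y + p' y)))
    (ρ := fun x => (vf0 f x)⁻¹)
    (h.vf0_Osm ((pow_Bdd M).mul hp))
    (h.vf0_Osm ((pow_Bdd M).mul (((h.w0_Bdd.add ((Bdd.const _).mul h.eta_Bdd)).mul hp).add hp')))
    (h.vf0_cont.inv₀ fun x hx => h.vf0_ne hx) ?_ hx
  · have hxM := (pow_pos hx.1 M).ne'
    have := key.div (hasDerivAt_pow M x) hxM
    refine this.congr_deriv ?_
    rw [SM, SM]
    have h0 := h.vf0_ne hx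
    have h1 := hx.1.ne'
    cases M with
    | zero => simp; ring
    | succ m =>
      have alg : ∀ (A B c x v : ℝ), x ≠ 0 → v ≠ 0 →
          (A * v⁻¹ * x ^ (m+1) - B * (c * x ^ (m+1-1))) / (x ^ (m+1)) ^ 2 =
          (A / x ^ (m+1) + -(c * (v / x) * (B / x ^ (m+1)))) / v := by
        intro A B c x v hx hv
        simp only [Nat.add_sub_cancel]
        field_simp
        ring
      exact alg _ _ _ _ _ h1 h0
  · intro n y hy
    have hy' := h.iter_mem hy n
    have h1 := (h.vf0_hasDeriv hy').mul ((hasDerivAt_pow M (f^[n] y)).mul (hd _ hy'))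
    have h2 := h1.comp y (h.iter_hasDeriv n hy)
    refine h2.congr_deriv ?_
    have h0 := h.vf0_ne hy'
    have h00 := h.vf0_ne hy
    have h3 := hy'.1.ne'
    cases M with
    | zero => simp; field_simp
    | succ m =>
      simp only [Nat.add_sub_cancel]
      field_simp
      simp only [Pi.mul_apply]
      ring

lemma BC_SM (h : Ctr f b) (M : ℕ) {j : ℕ} : ∀ {p : ℝ → ℝ}, BC f b (j+1) p → BC f b j (w0 f) →
    BC f b (j+1) (SM f M p) := by
  induction j with
  | zero =>
    rintro p ⟨h1, p', h2, h3⟩ hw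
    have hp : BC f b 0 p := BC.pred ⟨h1, p', h2, h3⟩
    have he := (h.BC_eta hw).pred
    have hM : BC f b 0 (fun x => (M:ℝ) * (vf0 f x / x)) := (BC.const _).mul he
    have h4 : BC f b 0 (fun x => (w0 f x + M * (vf0 f x / x)) * p x + p' x) :=
      ((hw.add hM).mul hp).add h3
    refine ⟨h.SM_Bdd M h1, _, fun x hx => h.SM_hasDeriv M h1 h3.bdd h2 hx, BC.add ?_ (BC.neg ?_)⟩
    · exact ⟨h.SM_cont M h4.2 h4.1, h.SM_Bdd M h4.2⟩
    · exact hM.mul ⟨h.SM_cont M hp.2 hp.1, h.SM_Bdd M hp.2⟩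
  | succ j ih =>
    rintro p ⟨h1, p', h2, h3⟩ hw
    have hp : BC f b (j+1) p := BC.pred ⟨h1, p', h2, h3⟩
    have he := (h.BC_eta hw).pred
    have hM : BC f b (j+1) (fun x => (M:ℝ) * (vf0 f x / x)) := (BC.const _).mul he
    have h4 : BC f b (j+1) (fun x => (w0 f x + M * (vf0 f x / x)) * p x + p' x) :=
      ((hw.add hM).mul hp).add h3
    refine ⟨h.SM_Bdd M h1, _, fun x hx => h.SM_hasDeriv M h1 h3.bdd h2 hx, BC.add ?_ (BC.neg ?_)⟩
    · exact ih h4 hw.pred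
    · exact hM.mul (ih hp hw.pred)

lemma BC_w0 (h : Ctr f b) (j : ℕ) : BC f b j (w0 f) := by
  have e : ∀ x ∈ Ioo 0 b, w0 f x = (deriv f 0 - 1) - SM f 0 (F f) x := by
    intro x _
    simp [w0, SM, mul_comm]
  induction j with
  | zero =>
    refine BC.congr ((BC.const _).sub (q := SM f 0 (F f)) ⟨?_, ?_⟩) e
    · exact h.SM_cont 0 (smooth_Bdd h.F_smooth.continuous) h.F_smooth.continuous.continuousOn
    · exact h.SM_Bdd 0 (smooth_Bdd h.F_smooth.continuous)
  | succ j ih =>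
    exact BC.congr ((BC.const _).sub (h.BC_SM 0 (h.BC_smooth h.F_smooth (h.BC_vf0 ih).pred) ih)) e

lemma BC_vf (h : Ctr f b) (j : ℕ) : BC f b j (vf0 f) := (h.BC_vf0 (h.BC_w0 j)).pred

lemma BC_eta' (h : Ctr f b) (j : ℕ) : BC f b j (fun x => vf0 f x / x) := (h.BC_eta (h.BC_w0 j)).pred

lemma BC_smooth' (h : Ctr f b) (j : ℕ) {p : ℝ → ℝ} (hp : ContDiff ℝ ∞ p) : BC f b j p :=
  (h.BC_smooth hp (h.BC_vf j)).pred

lemma BC_SM' (h : Ctr f b) (M : ℕ) (j : ℕ) {p : ℝ → ℝ} (hp : BC f b (j+1) p) :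
    BC f b (j+1) (SM f M p) := h.BC_SM M hp (h.BC_w0 j)

lemma BC.contDiffOn (h : Ctr f b) {j : ℕ} : ∀ {p : ℝ → ℝ}, BC f b j p →
    ContDiffOn ℝ j p (Ioo 0 b) := by
  induction j with
  | zero => intro p hp; simpa using hp.1
  | succ j ih =>
    rintro p ⟨h1, q, h2, h3⟩
    have h4 : ContDiffOn ℝ j (vf0 f) (Ioo 0 b) := ih (h.BC_vf j)
    have := (ih h3).div h4 fun x hx => h.vf0_ne hx
    push_cast
    rw [contDiffOn_succ_iff_deriv_of_isOpen isOpen_Ioo]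
    refine ⟨fun x hx => (h2 x hx).differentiableAt.differentiableWithinAt, by simp, ?_⟩
    exact this.congr fun x hx => (h2 x hx).deriv

lemma vf0_smooth (h : Ctr f b) : ContDiffOn ℝ ∞ (vf0 f) (Ioo 0 b) :=
  contDiffOn_infty.2 fun j => BC.contDiffOn h (h.BC_vf j)

end Ctr

namespace Ctr
variable {f : ℝ → ℝ} {b : ℝ}

lemma vf0_ratio (h : Ctr f b) : Tendsto (fun x => vf0 f x / (f x - x)) (𝓝[>] 0) (𝓝 1) := by
  obtain ⟨K, hK0, hK⟩ := h.exists_K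
  have hmem : ∀ᶠ x in 𝓝[>] (0:ℝ), x ∈ Ioo 0 b := Ioo_mem_nhdsGT h.bpos
  have h1 : Tendsto (fun x => LL f x) (𝓝[>] 0) (𝓝 0) := by
    have h2 : Tendsto (fun x => K * x) (𝓝[>] (0:ℝ)) (𝓝 0) := by
      have : Tendsto (fun x => K * x) (𝓝 (0:ℝ)) (𝓝 (K * 0)) := (continuous_const_mul K).tendsto 0
      rw [mul_zero] at this
      exact this.mono_left nhdsWithin_le_nhds
    refine squeeze_zero_norm' ?_ h2
    filter_upwards [hmem] with x hx using h.LL_bound hK hK0 hx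
  have h2 := (Real.continuous_exp.tendsto 0).comp h1
  rw [Real.exp_zero] at h2
  refine h2.congr' ?_
  filter_upwards [hmem] with x hx
  have : f x - x ≠ 0 := by linarith [h.lt x hx]
  rw [vf0, Function.comp_apply, mul_div_cancel_left₀ _ this]

lemma w0_tendsto (h : Ctr f b) : Tendsto (w0 f) (𝓝[>] 0) (𝓝 (deriv f 0 - 1)) := by
  obtain ⟨K, hK0, hK⟩ := h.exists_K
  have hmem : ∀ᶠ x in 𝓝[>] (0:ℝ), x ∈ Ioo 0 b := Ioo_mem_nhdsGT h.bpos
  rw [tendsto_iff_norm_sub_tendsto_zero]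
  have h2 : Tendsto (fun x => (K * Real.exp (K * b)) * x) (𝓝[>] (0:ℝ)) (𝓝 0) := by
    have : Tendsto (fun x => (K * Real.exp (K * b)) * x) (𝓝 (0:ℝ)) (𝓝 ((K * Real.exp (K * b)) * 0)) :=
      (continuous_const_mul _).tendsto 0
    rw [mul_zero] at this
    exact this.mono_left nhdsWithin_le_nhds
  refine squeeze_zero' (Eventually.of_forall fun _ => norm_nonneg _) ?_ h2
  filter_upwards [hmem] with x hx using h.w0_bound hK hK0 hx

lemma iter_tendsto' (h : Ctr f b) {x : ℝ} (hx : x ∈ Ioo 0 b) :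
    Tendsto (fun n => f^[n] x) atTop (𝓝[>] 0) :=
  tendsto_nhdsWithin_iff.2 ⟨h.iter_tendsto hx, Eventually.of_forall fun n => (h.iter_mem hx n).1⟩

/-- squeezing: if `c x` lies between `f x` and `x` then it tends to zero. -/
lemma tendsto_between (h : Ctr f b) {c : ℝ → ℝ}
    (hc : ∀ x ∈ Ioo 0 b, f x ≤ c x ∧ c x ≤ x) : Tendsto c (𝓝[>] 0) (𝓝[>] 0) := by
  have hmem : ∀ᶠ x in 𝓝[>] (0:ℝ), x ∈ Ioo 0 b := Ioo_mem_nhdsGT h.bpos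
  refine tendsto_nhdsWithin_iff.2 ⟨?_, ?_⟩
  · refine tendsto_of_tendsto_of_tendsto_of_le_of_le' tendsto_const_nhds
      (h := fun x => x) (tendsto_id.mono_left nhdsWithin_le_nhds) ?_ ?_
    · filter_upwards [hmem] with x hx using (h.mem hx).1.le.trans (hc x hx).1
    · filter_upwards [hmem] with x hx using (hc x hx).2
  · filter_upwards [hmem] with x hx using (h.mem hx).1.trans_le (hc x hx).1

lemma vf0_commute (h : Ctr f b) {g : ℝ → ℝ} (hg : ContDiff ℝ ∞ g) (hgd : ∀ x, 0 < deriv g x)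
    (hg0 : g 0 = 0) (hgm : ∀ x ∈ Ioo 0 b, g x ∈ Ioo 0 b)
    (hc : ∀ x ∈ Ioo 0 b, g (f x) = f (g x)) {x : ℝ} (hx : x ∈ Ioo 0 b) :
    vf0 f (g x) = deriv g x * vf0 f x := by
  have hmem : ∀ᶠ x in 𝓝[>] (0:ℝ), x ∈ Ioo 0 b := Ioo_mem_nhdsGT h.bpos
  have hgD : ∀ x, HasDerivAt g (deriv g x) x := fun x =>
    ((contDiff_infty_iff_deriv.1 hg).1 x).hasDerivAt
  have hgdc : Continuous (deriv g) := (contDiff_infty_iff_deriv.1 hg).2.continuous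
  set c : ℝ → ℝ := fun x => vf0 f (g x) / (deriv g x * vf0 f x) with hcdef
  have inv : ∀ y ∈ Ioo 0 b, c (f y) = c y := by
    intro y hy
    have e1 : deriv g (f y) * deriv f y = deriv f (g y) * deriv g y := by
      have d1 : HasDerivAt (fun y => g (f y)) (deriv g (f y) * deriv f y) y :=
        (hgD (f y)).comp y (h.hasD y)
      have d2 : HasDerivAt (fun y => f (g y)) (deriv f (g y) * deriv g y) y :=
        (h.hasD (g y)).comp y (hgD y)
      refine d1.unique (d2.congr_of_eventuallyEq ?_)
      filter_upwards [isOpen_Ioo.mem_nhds hy] with z hz using hc z hz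
    simp only [hcdef]
    rw [hc y hy, h.vf0_inv (hgm y hy), h.vf0_inv hy]
    rw [show deriv g (f y) * (deriv f y * vf0 f y) = deriv f (g y) * (deriv g y * vf0 f y) by
      rw [← mul_assoc, e1, mul_assoc]]
    rw [mul_div_mul_left _ _ (h.dpos _).ne']
  have inv' : ∀ n, c (f^[n] x) = c x := by
    intro n
    induction n with
    | zero => rfl
    | succ n ih => rw [Function.iterate_succ_apply', inv _ (h.iter_mem hx n), ih]
  have lim : Tendsto c (𝓝[>] 0) (𝓝 1) := by
    have hmvt : ∀ y : ℝ, ∃ d : ℝ, y ∈ Ioo 0 b →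
        (f y ≤ d ∧ d ≤ y) ∧ deriv g d = (f (g y) - g y) / (f y - y) := by
      intro y
      by_cases hy : y ∈ Ioo 0 b
      · obtain ⟨d, hd, e⟩ := exists_hasDerivAt_eq_slope g (deriv g) (h.lt y hy)
          (hg.continuous.continuousOn) (fun z _ => hgD z)
        refine ⟨d, fun _ => ⟨⟨hd.1.le, hd.2.le⟩, ?_⟩⟩
        rw [e, ← hc y hy, ← neg_sub, ← neg_sub (f y) y, neg_div_neg_eq]
      · exact ⟨0, fun h => absurd h hy⟩
    choose d hd using hmvt
    have hd0 := h.tendsto_between (fun x hx => (hd x hx).1)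
    have l1 : Tendsto (fun y => deriv g (d y)) (𝓝[>] 0) (𝓝 (deriv g 0)) :=
      (hgdc.tendsto 0).comp (hd0.mono_right nhdsWithin_le_nhds)
    have l2 : Tendsto (deriv g) (𝓝[>] 0) (𝓝 (deriv g 0)) :=
      (hgdc.tendsto 0).mono_left nhdsWithin_le_nhds
    have hg0' : Tendsto g (𝓝[>] 0) (𝓝[>] 0) := by
      refine tendsto_nhdsWithin_iff.2 ⟨?_, ?_⟩
      · have := hg.continuous.tendsto 0
        rw [hg0] at this
        exact this.mono_left nhdsWithin_le_nhds
      · filter_upwards [hmem] with y hy using (hgm y hy).1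
    have l3 := h.vf0_ratio.comp hg0'
    have l4 := h.vf0_ratio
    have := (l3.div l4 one_ne_zero).mul (l1.div l2 (hgd 0).ne')
    rw [div_self one_ne_zero, div_self (hgd 0).ne', one_mul] at this
    refine this.congr' ?_
    filter_upwards [hmem] with y hy
    simp only [Function.comp_apply, hcdef, Pi.div_apply]
    rw [(hd y hy).2]
    have a1 : f y - y ≠ 0 := by linarith [h.lt y hy]
    have a2 : f (g y) - g y ≠ 0 := by linarith [h.lt _ (hgm y hy)]
    have a3 := h.vf0_ne hy
    have a4 := (hgd y).ne'
    field_simp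
  have := tendsto_nhds_unique ((lim.comp (h.iter_tendsto' hx)).congr inv') tendsto_const_nhds
  have a3 := h.vf0_ne hx
  have a4 := (hgd x).ne'
  have e : vf0 f (g x) / (deriv g x * vf0 f x) = 1 := this.symm
  rw [div_eq_one_iff_eq (mul_ne_zero a4 a3)] at e
  exact e

noncomputable def tau0 (f : ℝ → ℝ) (b : ℝ) (x : ℝ) : ℝ := ∫ t in (b/2)..x, (vf0 f t)⁻¹

lemma tau0_hasDeriv (h : Ctr f b) {x : ℝ} (hx : x ∈ Ioo 0 b) :
    HasDerivAt (tau0 f b) (vf0 f x)⁻¹ x := by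
  have hc : ContinuousOn (fun t => (vf0 f t)⁻¹) (Ioo 0 b) :=
    h.vf0_cont.inv₀ fun x hx => h.vf0_ne hx
  have hb : b/2 ∈ Ioo 0 b := ⟨by linarith [h.bpos], by linarith [h.bpos]⟩
  refine intervalIntegral.integral_hasDerivAt_right ?_ ?_ ?_
  · exact (hc.mono ((ordConnected_Ioo (a := 0) (b := b)).uIcc_subset hb hx)).intervalIntegrable
  · exact hc.stronglyMeasurableAtFilter isOpen_Ioo x hx
  · exact hc.continuousAt (isOpen_Ioo.mem_nhds hx)

lemma tau0_shift (h : Ctr f b) : ∃ T, ∀ x ∈ Ioo 0 b, tau0 f b (f x) = tau0 f b x + T := by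
  have hb : b/2 ∈ Ioo 0 b := ⟨by linarith [h.bpos], by linarith [h.bpos]⟩
  refine ⟨tau0 f b (f (b/2)) - tau0 f b (b/2), fun x hx => ?_⟩
  have key := (convex_Ioo 0 b).is_const_of_fderivWithin_eq_zero (𝕜 := ℝ)
    (f := fun x => tau0 f b (f x) - tau0 f b x) (x := x) (y := b/2) ?_ ?_ hx hb
  · linarith
  all_goals
    have : ∀ y ∈ Ioo 0 b, HasDerivAt (fun x => tau0 f b (f x) - tau0 f b x) 0 y := by
      intro y hy
      refine (((h.tau0_hasDeriv (h.mem hy)).comp y (h.hasD y)).sub (h.tau0_hasDeriv hy)).congr_deriv ?_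
      rw [h.vf0_inv hy]
      have := h.vf0_ne hy
      have := (h.dpos y).ne'
      field_simp
      ring
  · exact fun y hy => (this y hy).differentiableAt.differentiableWithinAt
  · intro y hy
    have := (this y hy).hasFDerivAt.hasFDerivWithinAt (s := Ioo 0 b)
    rw [this.fderivWithin (isOpen_Ioo.uniqueDiffWithinAt hy)]
    ext; simp

lemma deriv_zero_le (h : Ctr f b) : deriv f 0 ≤ 1 := by
  have := (h.hasD 0).hasDerivWithinAt (s := Ioi 0)
  rw [hasDerivWithinAt_iff_tendsto_slope' (by simp)] at this
  refine le_of_tendsto this ?_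
  filter_upwards [Ioo_mem_nhdsGT h.bpos] with x hx
  rw [slope_def_field, h.zero, sub_zero, sub_zero, div_le_one hx.1]
  exact (h.lt x hx).le

/-- the normalising constant -/
lemma T_spec (h : Ctr f b) {T : ℝ} (hT : ∀ x ∈ Ioo 0 b, tau0 f b (f x) = tau0 f b x + T) :
    0 < T ∧ T * (deriv f 0 - 1) = Real.log (deriv f 0) ∧ (deriv f 0 = 1 → T = 1) := by
  have hmem : ∀ᶠ x in 𝓝[>] (0:ℝ), x ∈ Ioo 0 b := Ioo_mem_nhdsGT h.bpos
  have sub : ∀ x ∈ Ioo 0 b, ∀ z ∈ Icc (f x) x, z ∈ Ioo 0 b := fun x hx z hz =>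
    ⟨(h.mem hx).1.trans_le hz.1, hz.2.trans_lt hx.2⟩
  -- f x - x = ξ(c) T
  have m1 : ∀ x : ℝ, ∃ c : ℝ, x ∈ Ioo 0 b → (f x ≤ c ∧ c ≤ x) ∧ f x - x = vf0 f c * T := by
    intro x
    by_cases hx : x ∈ Ioo 0 b
    · obtain ⟨c, hc, e⟩ := exists_ratio_hasDerivAt_eq_ratio_slope (tau0 f b) (fun x => (vf0 f x)⁻¹)
        (h.lt x hx) (fun z hz => (h.tau0_hasDeriv (sub x hx z hz)).continuousAt.continuousWithinAt)
        (fun z hz => h.tau0_hasDeriv (sub x hx z (Ioo_subset_Icc_self hz)))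
        (fun x => x) (fun _ => 1) continuousOn_id (fun z _ => hasDerivAt_id z)
      refine ⟨c, fun _ => ⟨⟨hc.1.le, hc.2.le⟩, ?_⟩⟩
      have := h.vf0_ne (sub x hx c (Ioo_subset_Icc_self hc))
      rw [hT x hx] at e
      field_simp at e
      linarith
    · exact ⟨0, fun h => absurd h hx⟩
  have hTpos : 0 < T := by
    obtain ⟨x, hx⟩ := hmem.exists
    obtain ⟨c, hc⟩ := m1 x
    obtain ⟨h1, h2⟩ := hc hx
    have h3 := h.vf0_neg (sub x hx c h1)
    have h4 := h.lt x hx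
    by_contra hh
    push Not at hh
    nlinarith
  refine ⟨hTpos, ?_, ?_⟩
  · have m2 : ∀ x : ℝ, ∃ c : ℝ, x ∈ Ioo 0 b → (f x ≤ c ∧ c ≤ x) ∧
        Real.log (deriv f x) = w0 f c * T := by
      intro x
      by_cases hx : x ∈ Ioo 0 b
      · have hd : ∀ z ∈ Icc (f x) x, HasDerivAt (fun y => Real.log (vf0 f y)) (w0 f z / vf0 f z) z :=
          fun z hz => (h.vf0_hasDeriv (sub x hx z hz)).log (h.vf0_ne (sub x hx z hz))
        obtain ⟨c, hc, e⟩ := exists_ratio_hasDerivAt_eq_ratio_slope (tau0 f b)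
          (fun x => (vf0 f x)⁻¹) (h.lt x hx)
          (fun z hz => (h.tau0_hasDeriv (sub x hx z hz)).continuousAt.continuousWithinAt)
          (fun z hz => h.tau0_hasDeriv (sub x hx z (Ioo_subset_Icc_self hz)))
          (fun y => Real.log (vf0 f y)) (fun z => w0 f z / vf0 f z)
          (fun z hz => (hd z hz).continuousAt.continuousWithinAt)
          (fun z hz => hd z (Ioo_subset_Icc_self hz))
        refine ⟨c, fun _ => ⟨⟨hc.1.le, hc.2.le⟩, ?_⟩⟩
        have := h.vf0_ne (sub x hx c (Ioo_subset_Icc_self hc))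
        rw [hT x hx, h.vf0_inv hx, Real.log_mul (h.dpos x).ne' (h.vf0_ne hx)] at e
        field_simp at e
        linarith
      · exact ⟨0, fun h => absurd h hx⟩
    choose c hc using m2
    have hc0 := h.tendsto_between (fun x hx => (hc x hx).1)
    have l1 := (h.w0_tendsto.comp hc0).mul_const T
    have l2 : Tendsto (fun x => Real.log (deriv f x)) (𝓝[>] 0) (𝓝 (Real.log (deriv f 0))) :=
      ((h.smoothD.continuous.log fun x => (h.dpos x).ne').tendsto 0).mono_left nhdsWithin_le_nhds
    rw [mul_comm]
    refine tendsto_nhds_unique (l1.congr' ?_) l2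
    filter_upwards [hmem] with x hx using ((hc x hx).2).symm
  · intro hl1
    -- ratio ξ(c)/(f x - x) = 1/T tends to one
    choose c hc using m1
    have hc0 := h.tendsto_between (fun x hx => (hc x hx).1)
    have m3 : ∀ x : ℝ, ∃ d : ℝ, x ∈ Ioo 0 b → (f x ≤ d ∧ d ≤ x) ∧
        vf0 f x - vf0 f (c x) = w0 f d * (x - c x) := by
      intro x
      by_cases hx : x ∈ Ioo 0 b
      · rcases eq_or_lt_of_le (hc x hx).1.2 with e | e
        · exact ⟨x, fun _ => ⟨⟨(h.lt x hx).le, le_rfl⟩, by rw [e]; ring⟩⟩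
        · have s2 : ∀ z ∈ Icc (c x) x, z ∈ Ioo 0 b := fun z hz =>
            sub x hx z ⟨(hc x hx).1.1.trans hz.1, hz.2⟩
          obtain ⟨d, hd, e'⟩ := exists_hasDerivAt_eq_slope (vf0 f) (w0 f) e
            (fun z hz => (h.vf0_hasDeriv (s2 z hz)).continuousAt.continuousWithinAt)
            (fun z hz => h.vf0_hasDeriv (s2 z (Ioo_subset_Icc_self hz)))
          refine ⟨d, fun _ => ⟨⟨(hc x hx).1.1.trans hd.1.le, hd.2.le⟩, ?_⟩⟩
          rw [e', div_mul_cancel₀ _ (by linarith)]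
      · exact ⟨0, fun h => absurd h hx⟩
    choose d hd using m3
    have hd0 := h.tendsto_between (fun x hx => (hd x hx).1)
    have l1 := h.w0_tendsto.comp hd0
    rw [hl1, sub_self] at l1
    have l2 : Tendsto (fun x => w0 f (d x) * ((x - c x) / (f x - x))) (𝓝[>] 0) (𝓝 0) := by
      have l1' := l1.norm
      rw [norm_zero] at l1'
      refine squeeze_zero_norm' ?_ l1'
      filter_upwards [hmem] with x hx
      have hx1 := h.lt x hx
      have hx2 := (hc x hx).1
      rw [norm_mul, Function.comp_apply]
      refine mul_le_of_le_one_right (norm_nonneg _) ?_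
      rw [Real.norm_eq_abs, abs_div, abs_of_nonneg (by linarith), abs_of_neg (by linarith),
        div_le_one (by linarith)]
      linarith
    have l3 := (h.vf0_ratio.sub l2).mul_const T
    have l4 : Tendsto (fun _ : ℝ => (1:ℝ)) (𝓝[>] 0) (𝓝 ((1 - 0) * T)) := by
      refine l3.congr' ?_
      filter_upwards [hmem] with x hx
      have hx1 : f x - x ≠ 0 := by linarith [h.lt x hx]
      have e1 := (hd x hx).2
      have e2 := (hc x hx).2
      rw [← mul_div_assoc, ← sub_div, ← e1, sub_sub_cancel, div_mul_eq_mul_div, ← e2, div_self hx1]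
    have := tendsto_nhds_unique l4 tendsto_const_nhds
    linarith

end Ctr

/-- The formal vector field up to any order. -/
lemma formal_vf (f A : ℝ → ℝ) (k : ℕ) (hA : ContDiff ℝ ∞ A)
    (hf : ∀ x, f x = x + x ^ (k+1) * A x) (hA0 : A 0 ≠ 0) (hpos : k = 0 → 0 < 1 + A 0) (n : ℕ) :
    ∃ X1 E : ℝ → ℝ, ContDiff ℝ ∞ X1 ∧ X1 0 = 1 ∧ ContDiff ℝ ∞ E ∧
      ∀ x, (f x) ^ (k+1) * X1 (f x) - deriv f x * (x ^ (k+1) * X1 x) = x ^ (2*k+2+n) * E x := by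
  have hA' := contDiff_infty_iff_deriv.1 hA
  have hd : ∀ x, deriv f x = 1 + ((k+1:ℕ) * x ^ k * A x + x ^ (k+1) * deriv A x) := by
    intro x
    have e : f = fun x => x + x ^ (k+1) * A x := funext hf
    rw [e]
    refine HasDerivAt.deriv ?_
    refine ((hasDerivAt_id x).add ((hasDerivAt_pow (k+1) x).mul (hA'.1 x).hasDerivAt)).congr_deriv ?_
    simp
  set H : ℕ → ℝ → ℝ := fun m x =>
    A x * (∑ i ∈ Finset.range m, (1 + x ^ k * A x) ^ i) - (k+1:ℕ) * A x - x * deriv A x with hH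
  have hHs : ∀ m, ContDiff ℝ ∞ (H m) := by
    intro m
    have h1 : ContDiff ℝ ∞ (fun x => x ^ k * A x) := (contDiff_id.pow k).mul hA
    have h2 : ContDiff ℝ ∞ (fun x => ∑ i ∈ Finset.range m, (1 + x ^ k * A x) ^ i) :=
      ContDiff.sum fun i _ => (contDiff_const.add h1).pow i
    exact ((hA.mul h2).sub (contDiff_const.mul hA)).sub (contDiff_id.mul hA'.2)
  have hHe : ∀ m x, (f x) ^ m - deriv f x * x ^ m = x ^ (m+k) * H m x := by
    intro m x
    have h1 : f x = x * (1 + x ^ k * A x) := by rw [hf]; ring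
    have h2 := mul_geom_sum (1 + x ^ k * A x) m
    rw [h1, mul_pow, hd]
    have h3 : (1 + x ^ k * A x) ^ m = 1 + x ^ k * A x *
        ∑ i ∈ Finset.range m, (1 + x ^ k * A x) ^ i := by linarith
    rw [h3]
    simp only [hH]
    ring
  have hH0 : ∀ m, k + 2 ≤ m → H m 0 ≠ 0 := by
    intro m hm
    simp only [hH]
    rcases Nat.eq_zero_or_pos k with rfl | hk
    · have h1 := hpos rfl
      obtain ⟨m', rfl⟩ : ∃ m', m = m' + 2 := ⟨m - 2, by omega⟩
      rw [Finset.sum_range_succ', pow_zero, one_mul]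
      have h2 : 0 < ∑ i ∈ Finset.range (m' + 1), (1 + A 0) ^ (i+1) := by
        refine Finset.sum_pos (fun i _ => pow_pos h1 _) ⟨0, by simp⟩
      have e : A 0 * (∑ i ∈ Finset.range (m' + 1), (1 + A 0) ^ (i + 1) + (1 + A 0) ^ 0) -
          ((0 + 1 : ℕ):ℝ) * A 0 - 0 * deriv A 0 = A 0 * ∑ i ∈ Finset.range (m' + 1), (1 + A 0) ^ (i + 1) := by
        push_cast; ring
      rw [e]
      exact mul_ne_zero hA0 h2.ne'
    · rw [zero_pow hk.ne']
      have e : A 0 * (∑ i ∈ Finset.range m, (1 + 0 * A 0) ^ i) - ((k + 1 : ℕ):ℝ) * A 0 - 0 * deriv A 0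
          = A 0 * (m - (k+1)) := by
        simp; ring
      rw [e]
      refine mul_ne_zero hA0 ?_
      have : ((k + 2 : ℕ):ℝ) ≤ m := by exact_mod_cast hm
      push_cast at this
      intro h0
      linarith
  have hHk : H (k+1) 0 = 0 := by
    simp only [hH]
    rcases Nat.eq_zero_or_pos k with rfl | hk
    · simp
    · rw [zero_pow hk.ne']; simp; ring
  induction n with
  | zero =>
    obtain ⟨E, hE, e⟩ := hadamard 0 (H (k+1)) (hHs _) hHk
    refine ⟨fun _ => 1, E, contDiff_const, rfl, hE, fun x => ?_⟩
    have := hHe (k+1) x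
    rw [e x] at this
    simp only [mul_one]
    rw [this]; ring
  | succ n ih =>
    obtain ⟨X1, E, hX1, hX10, hE, e⟩ := ih
    have hm := hH0 (k+2+n) (by omega)
    set c := - E 0 / H (k+2+n) 0 with hc
    obtain ⟨E', hE', e'⟩ := hadamard 0 (fun x => E x + c * H (k+2+n) x)
      (hE.add (contDiff_const.mul (hHs _))) (by simp only [hc]; field_simp; ring)
    refine ⟨fun x => X1 x + c * x ^ (n+1), E', hX1.add (contDiff_const.mul (contDiff_id.pow _)),
      by simp [hX10], hE', fun x => ?_⟩
    have h1 := e x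
    have h2 := hHe (k+2+n) x
    have h3 := e' x
    have h4 : f x ^ (k + 1) * (X1 (f x) + c * f x ^ (n + 1)) -
        deriv f x * (x ^ (k + 1) * (X1 x + c * x ^ (n + 1))) =
        (f x ^ (k + 1) * X1 (f x) - deriv f x * (x ^ (k + 1) * X1 x)) +
        c * (f x ^ (k+2+n) - deriv f x * x ^ (k+2+n)) := by ring
    rw [h4, h1, h2]
    have h5 : x ^ (2*k+2+n) * E x + c * (x ^ (k+2+n+k) * H (k+2+n) x) =
      x ^ (2*k+2+n) * (E x + c * H (k+2+n) x) := by ring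
    rw [h5, h3]; ring

namespace Ctr
variable {f : ℝ → ℝ} {b : ℝ}

lemma BC_ode {p s : ℝ → ℝ} (hp : Bdd b p) (hs : ∀ j, BC f b j s)
    (hd : ∀ x ∈ Ioo 0 b, HasDerivAt p (s x * p x / vf0 f x) x) (j : ℕ) : BC f b j p := by
  induction j with
  | zero => exact ⟨fun x hx => (hd x hx).continuousAt.continuousWithinAt, hp⟩
  | succ j ih => exact ⟨hp, _, hd, (hs j).mul ih⟩

variable {A : ℝ → ℝ} {k : ℕ}

lemma A_bounds (h : Ctr f b) (hA : Continuous A) (hf : ∀ x, f x = x + x ^ (k+1) * A x)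
    (hA0 : A 0 ≠ 0) :
    Bdd b (fun x => (A x)⁻¹) := by
  intro c hc
  have hne : ∀ x ∈ Icc 0 c, A x ≠ 0 := by
    intro x hx h0
    rcases eq_or_lt_of_le hx.1 with e | e
    · rw [← e] at h0; exact hA0 h0
    · have := h.lt x ⟨e, hx.2.trans_lt hc.2⟩
      rw [hf x, h0] at this
      simp at this
  obtain ⟨C, hC⟩ := (isCompact_Icc (a := 0) (b := c)).exists_bound_of_continuousOn
    (hA.continuousOn.inv₀ hne)
  exact ⟨C, fun x hx => hC x ⟨hx.1.le, hx.2⟩⟩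

lemma expLL_Bdd (h : Ctr f b) : Bdd b (fun x => Real.exp (LL f x)) ∧
    Bdd b (fun x => Real.exp (- LL f x)) := by
  obtain ⟨K, hK0, hK⟩ := h.exists_K
  have : ∀ x ∈ Ioo 0 b, |LL f x| ≤ K * b := fun x hx =>
    (h.LL_bound hK hK0 hx).trans (mul_le_mul_of_nonneg_left hx.2.le hK0)
  constructor <;> intro c hc <;> refine ⟨Real.exp (K * b), fun x hx => ?_⟩ <;>
    rw [abs_of_pos (Real.exp_pos _), Real.exp_le_exp] <;>
    have := abs_le.1 (this x ⟨hx.1, hx.2.trans_lt hc.2⟩) <;> linarith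

lemma vf0_eq (hf : ∀ x, f x = x + x ^ (k+1) * A x) (x : ℝ) :
    vf0 f x = x ^ (k+1) * (A x * Real.exp (LL f x)) := by
  rw [vf0, hf x]; ring

lemma BC_y (h : Ctr f b) (hA : Continuous A) (hf : ∀ x, f x = x + x ^ (k+1) * A x) (j : ℕ) :
    BC f b j (fun x => vf0 f x / x ^ (k+1)) := by
  refine BC_ode (s := fun x => w0 f x - (k+1:ℕ) * (vf0 f x / x)) ?_
    (fun j => (h.BC_w0 j).sub ((BC.const _).mul (h.BC_eta' j))) ?_ j
  · refine ((smooth_Bdd hA).mul h.expLL_Bdd.1).congr fun x hx => ?_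
    rw [vf0_eq hf, mul_div_cancel_left₀ _ (pow_pos hx.1 _).ne']
  · intro x hx
    refine ((h.vf0_hasDeriv hx).div (hasDerivAt_pow (k+1) x) (pow_pos hx.1 _).ne').congr_deriv ?_
    have h1 := h.vf0_ne hx
    have h2 := hx.1.ne'
    simp only [Nat.add_sub_cancel]
    field_simp
    ring

lemma BC_yinv (h : Ctr f b) (hA : Continuous A) (hf : ∀ x, f x = x + x ^ (k+1) * A x)
    (hA0 : A 0 ≠ 0) (j : ℕ) : BC f b j (fun x => x ^ (k+1) / vf0 f x) := by
  refine BC_ode (s := fun x => (k+1:ℕ) * (vf0 f x / x) - w0 f x) ?_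
    (fun j => ((BC.const _).mul (h.BC_eta' j)).sub (h.BC_w0 j)) ?_ j
  · refine ((h.A_bounds hA hf hA0).mul h.expLL_Bdd.2).congr fun x hx => ?_
    rw [vf0_eq hf, Real.exp_neg, ← mul_inv, div_mul_cancel_left₀ (pow_pos hx.1 _).ne']
  · intro x hx
    refine ((hasDerivAt_pow (k+1) x).div (h.vf0_hasDeriv hx) (h.vf0_ne hx)).congr_deriv ?_
    have h1 := h.vf0_ne hx
    have h2 := hx.1.ne'
    simp only [Nat.add_sub_cancel]
    field_simp
    ring

/-- derivatives of `x^M q` with `q ∈ BC∞` -/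
lemma iter_xMq (h : Ctr f b) (hA : Continuous A) (hf : ∀ x, f x = x + x ^ (k+1) * A x)
    (hA0 : A 0 ≠ 0) (r : ℕ) : ∀ (j : ℕ) (η : ℝ → ℝ), (∃ q, BC f b (r + j) q ∧ ∀ x ∈ Ioo 0 b,
      η x = x ^ ((r+j+1) * (k+1)) * q x) →
      ∃ q, BC f b r q ∧ ∀ x ∈ Ioo 0 b, iteratedDeriv j η x = x ^ ((r+1) * (k+1)) * q x := by
  intro j
  induction j with
  | zero => rintro η ⟨q, hq, e⟩; exact ⟨q, hq, by simpa using e⟩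
  | succ j ih =>
    rintro η ⟨q, hq, e⟩
    have hq0 : BC f b (r + j) q := BC.pred hq
    obtain ⟨hb, q', hq', hq''⟩ := hq
    rw [iteratedDeriv_succ']
    refine ih (deriv η) ⟨fun x => (((r + j + 1 + 1) * (k+1) : ℕ) : ℝ) * x ^ k * q x
      + q' x * (x ^ (k+1) / vf0 f x), ?_, ?_⟩
    · exact (((BC.const _).mul (h.BC_smooth' (r+j) (contDiff_id.pow k))).mul hq0).add
        (BC.mul hq'' (h.BC_yinv hA hf hA0 _))
    · intro x hx
      have hd : HasDerivAt (fun x => x ^ ((r+(j+1)+1) * (k+1)) * q x) _ x :=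
        (hasDerivAt_pow _ x).mul (hq' x hx)
      have hd' : HasDerivAt η _ x := hd.congr_of_eventuallyEq
        (by filter_upwards [isOpen_Ioo.mem_nhds hx] with y hy using e y hy)
      rw [hd'.deriv]
      have h1 := h.vf0_ne hx
      have e1 : (r + (j+1) + 1) * (k+1) = (r+j+1)*(k+1) + k + 1 := by ring
      have e2 : (r+(j+1)+1) * (k+1) = (r+j+1+1) * (k+1) := by ring
      rw [show x ^ ((r + (j+1) + 1) * (k+1)) = x ^ ((r+j+1)*(k+1)) * x ^ (k+1) by
        rw [← pow_add]; congr 1]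
      rw [show (r + (j+1) + 1) * (k+1) - 1 = (r+j+1)*(k+1) + k by omega, e2, pow_add]
      field_simp

/-- the main side estimate -/
lemma takens_side (h : Ctr f b) (hA : Continuous A) (hf : ∀ x, f x = x + x ^ (k+1) * A x)
    (hA0 : A 0 ≠ 0) (r N : ℕ) {X1 E : ℝ → ℝ} (hX1 : ContDiff ℝ ∞ X1) (hX10 : X1 0 ≠ 0)
    (hE : ContDiff ℝ ∞ E) (hN : N = (r+1) * (k+1) + 2 * (k+1))
    (hX : ∀ x, (f x) ^ (k+1) * X1 (f x) - deriv f x * (x ^ (k+1) * X1 x) = x ^ N * E x) :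
    ∀ j ≤ r, Tendsto (iteratedDeriv j (fun x => vf0 f x - A 0 / X1 0 * (x ^ (k+1) * X1 x)))
      (𝓝[>] 0) (𝓝 0) := by
  set M := (r+1) * (k+1) with hM
  set ν := A 0 / X1 0 with hν
  have hmem : ∀ᶠ x in 𝓝[>] (0:ℝ), x ∈ Ioo 0 b := Ioo_mem_nhdsGT h.bpos
  have hν0 : ν ≠ 0 := div_ne_zero hA0 hX10
  set p : ℝ → ℝ := fun x => (E x / deriv f x) * ((x ^ (k+1) / vf0 f x) * (x ^ (k+1) / vf0 f x)) with hp
  have hpBC : ∀ j, BC f b j p := fun j => (h.BC_smooth' j (hE.div h.smoothD fun x => (h.dpos x).ne')).mul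
    ((h.BC_yinv hA hf hA0 j).mul (h.BC_yinv hA hf hA0 j))
  set u : ℝ → ℝ := fun x => x ^ (k+1) * X1 x / vf0 f x with hu
  have hus : ∀ x ∈ Ioo 0 b, u (f x) - u x = vf0 f x * (x ^ M * p x) := by
    intro x hx
    simp only [hu, hp]
    rw [h.vf0_inv hx]
    have h1 := h.vf0_ne hx
    have h2 := (h.dpos x).ne'
    have h3 := hX x
    rw [hN, pow_add x M] at h3
    have h4 : f x ^ (k+1) * X1 (f x) = x ^ M * x ^ (2*(k+1)) * E x + deriv f x * (x ^ (k+1) * X1 x) := by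
      linarith
    rw [h4]
    field_simp
    ring
  have hu0 : Tendsto u (𝓝[>] 0) (𝓝 (1/ν)) := by
    have l1 : Tendsto (fun x => X1 x / A x) (𝓝[>] 0) (𝓝 (X1 0 / A 0)) :=
      (((hX1.continuous.tendsto 0).div (hA.tendsto 0) hA0)).mono_left nhdsWithin_le_nhds
    have l2 := l1.div h.vf0_ratio one_ne_zero
    rw [div_one] at l2
    have e : 1/ν = X1 0 / A 0 := by rw [hν]; simp
    rw [e]
    refine l2.congr' ?_
    filter_upwards [hmem] with x hx
    simp only [hu, Pi.div_apply]
    have e1 : f x - x = x ^ (k+1) * A x := by rw [hf x]; ring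
    have h1 := h.vf0_ne hx
    have h2 : f x - x ≠ 0 := by linarith [h.lt x hx]
    have h3 : A x ≠ 0 := by rintro h0; rw [e1, h0, mul_zero] at h2; exact h2 rfl
    have h4 := (pow_pos hx.1 (k+1)).ne'
    rw [e1]
    field_simp
  have husum : ∀ x ∈ Ioo 0 b, u x - 1/ν = - (x ^ M * SM f M p x) := by
    intro x hx
    have hs : Summable (fun n => (fun y => vf0 f y * (y ^ M * p y)) (f^[n] x)) :=
      h.sum_summable (h.vf0_Osm ((pow_Bdd M).mul (hpBC 0).bdd)) hx
    have h1 := hs.hasSum.tendsto_sum_nat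
    have h2 : ∀ n, ∑ i ∈ Finset.range n, (fun y => vf0 f y * (y ^ M * p y)) (f^[i] x)
        = u (f^[n] x) - u x := by
      intro n
      have h20 := Finset.sum_range_sub (fun n => u (f^[n] x)) n
      simp only [Function.iterate_zero, id] at h20
      rw [← h20]
      refine Finset.sum_congr rfl fun i _ => ?_
      rw [Function.iterate_succ_apply', hus _ (h.iter_mem hx i)]
    have h3 := ((hu0.comp (h.iter_tendsto' hx)).sub_const (u x))
    have h4 := tendsto_nhds_unique (h1.congr h2) h3
    rw [SM, h4, mul_div_cancel₀ _ (pow_pos hx.1 M).ne']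
    ring
  have hη : ∀ x ∈ Ioo 0 b, vf0 f x - ν * (x ^ (k+1) * X1 x) = x ^ M * (ν * (vf0 f x * SM f M p x)) := by
    intro x hx
    have h1 := husum x hx
    have h2 := h.vf0_ne hx
    have h3 : x ^ (k+1) * X1 x = vf0 f x * (1/ν - x ^ M * SM f M p x) := by
      have : u x = 1/ν - x ^ M * SM f M p x := by linarith
      rw [← this]; simp only [hu]; field_simp
    rw [h3]; field_simp; ring
  intro j hj
  obtain ⟨i, rfl⟩ : ∃ i, r = i + j := ⟨r - j, by omega⟩
  obtain ⟨q, hq, e⟩ := h.iter_xMq hA hf hA0 i j _ ⟨_, BC.mul (BC.const ν) (BC.mul (h.BC_vf (i+j))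
    (BC.pred (h.BC_SM' M (i+j) (hpBC _)))), hη⟩
  obtain ⟨C, hC⟩ := hq.bdd (b/2) ⟨by linarith [h.bpos], by linarith [h.bpos]⟩
  have hl : Tendsto (fun x : ℝ => x ^ ((i+1)*(k+1)) * C) (𝓝[>] 0) (𝓝 0) := by
    have : Continuous (fun x : ℝ => x ^ ((i+1)*(k+1)) * C) := by fun_prop
    have := (this.tendsto 0).mono_left (nhdsWithin_le_nhds (s := Ioi 0))
    simpa using this
  refine squeeze_zero_norm' ?_ hl
  filter_upwards [hmem, Ioo_mem_nhdsGT (show (0:ℝ) < b/2 by linarith [h.bpos])] with x hx hx'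
  rw [e x hx, norm_mul, Real.norm_eq_abs, Real.norm_eq_abs, abs_of_pos (pow_pos hx.1 _)]
  exact mul_le_mul_of_nonneg_left (hC x ⟨hx'.1, hx'.2.le⟩) (pow_pos hx.1 _).le

end Ctr

/-- `f` is a global smooth orientation preserving diffeomorphism of `ℝ` with inverse `fi`. -/
structure GD (f fi : ℝ → ℝ) : Prop where
  smooth : ContDiff ℝ ∞ f
  ismooth : ContDiff ℝ ∞ fi
  li : ∀ x, fi (f x) = x
  ri : ∀ x, f (fi x) = x
  dpos : ∀ x, 0 < deriv f x

namespace GD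
variable {f fi : ℝ → ℝ}

lemma hasD (h : GD f fi) (x : ℝ) : HasDerivAt f (deriv f x) x :=
  ((contDiff_infty_iff_deriv.1 h.smooth).1 x).hasDerivAt

lemma ihasD (h : GD f fi) (x : ℝ) : HasDerivAt fi (deriv fi x) x :=
  ((contDiff_infty_iff_deriv.1 h.ismooth).1 x).hasDerivAt

lemma deriv_mul (h : GD f fi) (x : ℝ) : deriv f (fi x) * deriv fi x = 1 := by
  have h1 : HasDerivAt (fun x => f (fi x)) (deriv f (fi x) * deriv fi x) x :=
    (h.hasD (fi x)).comp x (h.ihasD x)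
  have h2 : (fun x => f (fi x)) = id := funext h.ri
  rw [h2] at h1
  exact h1.unique (hasDerivAt_id x)

lemma smono (h : GD f fi) : StrictMono f := strictMono_of_deriv_pos h.dpos

lemma symm (h : GD f fi) : GD fi f :=
  ⟨h.ismooth, h.smooth, h.ri, h.li, fun x => by
    have h1 := h.deriv_mul x
    have h2 := h.dpos (fi x)
    by_contra hh
    push Not at hh
    nlinarith⟩

lemma cont (h : GD f fi) : Continuous f := h.smooth.continuous

lemma fix_symm (h : GD f fi) {p : ℝ} (hp : f p = p) : fi p = p := by
  have := h.li p; rwa [hp] at this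

lemma deriv_inv (h : GD f fi) {p : ℝ} (hp : f p = p) : deriv fi p = (deriv f p)⁻¹ := by
  have := h.deriv_mul p
  rw [h.fix_symm hp] at this
  exact eq_inv_of_mul_eq_one_right this

end GD

structure EndData (f fi : ℝ → ℝ) (p : ℝ) (S : Set ℝ) (L : ℝ) (ξ τ : ℝ → ℝ) (T : ℝ) : Prop where
  op : IsOpen S
  fp : f p = p
  maps : ∀ x ∈ S, f x ∈ S
  imaps : ∀ x ∈ S, fi x ∈ S
  nofix : ∀ x ∈ S, f x ≠ x
  sm : ContDiffOn ℝ ∞ ξ S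
  ne : ∀ x ∈ S, ξ x ≠ 0
  tau : ∀ x ∈ S, HasDerivAt τ (ξ x)⁻¹ x
  tf : ∀ x ∈ S, τ (f x) = τ x + 1
  Tpos : 0 < T
  Tlog : T * (deriv f p - 1) = Real.log (deriv f p)
  T1 : deriv f p = 1 → T = 1
  ratio : Tendsto (fun x => ξ x / (f x - x)) (𝓝[S] p) (𝓝 T)
  der : Tendsto (deriv ξ) (𝓝[S] p) (𝓝 (Real.log (deriv f p)))
  bd : ∀ K, 0 ≤ K → (∀ x ∈ closure S, |Ctr.F f x| ≤ K) → (∀ x ∈ closure S, |Ctr.F fi x| ≤ K) →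
    ∀ x ∈ S, |deriv ξ x - Real.log (deriv f p)| ≤ max T (T * deriv f p) * (K * Real.exp (K * L) * L)
  cen : ∀ g : ℝ → ℝ, ContDiff ℝ ∞ g → (∀ x, 0 < deriv g x) → g p = p → (∀ x ∈ S, g x ∈ S) →
    (∀ x ∈ S, g (f x) = f (g x)) → ∀ x ∈ S, ξ (g x) = deriv g x * ξ x
  tak : ∀ (k r : ℕ) (A X1 E : ℝ → ℝ), ContDiff ℝ ∞ A → A p ≠ 0 →
    (∀ x, f x = x + (x - p) ^ (k+1) * A x) → ContDiff ℝ ∞ X1 → X1 p ≠ 0 → ContDiff ℝ ∞ E →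
    (∀ x, (f x - p) ^ (k+1) * X1 (f x) - deriv f x * ((x - p) ^ (k+1) * X1 x) =
      (x - p) ^ ((r+1) * (k+1) + 2 * (k+1)) * E x) →
    ∀ j ≤ r, Tendsto (iteratedDeriv j (fun x => ξ x - T * A p / X1 p * ((x - p) ^ (k+1) * X1 x)))
      (𝓝[S] p) (𝓝 0)

lemma nhdsIoo {b : ℝ} (hb : 0 < b) : 𝓝[Ioo 0 b] (0:ℝ) = 𝓝[>] 0 := nhdsWithin_Ioo_eq_nhdsGT hb

lemma EndData.ofCtr {f fi : ℝ → ℝ} {b : ℝ} (h : Ctr f b) (hd : GD f fi) :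
    ∃ ξ τ T, EndData f fi 0 (Ioo 0 b) b ξ τ T := by
  obtain ⟨T, hT⟩ := h.tau0_shift
  obtain ⟨T0, T2, T3⟩ := h.T_spec hT
  have hmem : ∀ᶠ x in 𝓝[>] (0:ℝ), x ∈ Ioo 0 b := Ioo_mem_nhdsGT h.bpos
  have hderiv : ∀ x ∈ Ioo 0 b, deriv (fun x => T * Ctr.vf0 f x) x = T * Ctr.w0 f x := fun x hx =>
    ((h.vf0_hasDeriv hx).const_mul T).deriv
  refine ⟨fun x => T * Ctr.vf0 f x, fun x => Ctr.tau0 f b x / T, T, ?_⟩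
  refine ⟨isOpen_Ioo, h.zero, fun x hx => h.mem hx, ?_, fun x hx => (h.lt x hx).ne, ?_, ?_, ?_, ?_,
    T0, T2, T3, ?_, ?_, ?_, ?_, ?_⟩
  · intro x hx
    have h0 : fi 0 = 0 := hd.fix_symm h.zero
    have h1 : fi b = b := hd.fix_symm h.fixb
    exact ⟨by have := hd.symm.smono hx.1; rwa [h0] at this,
      by have := hd.symm.smono hx.2; rwa [h1] at this⟩
  · exact contDiffOn_const.mul h.vf0_smooth
  · exact fun x hx => mul_ne_zero T0.ne' (h.vf0_ne hx)
  · intro x hx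
    refine ((h.tau0_hasDeriv hx).div_const T).congr_deriv ?_
    rw [mul_inv]; ring
  · intro x hx
    rw [hT x hx, add_div, div_self T0.ne']
  · rw [nhdsIoo h.bpos]
    have := h.vf0_ratio.const_mul T
    rw [mul_one] at this
    exact this.congr fun x => by ring
  · rw [nhdsIoo h.bpos, ← T2]
    refine (h.w0_tendsto.const_mul T).congr' ?_
    filter_upwards [hmem] with x hx using (hderiv x hx).symm
  · intro K hK0 hK _ x hx
    rw [closure_Ioo h.bpos.ne] at hK
    rw [hderiv x hx, ← T2, ← mul_sub, abs_mul, abs_of_pos T0]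
    have := h.w0_bound hK hK0 hx
    have h2 : 0 ≤ K * Real.exp (K * b) := mul_nonneg hK0 (Real.exp_pos _).le
    exact mul_le_mul (le_max_left _ _) (this.trans (mul_le_mul_of_nonneg_left hx.2.le h2))
      (abs_nonneg _) (T0.le.trans (le_max_left _ _))
  · intro g hg hgd hg0 hgm hc x hx
    rw [h.vf0_commute hg hgd hg0 hgm hc hx]; ring
  · intro k r A X1 E hA hA0 hf hX1 hX10 hE hX j hj
    rw [nhdsIoo h.bpos]
    simp only [sub_zero] at hf hX ⊢
    have := (h.takens_side hA.continuous hf hA0 r _ hX1 hX10 hE rfl hX j hj).const_mul T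
    rw [mul_zero] at this
    refine this.congr fun x => ?_
    rw [← iteratedDeriv_const_mul_field]
    congr 1
    ext y
    ring

lemma Tspec_unique {T T' l : ℝ} (h1 : T * (l - 1) = Real.log l) (h2 : l = 1 → T = 1)
    (h1' : T' * (l - 1) = Real.log l) (h2' : l = 1 → T' = 1) : T = T' := by
  by_cases hl : l = 1
  · rw [h2 hl, h2' hl]
  · have : l - 1 ≠ 0 := sub_ne_zero.2 hl
    exact mul_right_cancel₀ this (h1.trans h1'.symm)


lemma nhdsS_tendsto {S : Set ℝ} {p : ℝ} {f : ℝ → ℝ} (hc : Continuous f) (hp : f p = p)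
    (hm : ∀ x ∈ S, f x ∈ S) : Tendsto f (𝓝[S] p) (𝓝[S] p) := by
  refine tendsto_nhdsWithin_iff.2 ⟨?_, ?_⟩
  · have := hc.tendsto p
    rw [hp] at this
    exact this.mono_left nhdsWithin_le_nhds
  · filter_upwards [self_mem_nhdsWithin] with x hx using hm x hx

/-- `(fi x - x)/(x - f x) → 1/λ`. -/
lemma inv_ratio {f fi : ℝ → ℝ} (h : GD f fi) {S : Set ℝ} {p : ℝ} (hp : f p = p)
    (hne : ∀ x ∈ S, f x ≠ x) :
    Tendsto (fun x => (fi x - x) / (x - f x)) (𝓝[S] p) (𝓝 (deriv f p)⁻¹) := by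
  have hdc : Continuous (deriv fi) := (contDiff_infty_iff_deriv.1 h.ismooth).2.continuous
  have hm : ∀ x : ℝ, ∃ c : ℝ, x ∈ S → (min x (f x) ≤ c ∧ c ≤ max x (f x)) ∧
      deriv fi c = (fi x - x) / (x - f x) := by
    intro x
    by_cases hx : x ∈ S
    · rcases lt_or_gt_of_ne (hne x hx) with hlt | hlt
      · obtain ⟨c, hc, e⟩ := exists_hasDerivAt_eq_slope fi (deriv fi) hlt
          h.ismooth.continuous.continuousOn (fun z _ => h.ihasD z)
        refine ⟨c, fun _ => ⟨⟨?_, ?_⟩, ?_⟩⟩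
        · exact (min_le_right _ _).trans hc.1.le
        · exact hc.2.le.trans (le_max_left _ _)
        · rw [e, h.li]
      · obtain ⟨c, hc, e⟩ := exists_hasDerivAt_eq_slope fi (deriv fi) hlt
          h.ismooth.continuous.continuousOn (fun z _ => h.ihasD z)
        refine ⟨c, fun _ => ⟨⟨?_, ?_⟩, ?_⟩⟩
        · exact (min_le_left _ _).trans hc.1.le
        · exact hc.2.le.trans (le_max_right _ _)
        · rw [e, h.li, ← neg_sub, ← neg_sub x (f x), neg_div_neg_eq]
    · exact ⟨0, fun h => absurd h hx⟩
  choose c hc using hm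
  have hc0 : Tendsto c (𝓝[S] p) (𝓝 p) := by
    have c1 : Continuous fun x => min x (f x) := continuous_id.min h.cont
    have c2 : Continuous fun x => max x (f x) := continuous_id.max h.cont
    have l1 := (c1.tendsto p).mono_left (nhdsWithin_le_nhds (s := S))
    have l2 := (c2.tendsto p).mono_left (nhdsWithin_le_nhds (s := S))
    rw [hp, min_self] at l1
    rw [hp, max_self] at l2
    refine tendsto_of_tendsto_of_tendsto_of_le_of_le' l1 l2 ?_ ?_
    · filter_upwards [self_mem_nhdsWithin] with x hx using (hc x hx).1.1
    · filter_upwards [self_mem_nhdsWithin] with x hx using (hc x hx).1.2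
  rw [← h.deriv_inv hp]
  refine ((hdc.tendsto p).comp hc0).congr' ?_
  filter_upwards [self_mem_nhdsWithin] with x hx using (hc x hx).2

lemma EndData.inv {f fi : ℝ → ℝ} {p : ℝ} {S : Set ℝ} {L : ℝ} {ξ τ : ℝ → ℝ} {T : ℝ}
    (h : EndData fi f p S L ξ τ T) (hd : GD f fi) :
    EndData f fi p S L (fun x => - ξ x) (fun x => - τ x) (T / deriv f p) := by
  have fp : f p = p := hd.symm.fix_symm h.fp
  have hl := hd.dpos p
  have hdi := hd.deriv_inv fp
  have hTT : ∀ k : ℕ, ∀ A : ℝ → ℝ, ContDiff ℝ ∞ A → (∀ x, f x = x + (x - p) ^ (k+1) * A x) →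
      (deriv f p) ^ (k+1) = deriv f p := by
    intro k A hA e
    rcases Nat.eq_zero_or_pos k with rfl | hk
    · simp
    · have : HasDerivAt f (1 + ((k+1:ℕ) * (p - p) ^ k * 1 * A p + (p-p)^(k+1) * deriv A p)) p := by
        have e' : f = fun x => x + (x - p) ^ (k+1) * A x := funext e
        rw [e']
        exact (hasDerivAt_id p).add ((((hasDerivAt_id p).sub_const p).pow (k+1)).mul
          ((contDiff_infty_iff_deriv.1 hA).1 p).hasDerivAt)
      rw [this.deriv, sub_self, zero_pow hk.ne']
      simp
  refine ⟨h.op, fp, h.imaps, h.maps, ?_, h.sm.neg, fun x hx => neg_ne_zero.2 (h.ne x hx), ?_, ?_,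
    div_pos h.Tpos hl, ?_, ?_, ?_, ?_, ?_, ?_, ?_⟩
  · intro x hx e
    exact h.nofix x hx (hd.fix_symm e)
  · intro x hx
    exact (h.tau x hx).neg.congr_deriv (by rw [inv_neg])
  · intro x hx
    have := h.tf (f x) (h.imaps x hx)
    rw [hd.li] at this
    linarith
  · have := h.Tlog
    rw [hdi, Real.log_inv] at this
    have h2 : Real.log (deriv f p) = - (T * ((deriv f p)⁻¹ - 1)) := by linarith
    rw [h2]; field_simp; ring
  · intro e
    rw [e, div_one]
    exact h.T1 (by rw [hdi, e, inv_one])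
  · have := h.ratio.mul (inv_ratio hd fp (S := S) fun x hx e => h.nofix x hx (hd.fix_symm e))
    rw [div_eq_mul_inv]
    refine this.congr' ?_
    filter_upwards [self_mem_nhdsWithin] with x hx
    have h1 : fi x - x ≠ 0 := sub_ne_zero.2 (h.nofix x hx)
    rw [div_mul_div_cancel₀ h1, ← neg_sub (f x) x, div_neg, neg_div]
  · have := h.der.neg
    rw [hdi, Real.log_inv, neg_neg] at this
    refine this.congr fun x => ?_
    exact (deriv.fun_neg).symm
  · intro K hK0 hK1 hK2 x hx
    have := h.bd K hK0 hK2 hK1 x hx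
    rw [hdi, Real.log_inv] at this
    rw [deriv.fun_neg, show -deriv ξ x - Real.log (deriv f p) = -(deriv ξ x - - Real.log (deriv f p)) by ring,
      abs_neg, div_mul_cancel₀ _ hl.ne', max_comm, div_eq_mul_inv]
    exact this
  · intro g hg hgd hgp hgm hgc x hx
    have := h.cen g hg hgd hgp hgm (fun y hy => ?_) x hx
    · rw [this]; ring
    · have h1 := hgc (fi y) (h.maps y hy)
      rw [hd.ri] at h1
      rw [h1, hd.li]
  · intro k r A X1 E hA hA0 hf hX1 hX10 hE hX j hj
    obtain ⟨Y, hY, eY⟩ := hadamard p (fun x => fi x - p) (hd.ismooth.sub contDiff_const)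
      (by simp [h.fp])
    have eY' : ∀ x, fi x - p = (x - p) * Y x := eY
    have hYp : Y p = (deriv f p)⁻¹ := by
      rw [← hdi]
      have h1 : HasDerivAt (fun x => fi x - p) (1 * Y p + (p - p) * deriv Y p) p := by
        rw [funext eY']
        exact (((hasDerivAt_id p).sub_const p).mul
          ((contDiff_infty_iff_deriv.1 hY).1 p).hasDerivAt)
      have h2 := ((hd.ihasD p).sub_const p).unique h1
      rw [h2]; ring
    have hdis : ContDiff ℝ ∞ (deriv fi) := (contDiff_infty_iff_deriv.1 hd.ismooth).2
    have key := h.tak k r (fun x => -(Y x ^ (k+1) * A (fi x))) X1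
      (fun x => -(deriv fi x * (Y x ^ ((r+1) * (k+1) + 2 * (k+1)) * E (fi x))))
      ((hY.pow _).mul (hA.comp hd.ismooth)).neg ?_ ?_ hX1 hX10
      ((hdis.mul ((hY.pow _).mul (hE.comp hd.ismooth))).neg) ?_ j hj
    · have e : (fun x => - ξ x - T / deriv f p * A p / X1 p * ((x - p) ^ (k+1) * X1 x)) =
        fun x => (-1) * (ξ x - T * (-(Y p ^ (k+1) * A (fi p))) / X1 p * ((x - p) ^ (k+1) * X1 x)) := by
        ext x
        rw [hYp, h.fp, inv_pow, hTT k A hA hf]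
        field_simp
        ring
      rw [e]
      have key2 := key.const_mul (-1)
      rw [mul_zero] at key2
      refine key2.congr fun x => ?_
      rw [← iteratedDeriv_const_mul_field]
    · rw [hYp, h.fp]
      exact neg_ne_zero.2 (mul_ne_zero (pow_ne_zero _ (inv_ne_zero hl.ne')) hA0)
    · intro x
      have h1 := hf (fi x)
      rw [hd.ri, eY', mul_pow] at h1
      linarith
    · intro x
      have h1 := hX (fi x)
      have h2 := hd.deriv_mul x
      rw [hd.ri] at h1
      have h3 : (fi x - p) ^ ((r+1) * (k+1) + 2 * (k+1)) =
        (x - p) ^ ((r+1) * (k+1) + 2 * (k+1)) * Y x ^ ((r+1) * (k+1) + 2 * (k+1)) := by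
        rw [eY', mul_pow]
      rw [h3] at h1
      have h4 := congrArg (fun z => deriv fi x * z) h1
      linear_combination (-1) * h4 - (fi x - p) ^ (k+1) * X1 (fi x) * h2

noncomputable def cj (p s : ℝ) (f : ℝ → ℝ) (x : ℝ) : ℝ := s * (f (p + s * x) - p)

lemma deriv_aff (h : ℝ → ℝ) (p s x : ℝ) :
    deriv (fun x => h (s * (x - p))) x = s * deriv h (s * (x - p)) := by
  have h1 := deriv_comp_sub_const (f := fun y => h (s * y)) (a := p) (x := x)
  rw [h1, deriv_comp_mul_left, smul_eq_mul]

lemma iteratedDeriv_aff (p s : ℝ) (j : ℕ) : ∀ (h : ℝ → ℝ) (x : ℝ),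
    iteratedDeriv j (fun x => h (s * (x - p))) x = s ^ j * iteratedDeriv j h (s * (x - p)) := by
  induction j with
  | zero => intro h x; simp
  | succ j ih =>
    intro h x
    rw [iteratedDeriv_succ', iteratedDeriv_succ']
    have : deriv (fun x => h (s * (x - p))) = fun x => s * deriv h (s * (x - p)) :=
      funext fun x => deriv_aff h p s x
    rw [this, iteratedDeriv_const_mul_field, ih (deriv h) x]
    ring

lemma cj_hasD {p s : ℝ} (hs : s * s = 1) {f : ℝ → ℝ} (hf : Differentiable ℝ f) (x : ℝ) :
    HasDerivAt (cj p s f) (deriv f (p + s * x)) x := by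
  have h1 : HasDerivAt (fun x => p + s * x) s x := by
    simpa using ((hasDerivAt_id x).const_mul s).const_add p
  refine ((((hf (p + s * x)).hasDerivAt.comp x h1).sub_const p).const_mul s).congr_deriv ?_
  rw [mul_comm s, mul_assoc, hs, mul_one]

lemma cj_deriv {p s : ℝ} (hs : s * s = 1) {f : ℝ → ℝ} (hf : Differentiable ℝ f) :
    deriv (cj p s f) = fun x => deriv f (p + s * x) := funext fun x => (cj_hasD hs hf x).deriv

lemma cj_smooth (p s : ℝ) {f : ℝ → ℝ} (hf : ContDiff ℝ ∞ f) : ContDiff ℝ ∞ (cj p s f) := by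
  unfold cj
  exact contDiff_const.mul ((hf.comp (contDiff_const.add (contDiff_const.mul contDiff_id))).sub
    contDiff_const)

lemma cj_aff {p s : ℝ} (hs : s * s = 1) (f : ℝ → ℝ) (x : ℝ) : p + s * cj p s f x = f (p + s * x) := by
  unfold cj
  linear_combination (f (p + s * x) - p) * hs

lemma GD.cj {f fi : ℝ → ℝ} (h : GD f fi) (p : ℝ) {s : ℝ} (hs : s * s = 1) :
    GD (cj p s f) (cj p s fi) := by
  have hdf := (contDiff_infty_iff_deriv.1 h.smooth).1
  refine ⟨cj_smooth p s h.smooth, cj_smooth p s h.ismooth, ?_, ?_, ?_⟩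
  · intro x
    rw [_root_.cj, cj_aff hs, h.li]
    linear_combination x * hs
  · intro x
    rw [_root_.cj, cj_aff hs, h.ri]
    linear_combination x * hs
  · intro x
    rw [cj_deriv hs hdf]; exact h.dpos _

lemma cj_F {p s : ℝ} (hs : s * s = 1) {f : ℝ → ℝ} (hf : ContDiff ℝ ∞ f) (x : ℝ) :
    Ctr.F (cj p s f) x = s * Ctr.F f (p + s * x) := by
  have hdf := (contDiff_infty_iff_deriv.1 hf)
  have hddf := (contDiff_infty_iff_deriv.1 hdf.2).1
  rw [Ctr.F, cj_deriv hs hdf.1, Ctr.F]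
  have h1 : HasDerivAt (fun x => p + s * x) s x := by
    simpa using ((hasDerivAt_id x).const_mul s).const_add p
  have h2 := ((hddf (p + s * x)).hasDerivAt.comp x h1).deriv
  simp only [Function.comp_def] at h2
  rw [h2]; ring

lemma EndData.ofcj {f fi : ℝ → ℝ} {p s L : ℝ} (hs : s * s = 1) (hd : GD f fi) {ξ τ : ℝ → ℝ} {T : ℝ}
    (h : EndData (cj p s f) (cj p s fi) 0 (Ioo 0 L) L ξ τ T) :
    EndData f fi p {x | s * (x - p) ∈ Ioo 0 L} L (fun x => s * ξ (s * (x - p)))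
      (fun x => τ (s * (x - p))) T := by
  have hdf := (contDiff_infty_iff_deriv.1 hd.smooth).1
  have hs0 : s ≠ 0 := by rintro rfl; simp at hs
  have habs : |s| = 1 := by
    have := abs_mul s s; rw [hs, abs_one] at this
    nlinarith [abs_nonneg s]
  have back : ∀ x, p + s * (s * (x - p)) = x := fun x => by linear_combination (x - p) * hs
  have back2 : ∀ x, s * (p + s * x - p) = x := fun x => by linear_combination x * hs
  have ecj : ∀ x, cj p s f (s * (x - p)) = s * (f x - p) := fun x => by rw [cj, back]
  have ecji : ∀ x, cj p s fi (s * (x - p)) = s * (fi x - p) := fun x => by rw [cj, back]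
  have cm : Continuous fun x => s * (x - p) := by fun_prop
  set S := {x | s * (x - p) ∈ Ioo 0 L} with hS
  have hd0 : deriv (cj p s f) 0 = deriv f p := by rw [cj_deriv hs hdf]; simp
  have tm : Tendsto (fun x => s * (x - p)) (𝓝[S] p) (𝓝[Ioo 0 L] 0) := by
    refine tendsto_nhdsWithin_iff.2 ⟨?_, ?_⟩
    · have := (cm.tendsto p).mono_left (nhdsWithin_le_nhds (s := S))
      simpa using this
    · filter_upwards [self_mem_nhdsWithin] with x hx using hx
  have hderiv : ∀ x, deriv (fun x => s * ξ (s * (x - p))) x = deriv ξ (s * (x - p)) := by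
    intro x
    rw [deriv_const_mul_field, deriv_aff, ← mul_assoc, hs, one_mul]
  have hdm : ∀ x, HasDerivAt (fun x => s * (x - p)) s x := fun x => by
    simpa using ((hasDerivAt_id x).sub_const p).const_mul s
  have fp : f p = p := by
    have := h.fp
    rw [cj, mul_zero, add_zero] at this
    have := (mul_eq_zero.1 this).resolve_left hs0
    linarith
  refine ⟨isOpen_Ioo.preimage cm, fp, ?_, ?_, ?_, ?_, ?_, ?_, ?_, h.Tpos, ?_, ?_, ?_, ?_, ?_, ?_, ?_⟩
  · intro x hx
    have := h.maps _ hx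
    rwa [ecj] at this
  · intro x hx
    have := h.imaps _ hx
    rwa [ecji] at this
  · intro x hx e
    refine h.nofix _ hx ?_
    rw [ecj, e]
  · refine contDiffOn_const.mul (h.sm.comp (contDiff_const.mul (contDiff_id.sub contDiff_const)).contDiffOn
      fun x hx => hx)
  · exact fun x hx => mul_ne_zero hs0 (h.ne _ hx)
  · intro x hx
    refine ((h.tau _ hx).comp x (hdm x)).congr_deriv ?_
    rw [mul_inv, inv_eq_of_mul_eq_one_right hs, mul_comm]
  · intro x hx
    have := h.tf _ hx
    rwa [ecj] at this
  · rw [← hd0]; exact h.Tlog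
  · rw [← hd0]; exact h.T1
  · refine (h.ratio.comp tm).congr fun x => ?_
    simp only [Function.comp_apply]
    rw [ecj, ← mul_sub, show f x - p - (x - p) = f x - x by ring, mul_comm s (f x - x), ← div_div,
      div_eq_mul_inv _ s, inv_eq_of_mul_eq_one_right hs]
    ring
  · rw [← hd0]
    exact (h.der.comp tm).congr fun x => (hderiv x).symm
  · intro K hK0 hK1 hK2 x hx
    have hcl : ∀ y ∈ closure (Ioo 0 L), p + s * y ∈ closure S := by
      intro y hy
      have : Continuous fun y => p + s * y := by fun_prop
      refine closure_mono ?_ (image_closure_subset_closure_image this (mem_image_of_mem _ hy))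
      rintro _ ⟨z, hz, rfl⟩
      change s * (p + s * z - p) ∈ Ioo 0 L
      rwa [back2]
    rw [hderiv, ← hd0]
    refine h.bd K hK0 ?_ ?_ _ hx
    · intro y hy
      rw [cj_F hs hd.smooth, abs_mul, habs, one_mul]
      exact hK1 _ (hcl y hy)
    · intro y hy
      rw [cj_F hs hd.ismooth, abs_mul, habs, one_mul]
      exact hK2 _ (hcl y hy)
  · intro g hg hgd hgp hgm hgc x hx
    have hgdf := (contDiff_infty_iff_deriv.1 hg).1
    have key := h.cen (cj p s g) (cj_smooth p s hg) (fun y => by rw [cj_deriv hs hgdf]; exact hgd _)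
      (by simp [cj, hgp]) ?_ ?_ _ hx
    · rw [cj_deriv hs hgdf, cj, back] at key
      rw [key]; simp only [back]; ring
    · intro y hy
      have : p + s * y ∈ S := by
        change s * (p + s * y - p) ∈ Ioo 0 L
        rwa [back2]
      exact hgm _ this
    · intro y hy
      have : p + s * y ∈ S := by
        change s * (p + s * y - p) ∈ Ioo 0 L
        rwa [back2]
      have := hgc _ this
      rw [cj, cj_aff hs, this, cj, cj_aff hs]
  · intro k r A X1 E hA hA0 hf hX1 hX10 hE hX j hj
    have ca : ContDiff ℝ ∞ fun x => p + s * x := contDiff_const.add (contDiff_const.mul contDiff_id)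
    set N := (r+1) * (k+1) + 2 * (k+1) with hN
    have hsk : s ^ (k+1) * s = s ^ k := by rw [pow_succ, mul_assoc, hs, mul_one]
    have hsk0 := pow_ne_zero k hs0
    have key := h.tak k r (fun x => s ^ k * A (p + s * x)) (fun x => s ^ k * X1 (p + s * x))
      (fun x => s * s ^ N * E (p + s * x)) (contDiff_const.mul (hA.comp ca)) ?_ ?_
      (contDiff_const.mul (hX1.comp ca)) ?_ (contDiff_const.mul (hE.comp ca)) ?_ j hj
    · have key2 := (key.comp tm).const_mul (s * s ^ j)
      rw [mul_zero (s * s ^ j)] at key2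
      refine key2.congr fun x => ?_
      simp only [Function.comp_apply]
      rw [mul_assoc, ← iteratedDeriv_aff, ← iteratedDeriv_const_mul_field]
      congr 1
      ext y
      simp only [mul_zero, add_zero, sub_zero]
      rw [back, mul_pow]
      have e1 : T * (s ^ k * A p) / (s ^ k * X1 p) = T * A p / X1 p := by
        rw [mul_left_comm, mul_div_mul_left _ _ hsk0]
      rw [e1]
      have e2 : s * (s ^ (k+1) * s ^ k) = 1 := by
        have : s * (s ^ (k+1) * s ^ k) = (s * s) ^ (k+1) := by rw [mul_pow]; ring
        rw [this, hs, one_pow]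
      linear_combination (-(T * A p / X1 p * (y - p) ^ (k+1) * X1 y)) * e2
    · simp only [mul_zero, add_zero]; exact mul_ne_zero hsk0 hA0
    · intro x
      rw [cj, hf (p + s * x)]
      have : p + s * x - p = s * x := by ring
      rw [this, mul_pow]
      simp only [sub_zero]
      linear_combination x * hs + x ^ (k+1) * A (p + s * x) * hsk
    · simp only [mul_zero, add_zero]; exact mul_ne_zero hsk0 hX10
    · intro x
      have h1 := hX (p + s * x)
      simp only [sub_zero]
      rw [cj_aff hs, cj_deriv hs hdf, cj]
      have : p + s * x - p = s * x := by ring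
      rw [this, mul_pow s x N, mul_pow s x] at h1
      rw [mul_pow]
      have e3 : s ^ (k+1) * s ^ k = s := by
        have : s ^ (k+1) * s ^ k = (s * s) ^ k * s := by rw [mul_pow]; ring
        rw [this, hs, one_pow, one_mul]
      linear_combination s * h1 + (f (p + s*x) - p)^(k+1) * X1 (f (p + s*x)) * e3 +
        deriv f (p + s * x) * x ^ (k+1) * X1 (p + s * x) * hsk

/-- `(a,b)` is a component of the complement of the fixed point set of `f`. -/
structure Comp (f : ℝ → ℝ) (a b : ℝ) : Prop where
  lt : a < b
  fa : f a = a
  fb : f b = b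
  ne : ∀ x ∈ Ioo a b, f x ≠ x

lemma sign_of_ne {u : ℝ → ℝ} {s : Set ℝ} (hs : IsPreconnected s) (hu : ContinuousOn u s)
    (h0 : ∀ x ∈ s, u x ≠ 0) : (∀ x ∈ s, u x < 0) ∨ (∀ x ∈ s, 0 < u x) := by
  by_contra hh
  push Not at hh
  obtain ⟨⟨x, hx, hx1⟩, ⟨y, hy, hy1⟩⟩ := hh
  obtain ⟨z, hz, hz0⟩ := hs.intermediate_value hy hx hu ⟨hy1, hx1⟩
  exact h0 z hz hz0

lemma Comp.sign {f : ℝ → ℝ} {a b : ℝ} (h : Comp f a b) (hf : Continuous f) :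
    (∀ x ∈ Ioo a b, f x < x) ∨ (∀ x ∈ Ioo a b, x < f x) := by
  rcases sign_of_ne isPreconnected_Ioo ((hf.sub continuous_id).continuousOn (s := Ioo a b))
    (fun x hx => sub_ne_zero.2 (h.ne x hx)) with h1 | h1
  · exact Or.inl fun x hx => sub_neg.1 (h1 x hx)
  · exact Or.inr fun x hx => sub_pos.1 (h1 x hx)

lemma Comp.symm {f fi : ℝ → ℝ} {a b : ℝ} (h : Comp f a b) (hd : GD f fi) : Comp fi a b :=
  ⟨h.lt, hd.fix_symm h.fa, hd.fix_symm h.fb, fun x hx e => h.ne x hx (by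
    have := hd.ri x; rwa [e] at this)⟩

lemma endData_aux {f fi : ℝ → ℝ} (hd : GD f fi) {p s L : ℝ} (hs : s * s = 1) (hL : 0 < L) (hp : f p = p)
    (hq : f (p + s * L) = p + s * L) (hlt : ∀ x, s * (x - p) ∈ Ioo 0 L → s * (f x - x) < 0) :
    ∃ ξ τ T, EndData f fi p {x | s * (x - p) ∈ Ioo 0 L} L ξ τ T := by
  have hc : Ctr (cj p s f) L := by
    refine ⟨cj_smooth p s hd.smooth, (hd.cj p hs).dpos, by simp [cj, hp], hL, ?_, ?_⟩
    · rw [cj, hq]; linear_combination L * hs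
    · intro x hx
      have e : s * (p + s * x - p) = x := by linear_combination x * hs
      have := hlt (p + s * x) (by rwa [e])
      rw [cj]
      nlinarith
  obtain ⟨ξ, τ, T, h⟩ := EndData.ofCtr hc (hd.cj p hs)
  exact ⟨_, _, T, EndData.ofcj hs hd h⟩

lemma endData_aux2 {f fi : ℝ → ℝ} (hd : GD f fi) {p s L : ℝ} (hs : s * s = 1) (hL : 0 < L) (hp : f p = p)
    (hq : f (p + s * L) = p + s * L) (hlt : (∀ x, s * (x - p) ∈ Ioo 0 L → s * (f x - x) < 0) ∨
      ∀ x, s * (x - p) ∈ Ioo 0 L → s * (fi x - x) < 0) :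
    ∃ ξ τ T, EndData f fi p {x | s * (x - p) ∈ Ioo 0 L} L ξ τ T := by
  rcases hlt with h | h
  · exact endData_aux hd hs hL hp hq h
  · obtain ⟨ξ, τ, T, h⟩ := endData_aux hd.symm hs hL (hd.fix_symm hp) (hd.fix_symm hq) h
    exact ⟨_, _, _, h.inv hd⟩

lemma Comp.sign' {f fi : ℝ → ℝ} {a b : ℝ} (h : Comp f a b) (hd : GD f fi) :
    ((∀ x ∈ Ioo a b, f x < x) ∧ ∀ x ∈ Ioo a b, x < fi x) ∨
      ((∀ x ∈ Ioo a b, x < f x) ∧ ∀ x ∈ Ioo a b, fi x < x) := by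
  have key : ∀ x, (f x < x → x < fi x) ∧ (x < f x → fi x < x) := fun x =>
    ⟨fun h => by have := hd.symm.smono h; rwa [hd.li] at this,
     fun h => by have := hd.symm.smono h; rwa [hd.li] at this⟩
  rcases h.sign hd.cont with h1 | h1
  · exact Or.inl ⟨h1, fun x hx => (key x).1 (h1 x hx)⟩
  · exact Or.inr ⟨h1, fun x hx => (key x).2 (h1 x hx)⟩

lemma Comp.left {f fi : ℝ → ℝ} {a b : ℝ} (h : Comp f a b) (hd : GD f fi) :
    ∃ ξ τ T, EndData f fi a (Ioo a b) (b - a) ξ τ T := by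
  have e : {x | (1:ℝ) * (x - a) ∈ Ioo 0 (b - a)} = Ioo a b := by
    ext x; simp
  rw [← e]
  refine endData_aux2 hd (by norm_num) (sub_pos.2 h.lt) h.fa (by simp [h.fb]) ?_
  rcases h.sign' hd with h1 | h1
  · left; intro x hx
    have : x ∈ Ioo a b := by rw [← e]; exact hx
    linarith [h1.1 x this]
  · right; intro x hx
    have : x ∈ Ioo a b := by rw [← e]; exact hx
    linarith [h1.2 x this]

lemma Comp.right {f fi : ℝ → ℝ} {a b : ℝ} (h : Comp f a b) (hd : GD f fi) :
    ∃ ξ τ T, EndData f fi b (Ioo a b) (b - a) ξ τ T := by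
  have e : {x | (-1:ℝ) * (x - b) ∈ Ioo 0 (b - a)} = Ioo a b := by
    ext x; simp only [mem_setOf_eq, mem_Ioo]
    constructor
    · rintro ⟨h1, h2⟩; constructor <;> linarith
    · rintro ⟨h1, h2⟩; constructor <;> linarith
  rw [← e]
  refine endData_aux2 hd (by norm_num) (sub_pos.2 h.lt) h.fb ?_ ?_
  · have : b + -1 * (b - a) = a := by ring
    rw [this, h.fa]
  rcases h.sign' hd with h1 | h1
  · right; intro x hx
    have : x ∈ Ioo a b := by rw [← e]; exact hx
    linarith [h1.2 x this]
  · left; intro x hx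
    have : x ∈ Ioo a b := by rw [← e]; exact hx
    linarith [h1.1 x this]

lemma perm_ai (e : Equiv.Perm ℝ) (x : ℝ) : e (e⁻¹ x) = x := e.apply_symm_apply x
lemma perm_ia (e : Equiv.Perm ℝ) (x : ℝ) : e⁻¹ (e x) = x := e.symm_apply_apply x

lemma GD.comp {f fi g gi : ℝ → ℝ} (hf : GD f fi) (hg : GD g gi) : GD (f ∘ g) (gi ∘ fi) := by
  refine ⟨hf.smooth.comp hg.smooth, hg.ismooth.comp hf.ismooth, ?_, ?_, ?_⟩
  · intro x; simp [hf.li, hg.li]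
  · intro x; simp [hf.ri, hg.ri]
  · intro x
    rw [((hf.hasD (g x)).comp x (hg.hasD x)).deriv]
    exact mul_pos (hf.dpos _) (hg.dpos _)

/-- Permutations of the line that are the identity off `[0,1]` and coincide on `[0,1]` with a
global diffeomorphism. -/
def IsD (e : Equiv.Perm ℝ) : Prop :=
  (∀ x, x ∉ Icc (0:ℝ) 1 → e x = x) ∧ ∃ F Fi, GD F Fi ∧ ∀ x ∈ Icc (0:ℝ) 1, e x = F x

namespace IsD
variable {e : Equiv.Perm ℝ}

lemma maps (h : IsD e) {x : ℝ} (hx : x ∈ Icc (0:ℝ) 1) : e x ∈ Icc (0:ℝ) 1 := by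
  by_contra hh
  have := e.injective (h.1 _ hh)
  rw [this] at hh
  exact hh hx

lemma imaps (h : IsD e) {x : ℝ} (hx : x ∈ Icc (0:ℝ) 1) : e⁻¹ x ∈ Icc (0:ℝ) 1 := by
  by_contra hh
  have := h.1 _ hh
  rw [perm_ai] at this
  rw [← this] at hh
  exact hh hx

lemma rep (h : IsD e) : ∃ F Fi, GD F Fi ∧ (∀ x ∈ Icc (0:ℝ) 1, e x = F x) ∧
    (∀ x ∈ Icc (0:ℝ) 1, e⁻¹ x = Fi x) := by
  obtain ⟨F, Fi, hd, hF⟩ := h.2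
  refine ⟨F, Fi, hd, hF, fun x hx => ?_⟩
  have := hF _ (h.imaps hx)
  rw [perm_ai] at this
  have h2 := hd.li (e⁻¹ x)
  rw [← this] at h2
  exact h2.symm

lemma inv (h : IsD e) : IsD e⁻¹ := by
  obtain ⟨F, Fi, hd, hF, hFi⟩ := h.rep
  refine ⟨fun x hx => ?_, Fi, F, hd.symm, hFi⟩
  rw [Equiv.Perm.inv_eq_iff_eq, h.1 x hx]

lemma mul {e' : Equiv.Perm ℝ} (h : IsD e) (h' : IsD e') : IsD (e * e') := by
  obtain ⟨F, Fi, hd, hF⟩ := h.2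
  obtain ⟨F', Fi', hd', hF'⟩ := h'.2
  refine ⟨fun x hx => ?_, F ∘ F', Fi' ∘ Fi, hd.comp hd', fun x hx => ?_⟩
  · rw [Equiv.Perm.mul_apply, h'.1 x hx, h.1 x hx]
  · rw [Equiv.Perm.mul_apply, hF _ (h'.maps hx), hF' x hx]; rfl

lemma one' : IsD 1 := by
  refine ⟨fun x _ => rfl, id, id, ⟨contDiff_id, contDiff_id, fun _ => rfl, fun _ => rfl, ?_⟩, fun x _ => rfl⟩
  intro x; simp

lemma zpow (h : IsD e) (n : ℤ) : IsD (e ^ n) := by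
  let S : Subgroup (Equiv.Perm ℝ) :=
    { carrier := {e | IsD e}
      mul_mem' := fun ha hb => IsD.mul ha hb
      one_mem' := one'
      inv_mem' := fun ha => IsD.inv ha }
  exact Subgroup.zpow_mem S (show e ∈ S from h) n

lemma zero (h : IsD e) : e 0 = 0 := by
  obtain ⟨F, Fi, hd, hF⟩ := h.2
  have h0 : (0:ℝ) ∈ Icc (0:ℝ) 1 := ⟨le_rfl, zero_le_one⟩
  refine le_antisymm ?_ (h.maps h0).1
  have h1 := h.imaps h0
  have h2 := hd.smono.monotone h1.1
  rw [← hF _ h0, ← hF _ h1, perm_ai] at h2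
  exact h2

lemma one (h : IsD e) : e 1 = 1 := by
  obtain ⟨F, Fi, hd, hF⟩ := h.2
  have h0 : (1:ℝ) ∈ Icc (0:ℝ) 1 := ⟨zero_le_one, le_rfl⟩
  refine le_antisymm (h.maps h0).2 ?_
  have h1 := h.imaps h0
  have h2 := hd.smono.monotone h1.2
  rw [← hF _ h0, ← hF _ h1, perm_ai] at h2
  exact h2

lemma smono (h : IsD e) : StrictMono e := by
  obtain ⟨F, Fi, hd, hF⟩ := h.2
  intro x y hxy
  by_cases hx : x ∈ Icc (0:ℝ) 1 <;> by_cases hy : y ∈ Icc (0:ℝ) 1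
  · rw [hF x hx, hF y hy]; exact hd.smono hxy
  · rw [h.1 y hy]
    have := (h.maps hx).2
    have : 1 < y := by
      by_contra hh; push Not at hh
      exact hy ⟨hx.1.trans hxy.le, hh⟩
    linarith
  · rw [h.1 x hx]
    have := (h.maps hy).1
    have : x < 0 := by
      by_contra hh; push Not at hh
      exact hx ⟨hh, hxy.le.trans hy.2⟩
    linarith
  · rw [h.1 x hx, h.1 y hy]; exact hxy

lemma contOn (h : IsD e) : ContinuousOn e (Icc 0 1) := by
  obtain ⟨F, Fi, hd, hF⟩ := h.2
  exact hd.cont.continuousOn.congr hF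

lemma mem_of_ne (h : IsD e) {x : ℝ} (hx : e x ≠ x) : x ∈ Ioo (0:ℝ) 1 := by
  have h1 : x ∈ Icc (0:ℝ) 1 := by
    by_contra hh; exact hx (h.1 x hh)
  refine ⟨lt_of_le_of_ne h1.1 ?_, lt_of_le_of_ne h1.2 ?_⟩
  · rintro rfl; exact hx h.zero
  · rintro rfl; exact hx h.one

/-- existence of components -/
lemma comp (h : IsD e) {x : ℝ} (hx : e x ≠ x) : ∃ a b, 0 ≤ a ∧ b ≤ 1 ∧ x ∈ Ioo a b ∧ Comp e a b := by
  have hx01 := h.mem_of_ne hx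
  have hcl : IsClosed (Icc (0:ℝ) 1 ∩ {y | e y = y}) := by
    have h1 : ContinuousOn (fun y => e y - y) (Icc 0 1) := h.contOn.sub continuousOn_id
    have := h1.preimage_isClosed_of_isClosed isClosed_Icc (isClosed_singleton (x := (0:ℝ)))
    convert this using 2
    ext y; simp [sub_eq_zero]
  have hA : IsCompact (Icc (0:ℝ) 1 ∩ {y | e y = y} ∩ Iic x) :=
    isCompact_Icc.of_isClosed_subset (hcl.inter isClosed_Iic) (fun y hy => hy.1.1)
  have hB : IsCompact (Icc (0:ℝ) 1 ∩ {y | e y = y} ∩ Ici x) :=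
    isCompact_Icc.of_isClosed_subset (hcl.inter isClosed_Ici) (fun y hy => hy.1.1)
  obtain ⟨a, ha⟩ := hA.exists_isGreatest ⟨0, ⟨⟨le_rfl, zero_le_one⟩, h.zero⟩, hx01.1.le⟩
  obtain ⟨b, hb⟩ := hB.exists_isLeast ⟨1, ⟨⟨zero_le_one, le_rfl⟩, h.one⟩, hx01.2.le⟩
  have hax : a < x := lt_of_le_of_ne ha.1.2 (by rintro rfl; exact hx ha.1.1.2)
  have hxb : x < b := lt_of_le_of_ne hb.1.2 (by rintro rfl; exact hx hb.1.1.2)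
  refine ⟨a, b, ha.1.1.1.1, hb.1.1.1.2, ⟨hax, hxb⟩, hax.trans hxb, ha.1.1.2, hb.1.1.2, ?_⟩
  intro y hy hey
  have hy01 : y ∈ Icc (0:ℝ) 1 := ⟨ha.1.1.1.1.trans hy.1.le, hy.2.le.trans hb.1.1.1.2⟩
  rcases le_total y x with h1 | h1
  · exact absurd (ha.2 ⟨⟨hy01, hey⟩, h1⟩) (not_le.2 hy.1)
  · exact absurd (hb.2 ⟨⟨hy01, hey⟩, h1⟩) (not_le.2 hy.2)

end IsD

/-- A commuting map fixing an interior point preserves the component. -/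
lemma Comp.preserved {f g : Equiv.Perm ℝ} (hf : IsD f) (hc : Commute f g) {c d x : ℝ}
    (h : Comp g c d) (hx : x ∈ Ioo c d) (hfx : f x = x) : f c = c ∧ f d = d := by
  have hcm : ∀ y, f (g y) = g (f y) := fun y => by
    have := congrArg (fun e : Equiv.Perm ℝ => e y) hc.eq; exact this
  have hic : ∀ y, f⁻¹ (g y) = g (f⁻¹ y) := fun y => by
    rw [Equiv.Perm.inv_eq_iff_eq, hcm, perm_ai]
  have hix : f⁻¹ x = x := by rw [Equiv.Perm.inv_eq_iff_eq, hfx]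
  have fixc : ∀ y, g y = y → g (f y) = f y := fun y hy => by rw [← hcm, hy]
  have fixi : ∀ y, g y = y → g (f⁻¹ y) = f⁻¹ y := fun y hy => by rw [← hic, hy]
  constructor
  · rcases lt_trichotomy (f c) c with h1 | h1 | h1
    · exfalso
      have h2 := hf.inv.smono h1
      have h3 := hf.inv.smono hx.1
      rw [perm_ia] at h2
      rw [hix] at h3
      exact h.ne _ ⟨h2, h3.trans hx.2⟩ (fixi c h.fa)
    · exact h1
    · exfalso
      have h3 := hf.smono hx.1
      rw [hfx] at h3
      exact h.ne _ ⟨h1, h3.trans hx.2⟩ (fixc c h.fa)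
  · rcases lt_trichotomy (f d) d with h1 | h1 | h1
    · exfalso
      have h3 := hf.smono hx.2
      rw [hfx] at h3
      exact h.ne _ ⟨hx.1.trans h3, h1⟩ (fixc d h.fb)
    · exact h1
    · exfalso
      have h2 := hf.inv.smono h1
      have h3 := hf.inv.smono hx.2
      rw [perm_ia] at h2
      rw [hix] at h3
      exact h.ne _ ⟨hx.1.trans h3, h2⟩ (fixi d h.fb)

open scoped Manifold in
lemma bump_exists {U : Set ℝ} (hU : IsOpen U) (hIU : Icc (0:ℝ) 1 ⊆ U) :
    ∃ χ : ℝ → ℝ, ContDiff ℝ ∞ χ ∧ (∀ x, x ∉ U → χ x = 0) ∧ (∀ x ∈ Icc (0:ℝ) 1, χ x = 1) ∧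
      ∀ x, χ x ∈ Icc (0:ℝ) 1 := by
  obtain ⟨χ, h1, h2, h3⟩ := exists_contMDiffMap_zero_one_of_isClosed (n := ⊤) 𝓘(ℝ, ℝ) hU.isClosed_compl
    (isClosed_Icc (a := (0:ℝ)) (b := 1)) (disjoint_left.2 fun x hx hx' => hx (hIU hx'))
  exact ⟨χ, χ.contMDiff.contDiff, fun x hx => h1 hx, fun x hx => h2 hx, h3⟩

lemma GD.ofDeriv {d : ℝ → ℝ} (hd : ContDiff ℝ ∞ d) {c : ℝ} (hc : 0 < c) (hcd : ∀ x, c ≤ d x) :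
    ∃ F Fi, GD F Fi ∧ F 0 = 0 ∧ ∀ x, HasDerivAt F (d x) x := by
  let F : ℝ → ℝ := fun x => ∫ t in (0:ℝ)..x, d t
  have hF : ∀ x, HasDerivAt F (d x) x := fun x =>
    intervalIntegral.integral_hasDerivAt_right (hd.continuous.intervalIntegrable _ _)
      hd.continuous.stronglyMeasurable.stronglyMeasurableAtFilter hd.continuous.continuousAt
  have hF0 : F 0 = 0 := by simp [F]
  have hdF : deriv F = d := funext fun x => (hF x).deriv
  have hs : ContDiff ℝ ∞ F := contDiff_infty_iff_deriv.2 ⟨fun x => (hF x).differentiableAt, by rwa [hdF]⟩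
  have hpos : ∀ x, 0 < deriv F x := fun x => by rw [hdF]; exact hc.trans_le (hcd x)
  have hmono : StrictMono F := strictMono_of_deriv_pos hpos
  have hm : Monotone fun x => F x - c * x := by
    refine monotone_of_deriv_nonneg (hs.differentiable (by simp) |>.sub (by fun_prop)) fun x => ?_
    have : HasDerivAt (fun x => F x - c * x) (d x - c * 1) x :=
      (hF x).sub ((hasDerivAt_id x).const_mul c)
    rw [this.deriv]; linarith [hcd x]
  have hsurj : Function.Surjective F := by
    refine hs.continuous.surjective ?_ ?_
    · refine tendsto_atTop_mono' _ ?_ (tendsto_id.const_mul_atTop hc)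
      filter_upwards [eventually_ge_atTop 0] with x hx
      have := hm hx
      simp only [hF0, mul_zero, sub_zero] at this
      simp only [id]; linarith
    · refine tendsto_atBot_mono' _ ?_ (tendsto_id.const_mul_atBot hc)
      filter_upwards [eventually_le_atBot 0] with x hx
      have := hm hx
      simp only [hF0, mul_zero, sub_zero] at this
      simp only [id]; linarith
  let H : ℝ ≃ₜ ℝ := (hmono.orderIsoOfSurjective F hsurj).toHomeomorph
  refine ⟨F, H.symm, ⟨hs, ?_, fun x => H.symm_apply_apply x, fun x => H.apply_symm_apply x, hpos⟩, hF0, hF⟩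
  exact H.contDiff_symm_deriv (f' := d) (fun x => (hc.trans_le (hcd x)).ne') hF hs

lemma GD.exists_ext {f : ℝ → ℝ} (hf : SmoothDiffeoI f) :
    ∃ F Fi, GD F Fi ∧ ∀ x ∈ Icc (0:ℝ) 1, f x = F x := by
  obtain ⟨hs, h0, h1, hp, -⟩ := hf
  have hdf : Differentiable ℝ f := (contDiff_infty_iff_deriv.1 hs).1
  have hds : ContDiff ℝ ∞ (deriv f) := (contDiff_infty_iff_deriv.1 hs).2
  let U : Set ℝ := {x | 0 < deriv f x} ∩ Ioo (-1) 2
  have hU : IsOpen U := (isOpen_lt continuous_const hds.continuous).inter isOpen_Ioo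
  have hIU : Icc (0:ℝ) 1 ⊆ U := fun x hx => ⟨hp x hx, by linarith [hx.1], by linarith [hx.2]⟩
  obtain ⟨χ, hχs, hχ0, hχ1, hχ⟩ := bump_exists hU hIU
  let d : ℝ → ℝ := fun x => χ x * deriv f x + (1 - χ x)
  have hd : ContDiff ℝ ∞ d := (hχs.mul hds).add (contDiff_const.sub hχs)
  have hdpos : ∀ x, 0 < d x := by
    intro x
    by_cases hx : x ∈ U
    · have h2 := hx.1
      simp only [mem_setOf_eq] at h2
      obtain ⟨h3, h4⟩ := hχ x
      change 0 < χ x * deriv f x + (1 - χ x)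
      rcases h3.eq_or_lt with h5 | h5
      · rw [← h5]; norm_num
      · have := mul_pos h5 h2; linarith
    · simp [d, hχ0 x hx]
  obtain ⟨z, hz, hzm⟩ := isCompact_Icc.exists_isMinOn (s := Icc (-1:ℝ) 2) ⟨0, by norm_num⟩
    hd.continuous.continuousOn
  obtain ⟨F, Fi, hG, hF0, hFd⟩ := GD.ofDeriv hd (c := min (d z) 1) (lt_min (hdpos z) one_pos) (by
    intro x
    by_cases hx : x ∈ Icc (-1:ℝ) 2
    · exact (min_le_left _ _).trans (hzm hx)
    · have : x ∉ U := fun h => hx ⟨h.2.1.le, h.2.2.le⟩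
      have : d x = 1 := by simp [d, hχ0 x this]
      rw [this]; exact min_le_right _ _)
  refine ⟨F, Fi, hG, fun x hx => ?_⟩
  have key : ∀ y ∈ Icc (0:ℝ) 1, HasDerivWithinAt (fun y => f y - F y) 0 (Icc 0 1) y := by
    intro y hy
    refine ((hdf y).hasDerivAt.sub (hFd y)).hasDerivWithinAt.congr_deriv ?_
    simp [d, hχ1 y hy]
  have := (convex_Icc (0:ℝ) 1).is_const_of_fderivWithin_eq_zero (𝕜 := ℝ) (f := fun y => f y - F y)
    (fun y hy => (key y hy).differentiableWithinAt) (fun y hy => by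
      have := (key y hy).hasFDerivWithinAt.fderivWithin (uniqueDiffOn_Icc one_pos y hy)
      rw [this]; ext; simp) hx ⟨le_rfl, zero_le_one⟩
  simp only [h0, hF0, sub_zero] at this
  linarith

open Classical in
lemma IsD.exists_of {f : ℝ → ℝ} (hf : SmoothDiffeoI f) :
    ∃ e : Equiv.Perm ℝ, IsD e ∧ ∀ x ∈ Icc (0:ℝ) 1, e x = f x := by
  obtain ⟨F, Fi, hd, hF⟩ := GD.exists_ext hf
  obtain ⟨hs, h0, h1, hp, hm⟩ := hf
  have F0 : F 0 = 0 := by rw [← hF 0 ⟨le_rfl, zero_le_one⟩, h0]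
  have F1 : F 1 = 1 := by rw [← hF 1 ⟨zero_le_one, le_rfl⟩, h1]
  have m1 : ∀ x ∈ Icc (0:ℝ) 1, F x ∈ Icc (0:ℝ) 1 := fun x hx => by rw [← hF x hx]; exact hm hx
  have m2 : ∀ x ∈ Icc (0:ℝ) 1, Fi x ∈ Icc (0:ℝ) 1 := fun x hx =>
    ⟨by have := hd.symm.smono.monotone hx.1; rwa [hd.fix_symm F0] at this,
     by have := hd.symm.smono.monotone hx.2; rwa [hd.fix_symm F1] at this⟩
  let e : Equiv.Perm ℝ :=
    { toFun := fun x => if x ∈ Icc (0:ℝ) 1 then F x else x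
      invFun := fun x => if x ∈ Icc (0:ℝ) 1 then Fi x else x
      left_inv := fun x => by
        beta_reduce
        by_cases hx : x ∈ Icc (0:ℝ) 1
        · rw [if_pos hx, if_pos (m1 x hx), hd.li]
        · rw [if_neg hx, if_neg hx]
      right_inv := fun x => by
        beta_reduce
        by_cases hx : x ∈ Icc (0:ℝ) 1
        · rw [if_pos hx, if_pos (m2 x hx), hd.ri]
        · rw [if_neg hx, if_neg hx] }
  have he : ∀ x, e x = if x ∈ Icc (0:ℝ) 1 then F x else x := fun x => rfl
  refine ⟨e, ⟨fun x hx => by rw [he, if_neg hx], F, Fi, hd, fun x hx => by rw [he, if_pos hx]⟩,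
    fun x hx => by rw [he, if_pos hx, hF x hx]⟩

lemma IsD.ext {e e' : Equiv.Perm ℝ} (h : IsD e) (h' : IsD e') (hh : ∀ x ∈ Ioo (0:ℝ) 1, e x = e' x) :
    e = e' := by
  ext x
  by_cases hx : x ∈ Ioo (0:ℝ) 1
  · exact hh x hx
  · have h1 : e x = x := by by_contra h2; exact hx (h.mem_of_ne h2)
    have h2 : e' x = x := by by_contra h2; exact hx (h'.mem_of_ne h2)
    rw [h1, h2]

lemma EndData.mono {f fi : ℝ → ℝ} {p a b L T : ℝ} {ξ τ : ℝ → ℝ} (h : EndData f fi p (Ioo a b) L ξ τ T) :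
    (StrictMonoOn τ (Ioo a b) ∧ ∀ z ∈ Ioo a b, z < f z) ∨
      (StrictAntiOn τ (Ioo a b) ∧ ∀ z ∈ Ioo a b, f z < z) := by
  have hc : ContinuousOn τ (Ioo a b) := fun x hx => (h.tau x hx).continuousAt.continuousWithinAt
  rcases sign_of_ne isPreconnected_Ioo h.sm.continuousOn h.ne with h1 | h1
  · right
    have hm : StrictAntiOn τ (Ioo a b) := by
      refine strictAntiOn_of_deriv_neg (convex_Ioo a b) hc fun x hx => ?_
      rw [interior_Ioo] at hx
      rw [(h.tau x hx).deriv]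
      exact inv_lt_zero.2 (h1 x hx)
    refine ⟨hm, fun z hz => ?_⟩
    rw [← hm.lt_iff_gt hz (h.maps z hz), h.tf z hz]
    linarith
  · left
    have hm : StrictMonoOn τ (Ioo a b) := by
      refine strictMonoOn_of_deriv_pos (convex_Ioo a b) hc fun x hx => ?_
      rw [interior_Ioo] at hx
      rw [(h.tau x hx).deriv]
      exact inv_pos.2 (h1 x hx)
    refine ⟨hm, fun z hz => ?_⟩
    rw [← hm.lt_iff_lt hz (h.maps z hz), h.tf z hz]
    linarith

lemma EndData.inj {f fi : ℝ → ℝ} {p a b L T : ℝ} {ξ τ : ℝ → ℝ} (h : EndData f fi p (Ioo a b) L ξ τ T) :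
    InjOn τ (Ioo a b) := by
  rcases h.mono with h1 | h1
  · exact h1.1.injOn
  · exact h1.1.injOn

lemma EndData.sgn {f fi : ℝ → ℝ} {p a b L T : ℝ} {ξ τ : ℝ → ℝ} (h : EndData f fi p (Ioo a b) L ξ τ T)
    {x y z : ℝ} (hx : x ∈ Ioo a b) (hy : y ∈ Ioo a b) (hz : z ∈ Ioo a b) (hxy : τ x < τ y) :
    0 < (y - x) * (f z - z) := by
  rcases h.mono with h1 | h1
  · exact mul_pos (sub_pos.2 ((h1.1.lt_iff_lt hx hy).1 hxy)) (sub_pos.2 (h1.2 z hz))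
  · exact mul_pos_of_neg_of_neg (sub_neg.2 ((h1.1.lt_iff_gt hx hy).1 hxy)) (sub_neg.2 (h1.2 z hz))

/-- a commuting diffeomorphism acts by translation in the time coordinate -/
lemma EndData.trans {f fi g : ℝ → ℝ} {p a b L T : ℝ} {ξ τ : ℝ → ℝ}
    (h : EndData f fi p (Ioo a b) L ξ τ T) (hab : a < b) (hg : ContDiff ℝ ∞ g) (hgd : ∀ x, 0 < deriv g x)
    (hgp : g p = p) (hgm : ∀ x ∈ Ioo a b, g x ∈ Ioo a b) (hgc : ∀ x ∈ Ioo a b, g (f x) = f (g x)) :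
    ∃ α, ∀ x ∈ Ioo a b, τ (g x) = τ x + α := by
  have key : ∀ x ∈ Ioo a b, HasDerivAt (fun x => τ (g x) - τ x) 0 x := by
    intro x hx
    have h1 := ((h.tau _ (hgm x hx)).comp x
      ((contDiff_infty_iff_deriv.1 hg).1 x).hasDerivAt).sub (h.tau x hx)
    refine h1.congr_deriv ?_
    rw [h.cen g hg hgd hgp hgm hgc x hx, mul_inv]
    have := (hgd x).ne'
    field_simp
    ring
  obtain ⟨c, hc⟩ : (Ioo a b).Nonempty := nonempty_Ioo.2 hab
  refine ⟨τ (g c) - τ c, fun x hx => ?_⟩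
  have := isOpen_Ioo.is_const_of_deriv_eq_zero (isPreconnected_Ioo)
    (fun x hx => (key x hx).differentiableAt.differentiableWithinAt) (fun x hx => (key x hx).deriv) hx hc
  linarith

lemma perm_comm {f g : Equiv.Perm ℝ} (hc : Commute f g) (y : ℝ) : f (g y) = g (f y) :=
  congrArg (fun e : Equiv.Perm ℝ => e y) hc.eq

/-- Summary of the data attached to an end of a component. -/
structure CD (f : Equiv.Perm ℝ) (F Fi : ℝ → ℝ) (a b p : ℝ) (ξ τ : ℝ → ℝ) (T : ℝ) : Prop where
  D : IsD f
  gd : GD F Fi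
  eF : ∀ x ∈ Icc (0:ℝ) 1, f x = F x
  eFi : ∀ x ∈ Icc (0:ℝ) 1, f⁻¹ x = Fi x
  a0 : 0 ≤ a
  b1 : b ≤ 1
  cp : Comp f a b
  pab : p = a ∨ p = b
  ed : EndData F Fi p (Ioo a b) (b - a) ξ τ T

lemma IsD.ioo {g : Equiv.Perm ℝ} (hg : IsD g) {a b x : ℝ} (ha : g a = a) (hb : g b = b) (hx : x ∈ Ioo a b) :
    g x ∈ Ioo a b := ⟨by have := hg.smono hx.1; rwa [ha] at this, by have := hg.smono hx.2; rwa [hb] at this⟩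

lemma IsD.cd {f : Equiv.Perm ℝ} (hf : IsD f) {F Fi : ℝ → ℝ} (hd : GD F Fi)
    (hF : ∀ x ∈ Icc (0:ℝ) 1, f x = F x) (hFi : ∀ x ∈ Icc (0:ℝ) 1, f⁻¹ x = Fi x) {a b : ℝ}
    (h : Comp f a b) (ha : 0 ≤ a) (hb : b ≤ 1) {p : ℝ} (hp : p = a ∨ p = b) :
    ∃ ξ τ T, CD f F Fi a b p ξ τ T := by
  have hcF : Comp F a b := by
    refine ⟨h.lt, ?_, ?_, ?_⟩
    · rw [← hF a ⟨ha, h.lt.le.trans hb⟩, h.fa]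
    · rw [← hF b ⟨ha.trans h.lt.le, hb⟩, h.fb]
    · intro x hx
      rw [← hF x ⟨ha.trans hx.1.le, hx.2.le.trans hb⟩]
      exact h.ne x hx
  rcases hp with rfl | rfl
  · obtain ⟨ξ, τ, T, h1⟩ := hcF.left hd
    exact ⟨ξ, τ, T, hf, hd, hF, hFi, ha, hb, h, Or.inl rfl, h1⟩
  · obtain ⟨ξ, τ, T, h1⟩ := hcF.right hd
    exact ⟨ξ, τ, T, hf, hd, hF, hFi, ha, hb, h, Or.inr rfl, h1⟩

namespace CD
variable {f g : Equiv.Perm ℝ} {F Fi : ℝ → ℝ} {a b p : ℝ} {ξ τ : ℝ → ℝ} {T : ℝ}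

lemma icc (h : CD f F Fi a b p ξ τ T) {x : ℝ} (hx : x ∈ Ioo a b) : x ∈ Icc (0:ℝ) 1 :=
  ⟨h.a0.trans hx.1.le, hx.2.le.trans h.b1⟩

lemma pmem (h : CD f F Fi a b p ξ τ T) : p ∈ Icc (0:ℝ) 1 := by
  rcases h.pab with rfl | rfl
  · exact ⟨h.a0, h.cp.lt.le.trans h.b1⟩
  · exact ⟨h.a0.trans h.cp.lt.le, h.b1⟩

lemma tf (h : CD f F Fi a b p ξ τ T) {x : ℝ} (hx : x ∈ Ioo a b) : τ (f x) = τ x + 1 := by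
  rw [h.eF x (h.icc hx)]; exact h.ed.tf x hx

lemma trans (h : CD f F Fi a b p ξ τ T) (hg : IsD g) (hc : Commute f g) (ga : g a = a) (gb : g b = b) :
    ∃ α, ∀ x ∈ Ioo a b, τ (g x) = τ x + α := by
  obtain ⟨G, Gi, hd, hG⟩ := hg.2
  obtain ⟨α, hα⟩ := h.ed.trans h.cp.lt hd.smooth hd.dpos (g := G) (by
      rw [← hG p h.pmem]
      rcases h.pab with h1 | h1
      · rw [h1, ga]
      · rw [h1, gb]) (fun x hx => by
      rw [← hG x (h.icc hx)]; exact hg.ioo ga gb hx) (fun x hx => by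
      rw [← hG x (h.icc hx), ← h.eF _ (hg.maps (h.icc hx)), ← h.eF x (h.icc hx),
        ← hG _ (h.D.maps (h.icc hx))]
      exact (perm_comm hc x).symm)
  exact ⟨α, fun x hx => by rw [hG x (h.icc hx)]; exact hα x hx⟩

lemma zpow_mem (hg : IsD g) (ga : g a = a) (gb : g b = b) (n : ℤ) {x : ℝ} (hx : x ∈ Ioo a b) :
    (g ^ n) x ∈ Ioo a b := by
  have hfix : ∀ c, g c = c → (g ^ n) c = c := fun c hc =>
    Equiv.Perm.zpow_apply_eq_self_of_apply_eq_self hc n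
  exact (hg.zpow n).ioo (hfix a ga) (hfix b gb) hx

lemma zpow_tau (hg : IsD g) (ga : g a = a) (gb : g b = b) {α : ℝ}
    (hα : ∀ x ∈ Ioo a b, τ (g x) = τ x + α) (n : ℤ) : ∀ {x : ℝ}, x ∈ Ioo a b →
    τ ((g ^ n) x) = τ x + n * α := by
  induction n using Int.induction_on with
  | zero => intro x hx; simp
  | succ n ih =>
    intro x hx
    rw [zpow_add_one, Equiv.Perm.mul_apply, ih (hg.ioo ga gb hx), hα x hx]
    push_cast; ring
  | pred n ih =>
    intro x hx
    have hia : g⁻¹ a = a := by rw [Equiv.Perm.inv_eq_iff_eq, ga]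
    have hib : g⁻¹ b = b := by rw [Equiv.Perm.inv_eq_iff_eq, gb]
    have hm := hg.inv.ioo hia hib hx
    have := hα _ hm
    rw [perm_ai] at this
    rw [zpow_sub_one, Equiv.Perm.mul_apply, ih hm, this]
    push_cast; ring

end CD

/-- `g` translates by `α` relatively to `f` at `y`. -/
def RR (f g : Equiv.Perm ℝ) (α y : ℝ) : Prop :=
  f y ≠ y ∧ ∀ n m : ℤ, (n * α < m → 0 < ((f ^ m) y - (g ^ n) y) * (f y - y)) ∧
    (n * α = m → (f ^ m) y = (g ^ n) y)

lemma CD.rr {f g : Equiv.Perm ℝ} {F Fi : ℝ → ℝ} {a b p : ℝ} {ξ τ : ℝ → ℝ} {T α : ℝ}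
    (h : CD f F Fi a b p ξ τ T) (hg : IsD g) (ga : g a = a) (gb : g b = b)
    (hα : ∀ x ∈ Ioo a b, τ (g x) = τ x + α) {y : ℝ} (hy : y ∈ Ioo a b) : RR f g α y := by
  refine ⟨h.cp.ne y hy, fun n m => ?_⟩
  have h1 := CD.zpow_mem h.D h.cp.fa h.cp.fb m hy
  have h2 := CD.zpow_mem hg ga gb n hy
  have h3 := CD.zpow_tau h.D h.cp.fa h.cp.fb (fun x hx => h.tf hx) m hy
  have h4 := CD.zpow_tau hg ga gb hα n hy
  refine ⟨fun hlt => ?_, fun he => ?_⟩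
  · have := h.ed.sgn h2 h1 hy (by rw [h3, h4]; linarith)
    rwa [← h.eF y (h.icc hy)] at this
  · exact h.ed.inj h1 h2 (by rw [h3, h4, he]; ring)

/-- If `f` fixes a point in a component of `g` then `f` is the identity there. -/
lemma Comp.id_of_fix {f g : Equiv.Perm ℝ} (hf : IsD f) (hg : IsD g) (hc : Commute f g) {c d x : ℝ}
    (h : Comp g c d) (h0 : 0 ≤ c) (h1 : d ≤ 1) (hx : x ∈ Ioo c d) (hfx : f x = x) :
    ∀ y ∈ Ioo c d, f y = y := by
  obtain ⟨fc, fd⟩ := h.preserved hf hc hx hfx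
  obtain ⟨F, Fi, hd, hF, hFi⟩ := hg.rep
  obtain ⟨ξ, τ, T, hcd⟩ := hg.cd hd hF hFi h h0 h1 (Or.inl rfl)
  obtain ⟨α, hα⟩ := hcd.trans hf hc.symm fc fd
  have h2 := hα x hx
  rw [hfx] at h2
  have h3 : α = 0 := by linarith
  intro y hy
  refine hcd.ed.inj (hf.ioo fc fd hy) hy ?_
  rw [hα y hy, h3, add_zero]

/-- A commuting map fixes the ends of the components. -/
lemma Comp.fixed {f g : Equiv.Perm ℝ} (hf : IsD f) (hg : IsD g) (hc : Commute f g) {a b : ℝ}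
    (h : Comp f a b) : g a = a ∧ g b = b := by
  constructor
  · by_contra hga
    obtain ⟨c, d, hc0, hd1, hacd, hcomp⟩ := hg.comp hga
    have := hcomp.id_of_fix hf hg hc hc0 hd1 hacd h.fa
    obtain ⟨z, hz1, hz2⟩ := exists_between (lt_min h.lt hacd.2)
    exact h.ne z ⟨hz1, hz2.trans_le (min_le_left _ _)⟩
      (this z ⟨hacd.1.trans hz1, hz2.trans_le (min_le_right _ _)⟩)
  · by_contra hgb
    obtain ⟨c, d, hc0, hd1, hbcd, hcomp⟩ := hg.comp hgb
    have := hcomp.id_of_fix hf hg hc hc0 hd1 hbcd h.fb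
    obtain ⟨z, hz1, hz2⟩ := exists_between (max_lt h.lt hbcd.1)
    exact h.ne z ⟨(le_max_left _ _).trans_lt hz1, hz2⟩
      (this z ⟨(le_max_right _ _).trans_lt hz1, hz2.trans hbcd.2⟩)

lemma Comp.exists_rr {f g : Equiv.Perm ℝ} (hf : IsD f) (hg : IsD g) (hc : Commute f g) {a b : ℝ}
    (h : Comp f a b) (h0 : 0 ≤ a) (h1 : b ≤ 1) : ∃ α, ∀ y ∈ Ioo a b, RR f g α y := by
  obtain ⟨ga, gb⟩ := h.fixed hf hg hc
  obtain ⟨F, Fi, hd, hF, hFi⟩ := hf.rep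
  obtain ⟨ξ, τ, T, hcd⟩ := hf.cd hd hF hFi h h0 h1 (Or.inl rfl)
  obtain ⟨α, hα⟩ := hcd.trans hg hc ga gb
  exact ⟨α, fun y hy => hcd.rr hg ga gb hα hy⟩

lemma exists_int_between {α β : ℝ} (h : α < β) : ∃ n m : ℤ, 0 < n ∧ n * α < m ∧ m < n * β := by
  obtain ⟨n, hn⟩ := exists_nat_gt (1 / (β - α))
  have h0 : 0 < β - α := sub_pos.2 h
  rw [div_lt_iff₀ h0] at hn
  have hn0 : 0 < n := by
    rcases Nat.eq_zero_or_pos n with rfl | h1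
    · simp at hn; linarith
    · exact h1
  refine ⟨n, ⌊n * α⌋ + 1, by exact_mod_cast hn0, ?_, ?_⟩
  · push_cast; exact Int.lt_floor_add_one _
  · push_cast
    have := Int.floor_le (n * α)
    linarith

lemma RR.not_lt {f g : Equiv.Perm ℝ} (hf : IsD f) (hg : IsD g) (hc : Commute f g) {α β y : ℝ}
    (h1 : RR f g α y) (h2 : RR f g β y) : ¬ α < β := by
  intro hlt
  obtain ⟨n, m, hn, hm1, hm2⟩ := exists_int_between hlt
  have k1 := (h1.2 n m).1 hm1
  have k2 := (h2.2 (-n) (-m)).1 (by push_cast; linarith)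
  have hD : IsD (f ^ m * g ^ n) := (hf.zpow m).mul (hg.zpow n)
  have e1 : (f ^ m * g ^ n) ((f ^ (-m)) y) = (g ^ n) y := by
    rw [← Equiv.Perm.mul_apply, ((hc.zpow_zpow m n).eq), mul_assoc, ← zpow_add, add_neg_cancel, zpow_zero,
      mul_one]
  have e2 : (f ^ m * g ^ n) ((g ^ (-n)) y) = (f ^ m) y := by
    rw [← Equiv.Perm.mul_apply, mul_assoc, ← zpow_add, add_neg_cancel, zpow_zero, mul_one]
  rcases lt_or_gt_of_ne h1.1 with hs | hs
  · have a1 : (f ^ m) y < (g ^ n) y := by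
      by_contra hh; push Not at hh
      nlinarith
    have a2 : (f ^ (-m)) y < (g ^ (-n)) y := by
      by_contra hh; push Not at hh
      nlinarith
    have := hD.smono a2
    rw [e1, e2] at this
    linarith
  · have a1 : (g ^ n) y < (f ^ m) y := by
      by_contra hh; push Not at hh
      nlinarith
    have a2 : (g ^ (-n)) y < (f ^ (-m)) y := by
      by_contra hh; push Not at hh
      nlinarith
    have := hD.smono a2
    rw [e1, e2] at this
    linarith

lemma RR.unique {f g : Equiv.Perm ℝ} (hf : IsD f) (hg : IsD g) (hc : Commute f g) {α β y : ℝ}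
    (h1 : RR f g α y) (h2 : RR f g β y) : α = β :=
  le_antisymm (_root_.not_lt.1 (RR.not_lt hf hg hc h2 h1)) (_root_.not_lt.1 (RR.not_lt hf hg hc h1 h2))

def Flat (F : ℝ → ℝ) (p : ℝ) : Prop := ∀ n, iteratedDeriv n (fun x => F x - x) p = 0

structure Setup (f g : Equiv.Perm ℝ) (F Fi G Gi : ℝ → ℝ) : Prop where
  hf : IsD f
  hg : IsD g
  hc : Commute f g
  gf : GD F Fi
  gg : GD G Gi
  eF : ∀ x ∈ Icc (0:ℝ) 1, f x = F x
  eFi : ∀ x ∈ Icc (0:ℝ) 1, f⁻¹ x = Fi x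
  eG : ∀ x ∈ Icc (0:ℝ) 1, g x = G x
  eGi : ∀ x ∈ Icc (0:ℝ) 1, g⁻¹ x = Gi x
  nd : ∀ x ∈ Ioo (0:ℝ) 1, ¬ (Flat F x ∧ Flat G x)

lemma IsD.lip {e : Equiv.Perm ℝ} (h : IsD e) : ∃ M, 0 ≤ M ∧ ∀ x ∈ Icc (0:ℝ) 1, ∀ y ∈ Icc (0:ℝ) 1,
    |e x - e y| ≤ M * |x - y| := by
  obtain ⟨F, Fi, hd, hF⟩ := h.2
  obtain ⟨M, hM⟩ := isCompact_Icc.exists_bound_of_continuousOn (s := Icc (0:ℝ) 1)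
    ((contDiff_infty_iff_deriv.1 hd.smooth).2.continuous.continuousOn)
  refine ⟨M, (norm_nonneg _).trans (hM 0 ⟨le_rfl, zero_le_one⟩), fun x hx y hy => ?_⟩
  rw [hF x hx, hF y hy]
  exact (convex_Icc (0:ℝ) 1).norm_image_sub_le_of_norm_deriv_le
    (fun z _ => (hd.hasD z).differentiableAt) hM hy hx

lemma IsD.pow_bound {e : Equiv.Perm ℝ} (h : IsD e) (N : ℕ) : ∃ C, 0 ≤ C ∧ ∀ y ∈ Icc (0:ℝ) 1,
    |(e ^ N) y - y| ≤ C * |e y - y| := by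
  obtain ⟨M, hM0, hM⟩ := h.lip
  induction N with
  | zero => exact ⟨0, le_rfl, fun y _ => by simp⟩
  | succ N ih =>
    obtain ⟨C, hC0, hC⟩ := ih
    have hN : IsD (e ^ N) := by have := h.zpow N; rwa [zpow_natCast] at this
    refine ⟨M * C + 1, by positivity, fun y hy => ?_⟩
    rw [pow_succ', Equiv.Perm.mul_apply]
    have h1 := hM _ (hN.maps hy) y hy
    have h2 := hC y hy
    have h3 := mul_le_mul_of_nonneg_left h2 hM0
    calc |e ((e ^ N) y) - y| = |(e ((e ^ N) y) - e y) + (e y - y)| := by ring_nf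
      _ ≤ |e ((e ^ N) y) - e y| + |e y - y| := abs_add_le _ _
      _ ≤ M * (C * |e y - y|) + |e y - y| := by linarith
      _ = _ := by ring

lemma rr_bound {f g : Equiv.Perm ℝ} (hf : IsD f) (hg : IsD g) (α : ℝ) :
    ∃ C, 0 ≤ C ∧ ∀ y, RR f g α y → |g y - y| ≤ C * |f y - y| := by
  obtain ⟨N, hN⟩ := exists_nat_gt |α|
  obtain ⟨C, hC0, hC⟩ := hf.pow_bound N
  obtain ⟨M, hM0, hM⟩ := hg.lip
  refine ⟨C + M * C, by positivity, fun y h => ?_⟩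
  have hy : y ∈ Icc (0:ℝ) 1 := Ioo_subset_Icc_self (hf.mem_of_ne h.1)
  have h1 := (h.2 1 N).1 (by push_cast; linarith [le_abs_self α])
  have h2 := (h.2 (-1) N).1 (by push_cast; linarith [neg_abs_le α])
  rw [zpow_one, zpow_natCast] at h1
  rw [zpow_neg_one, zpow_natCast] at h2
  have h3 := hC y hy
  have h4 := hM y hy _ (hg.imaps hy)
  rw [perm_ai] at h4
  have h5 := abs_nonneg (f y - y)
  have hMC : 0 ≤ M * C * |f y - y| := by positivity
  have hCC : 0 ≤ C * |f y - y| := by positivity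
  have key : ∀ z, 0 < ((f ^ N) y - z) * (f y - y) → 0 ≤ (z - y) * (f y - y) →
      |z - y| ≤ C * |f y - y| := by
    intro z hz1 hz2
    refine le_trans ?_ h3
    rcases lt_or_gt_of_ne h.1 with hs | hs
    · have a1 : (f ^ N) y < z := by by_contra hh; push Not at hh; nlinarith
      have a2 : z ≤ y := by by_contra hh; push Not at hh; nlinarith
      rw [abs_of_nonpos (by linarith), abs_of_nonpos (by linarith)]
      linarith
    · have a1 : z < (f ^ N) y := by by_contra hh; push Not at hh; nlinarith
      have a2 : y ≤ z := by by_contra hh; push Not at hh; nlinarith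
      rw [abs_of_nonneg (by linarith), abs_of_nonneg (by linarith)]
      linarith
  rcases le_or_gt 0 ((g y - y) * (f y - y)) with h6 | h6
  · have := key _ h1 h6
    linarith
  · have h7 : 0 ≤ (g⁻¹ y - y) * (f y - y) := by
      rcases lt_or_gt_of_ne h.1 with hs | hs
      · have a1 : y < g y := by by_contra hh; push Not at hh; nlinarith
        have := hg.inv.smono a1
        rw [perm_ia] at this
        nlinarith
      · have a1 : g y < y := by by_contra hh; push Not at hh; nlinarith
        have := hg.inv.smono a1
        rw [perm_ia] at this
        nlinarith
    have h8 := key _ h2 h7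
    rw [abs_sub_comm y] at h4
    have := mul_le_mul_of_nonneg_left h8 hM0
    linarith

lemma nebot_end {a b p : ℝ} (h : a < b) (hp : p = a ∨ p = b) : (𝓝[Ioo a b] p).NeBot := by
  rw [← mem_closure_iff_nhdsWithin_neBot, closure_Ioo h.ne]
  rcases hp with rfl | rfl
  · exact left_mem_Icc.2 h.le
  · exact right_mem_Icc.2 h.le

lemma isolated {F Fi : ℝ → ℝ} (hF : GD F Fi) {p : ℝ} (h : ¬ Flat F p) :
    ∀ᶠ x in 𝓝[≠] p, F x ≠ x := by
  unfold Flat at h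
  push Not at h
  obtain ⟨n, hn⟩ := h
  obtain ⟨k, B, hB, hd, hBp⟩ := finite_order p n _ (hF.smooth.sub contDiff_id) hn
  have h1 : ∀ᶠ x in 𝓝[≠] p, B x ≠ 0 := (hB.continuous.continuousAt.eventually_ne hBp).filter_mono nhdsWithin_le_nhds
  filter_upwards [h1, self_mem_nhdsWithin] with x hx hxp he
  have h2 := hd x
  simp only [id] at h2
  rw [he, sub_self] at h2
  exact mul_ne_zero (pow_ne_zero k (sub_ne_zero.2 hxp)) hx h2.symm

lemma flat_closed {F Fi : ℝ → ℝ} (hF : GD F Fi) : IsClosed {x | Flat F x} := by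
  have : {x | Flat F x} = ⋂ n, {x | iteratedDeriv n (fun x => F x - x) x = 0} := by
    ext x; simp [Flat]
  rw [this]
  refine isClosed_iInter fun n => isClosed_eq ?_ continuous_const
  exact (hF.smooth.sub contDiff_id).continuous_iteratedDeriv n (by exact_mod_cast le_top)

lemma flat_of_ev {F : ℝ → ℝ} {x : ℝ} (h : ∀ᶠ y in 𝓝 x, F y = y) : Flat F x := by
  intro n
  have h1 : (fun x => F x - x) =ᶠ[𝓝 x] fun _ => 0 := by
    filter_upwards [h] with y hy; rw [hy, sub_self]
  rw [h1.iteratedDeriv_eq n]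
  simp [iteratedDeriv_const]

namespace Setup
variable {f g : Equiv.Perm ℝ} {F Fi G Gi : ℝ → ℝ}

lemma symm (S : Setup f g F Fi G Gi) : Setup g f G Gi F Fi :=
  ⟨S.hg, S.hf, S.hc.symm, S.gg, S.gf, S.eG, S.eGi, S.eF, S.eFi, fun x hx h => S.nd x hx ⟨h.2, h.1⟩⟩

lemma end_notflat (S : Setup f g F Fi G Gi) {a b p : ℝ} (h : Comp f a b) (h0 : 0 ≤ a) (h1 : b ≤ 1)
    (hp : p = a ∨ p = b) (hp01 : p ∈ Ioo (0:ℝ) 1) : ¬ Flat F p := by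
  intro hfl
  refine S.nd p hp01 ⟨hfl, ?_⟩
  by_contra hG
  unfold Flat at hG
  push Not at hG
  obtain ⟨n, hn⟩ := hG
  obtain ⟨k, B, hB, hd, hBp⟩ := finite_order p n _ (S.gg.smooth.sub contDiff_id) hn
  obtain ⟨B2, hB2, hd2, -⟩ := divides_of_flat p (k+1) _ (S.gf.smooth.sub contDiff_id) hfl
  obtain ⟨α, hα⟩ := h.exists_rr S.hf S.hg S.hc h0 h1
  obtain ⟨C, hC0, hC⟩ := rr_bound S.hf S.hg α
  have hpe := nebot_end h.lt hp
  have key : ∀ᶠ y in 𝓝[Ioo a b] p, |B y| ≤ C * (|y - p| * |B2 y|) := by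
    filter_upwards [self_mem_nhdsWithin] with y hy
    have hyI : y ∈ Icc (0:ℝ) 1 := ⟨h0.trans hy.1.le, hy.2.le.trans h1⟩
    have k1 := hC y (hα y hy)
    have k2 := hd y
    have k3 := hd2 y
    simp only [id] at k2 k3
    rw [S.eF y hyI, S.eG y hyI, k2, k3, abs_mul, abs_mul, pow_succ, abs_mul] at k1
    have hyp : y - p ≠ 0 := by
      rw [sub_ne_zero]
      rcases hp with rfl | rfl
      · exact hy.1.ne'
      · exact hy.2.ne
    have hpos : 0 < |(y - p) ^ k| := abs_pos.2 (pow_ne_zero k hyp)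
    have : |(y - p) ^ k| * |B y| ≤ |(y - p) ^ k| * (C * (|y - p| * |B2 y|)) := by linarith
    exact le_of_mul_le_mul_left this hpos
  have t1 : Tendsto (fun y => |B y|) (𝓝[Ioo a b] p) (𝓝 |B p|) :=
    (hB.continuous.abs.tendsto p).mono_left nhdsWithin_le_nhds
  have t2 : Tendsto (fun y => C * (|y - p| * |B2 y|)) (𝓝[Ioo a b] p) (𝓝 0) := by
    have hcont : Continuous fun y => C * (|y - p| * |B2 y|) := by
      have := hB2.continuous
      fun_prop
    have := (hcont.tendsto p).mono_left (nhdsWithin_le_nhds (s := Ioo a b))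
    simpa using this
  have := le_of_tendsto_of_tendsto t1 t2 key
  exact hBp (abs_nonpos_iff.1 this)

lemma flat_id (S : Setup f g F Fi G Gi) {x : ℝ} (hx : x ∈ Ioo (0:ℝ) 1) (hfl : Flat F x) :
    ∀ᶠ y in 𝓝 x, f y = y := by
  have hfx : f x = x := by
    have := hfl 0
    rw [iteratedDeriv_zero] at this
    rw [S.eF x (Ioo_subset_Icc_self hx)]; linarith
  by_cases hgx : g x = x
  · have hG : ¬ Flat G x := fun h => S.nd x hx ⟨hfl, h⟩
    have h1 := isolated S.gg hG
    rw [eventually_nhdsWithin_iff] at h1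
    have h2 := h1.and (Ioo_mem_nhds hx.1 hx.2)
    obtain ⟨l, u, hlu, hs⟩ := mem_nhds_iff_exists_Ioo_subset.1 h2
    have gfix : ∀ c ∈ Ioo l u, g c = c → c = x := by
      intro c hc hgc
      by_contra hcx
      have := hs hc
      refine this.1 hcx ?_
      rw [← S.eG c (Ioo_subset_Icc_self this.2), hgc]
    filter_upwards [Ioo_mem_nhds hlu.1 hlu.2] with y hy
    by_contra hfy
    obtain ⟨a, b, ha, hb, hyab, hcomp⟩ := S.hf.comp hfy
    obtain ⟨ga, gb⟩ := hcomp.fixed S.hf S.hg S.hc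
    have hxn : x ∉ Ioo a b := fun h => hcomp.ne x h hfx
    rcases lt_trichotomy y x with h3 | h3 | h3
    · have hbx : b ≤ x := by
        by_contra hh; push Not at hh
        exact hxn ⟨hyab.1.trans h3, hh⟩
      have := gfix b ⟨hy.1.trans hyab.2, hbx.trans_lt hlu.2⟩ gb
      exact S.end_notflat hcomp ha hb (p := x) (Or.inr this.symm) hx hfl
    · exact hfy (by rw [h3, hfx])
    · have hbx : x ≤ a := by
        by_contra hh; push Not at hh
        exact hxn ⟨hh, h3.trans hyab.2⟩
      have := gfix a ⟨hlu.1.trans_le hbx, hyab.1.trans hy.2⟩ ga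
      exact S.end_notflat hcomp ha hb (p := x) (Or.inl this.symm) hx hfl
  · obtain ⟨a, b, ha, hb, hxab, hcomp⟩ := S.hg.comp hgx
    have := hcomp.id_of_fix S.hf S.hg S.hc ha hb hxab hfx
    filter_upwards [Ioo_mem_nhds hxab.1 hxab.2] with y hy using this y hy

lemma ev_flat (S : Setup f g F Fi G Gi) {x : ℝ} (hx : x ∈ Ioo (0:ℝ) 1) (h : ∀ᶠ y in 𝓝 x, f y = y) :
    Flat F x := by
  refine flat_of_ev ?_
  filter_upwards [h, Ioo_mem_nhds hx.1 hx.2] with y hy hy2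
  rw [← S.eF y (Ioo_subset_Icc_self hy2), hy]

lemma eq_one (S : Setup f g F Fi G Gi) {x : ℝ} (hx : x ∈ Ioo (0:ℝ) 1) (hfl : Flat F x) : f = 1 := by
  let u : Set ℝ := {x | x ∈ Ioo (0:ℝ) 1 ∧ ∀ᶠ y in 𝓝 x, f y = y}
  have hu : IsOpen u := by
    have : u = Ioo 0 1 ∩ interior {y | f y = y} := by
      ext z; simp only [u, mem_inter_iff, mem_interior_iff_mem_nhds]; rfl
    rw [this]; exact isOpen_Ioo.inter isOpen_interior
  have hsub : Ioo (0:ℝ) 1 ⊆ u := by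
    refine isPreconnected_Ioo.subset_of_closure_inter_subset hu ⟨x, hx, hx, S.flat_id hx hfl⟩ ?_
    rintro z ⟨hz1, hz2⟩
    refine ⟨hz2, S.flat_id hz2 ?_⟩
    have : closure u ⊆ {x | Flat F x} := closure_minimal (fun w hw => S.ev_flat hw.1 hw.2) (flat_closed S.gf)
    exact this hz1
  refine S.hf.ext IsD.one' fun y hy => ?_
  exact (hsub hy).2.self_of_nhds

end Setup

lemma RR.neg_side {f g : Equiv.Perm ℝ} (hf : IsD f) (hc : Commute f g) {α z : ℝ}
    (h : RR f g α z) {n m : ℤ} (hnm : n * α < m) : ((g ^ n * f ^ (-m)) z - z) * (f z - z) < 0 := by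
  have h1 := (h.2 n m).1 hnm
  have e1 : (f ^ (-m)) ((f ^ m) z) = z := by
    rw [← Equiv.Perm.mul_apply, ← zpow_add, neg_add_cancel, zpow_zero]; rfl
  have e2 : (f ^ (-m)) ((g ^ n) z) = (g ^ n * f ^ (-m)) z := by
    rw [← Equiv.Perm.mul_apply, (hc.zpow_zpow (-m) n).eq]
  have hm := (hf.zpow (-m)).smono
  rcases lt_or_gt_of_ne h.1 with hs | hs
  · have a1 : (f ^ m) z < (g ^ n) z := by by_contra hh; push Not at hh; nlinarith
    have := hm a1
    rw [e1, e2] at this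
    nlinarith
  · have a1 : (g ^ n) z < (f ^ m) z := by by_contra hh; push Not at hh; nlinarith
    have := hm a1
    rw [e1, e2] at this
    nlinarith

lemma RR.pos_side {f g : Equiv.Perm ℝ} (hf : IsD f) (hg : IsD g) (hc : Commute f g) {α z : ℝ}
    (h : RR f g α z) {n m : ℤ} (hnm : m + 1 < n * α) :
    0 < ((g ^ n * f ^ (-m)) z - f z) * (f z - z) := by
  have h1 := (h.2 (-n) (-(m+1))).1 (by push_cast; linarith)
  have hD : IsD (g ^ n * f) := (hg.zpow n).mul hf
  have e1 : (g ^ n * f) ((f ^ (-(m+1))) z) = (g ^ n * f ^ (-m)) z := by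
    rw [← Equiv.Perm.mul_apply, mul_assoc, ← zpow_one_add]
    congr 3; ring
  have e2 : (g ^ n * f) ((g ^ (-n)) z) = f z := by
    have : Commute (g ^ n) f := (hc.zpow_right n).symm
    rw [← Equiv.Perm.mul_apply, this.eq, mul_assoc, ← zpow_add, add_neg_cancel, zpow_zero, mul_one]
  have hm := hD.smono
  rcases lt_or_gt_of_ne h.1 with hs | hs
  · have a1 : (f ^ (-(m+1))) z < (g ^ (-n)) z := by by_contra hh; push Not at hh; nlinarith
    have := hm a1
    rw [e1, e2] at this
    nlinarith
  · have a1 : (g ^ (-n)) z < (f ^ (-(m+1))) z := by by_contra hh; push Not at hh; nlinarith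
    have := hm a1
    rw [e1, e2] at this
    nlinarith

lemma exists_int_between' {α β : ℝ} (h : α < β) : ∃ n m : ℤ, n * α < m ∧ m + 1 < n * β := by
  obtain ⟨n, hn⟩ := exists_nat_gt (2 / (β - α))
  have h0 : 0 < β - α := sub_pos.2 h
  rw [div_lt_iff₀ h0] at hn
  refine ⟨n, ⌊n * α⌋ + 1, ?_, ?_⟩
  · push_cast; exact Int.lt_floor_add_one _
  · push_cast
    have := Int.floor_le (n * α)
    linarith

lemma match_lt {f g : Equiv.Perm ℝ} {F Fi : ℝ → ℝ} (hf : IsD f) (hg : IsD g) (hc : Commute f g)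
    (gf : GD F Fi) (eF : ∀ x ∈ Icc (0:ℝ) 1, f x = F x) {p b a1 b1 a2 b2 α β : ℝ} (hp0 : 0 ≤ p) (hb1 : b ≤ 1)
    (hnf : ¬ Flat F p) (hR : Comp f p b) (hab1 : a1 < b1) (hab2 : a2 < b2)
    (h10 : 0 ≤ a1) (h11 : b1 ≤ 1) (h20 : 0 ≤ a2) (h21 : b2 ≤ 1) (hp1 : p = a1 ∨ p = b1) (hp2 : p = a2 ∨ p = b2)
    (hα : ∀ y ∈ Ioo a1 b1, RR f g α y) (hβ : ∀ y ∈ Ioo a2 b2, RR f g β y) : ¬ α < β := by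
  intro hlt
  obtain ⟨n, m, hm1, hm2⟩ := exists_int_between' hlt
  set e := g ^ n * f ^ (-m) with he
  have hD : IsD e := (hg.zpow n).mul (hf.zpow (-m))
  have hcm : Commute f e := (hc.zpow_right n).mul_right (Commute.zpow_right (Commute.refl f) (-m))
  obtain ⟨H, Hi, hH, eH⟩ := hD.2
  obtain ⟨γ, hγ⟩ := hR.exists_rr hf hD hcm hp0 hb1
  obtain ⟨C, hC0, hC⟩ := rr_bound hf hD γ
  unfold Flat at hnf
  push Not at hnf
  obtain ⟨j, hj⟩ := hnf
  obtain ⟨k, A, hA, hd, hAp⟩ := finite_order p j _ (gf.smooth.sub contDiff_id) hj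
  have hd' : ∀ x, F x - x = (x - p) ^ k * A x := hd
  obtain ⟨B, hB, hdB⟩ := divides_of_bound p k (fun x => H x - x) (hH.smooth.sub contDiff_id) (by
    refine ⟨C * (|A p| + 1), ?_⟩
    have h1 : ∀ᶠ x in 𝓝[>] p, |A x| < |A p| + 1 :=
      ((hA.continuous.abs.tendsto p).eventually_lt_const (lt_add_one _)).filter_mono nhdsWithin_le_nhds
    filter_upwards [h1, Ioo_mem_nhdsGT hR.lt] with x hx1 hx2
    have hxI : x ∈ Icc (0:ℝ) 1 := ⟨hp0.trans hx2.1.le, hx2.2.le.trans hb1⟩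
    have h2 := hC x (hγ x hx2)
    rw [eF x hxI, eH x hxI, hd', abs_mul, abs_pow, abs_of_pos (sub_pos.2 hx2.1)] at h2
    refine h2.trans ?_
    have h3 : 0 ≤ C * (x - p) ^ k := mul_nonneg hC0 (pow_nonneg (sub_nonneg.2 hx2.1.le) k)
    nlinarith)
  have t : ∀ s : Set ℝ, Tendsto (fun x => B x / A x) (𝓝[s] p) (𝓝 (B p / A p)) := fun s =>
    ((hB.continuous.tendsto p).div (hA.continuous.tendsto p) hAp).mono_left nhdsWithin_le_nhds
  have hne1 := nebot_end hab1 hp1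
  have hne2 := nebot_end hab2 hp2
  have l1 : B p / A p ≤ 0 := by
    refine le_of_tendsto (t (Ioo a1 b1)) ?_
    filter_upwards [self_mem_nhdsWithin] with x hx
    have hxI : x ∈ Icc (0:ℝ) 1 := ⟨h10.trans hx.1.le, hx.2.le.trans h11⟩
    have h2 := RR.neg_side hf hc (hα x hx) hm1
    rw [← he, eF x hxI, eH x hxI, hd', hdB] at h2
    have h3 : ((x - p) ^ k) ^ 2 * (B x * A x) < 0 := by nlinarith
    have h4 : B x * A x < 0 := by
      by_contra hh; push Not at hh
      nlinarith [mul_nonneg (sq_nonneg ((x - p) ^ k)) hh]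
    have h5 : B x / A x = B x * A x * (A x * A x)⁻¹ := by
      have : A x ≠ 0 := by rintro h; rw [h] at h4; simp at h4
      field_simp
    rw [h5]
    exact mul_nonpos_of_nonpos_of_nonneg h4.le (inv_nonneg.2 (mul_self_nonneg _))
  have l2 : 1 ≤ B p / A p := by
    refine ge_of_tendsto (t (Ioo a2 b2)) ?_
    filter_upwards [self_mem_nhdsWithin] with x hx
    have hxI : x ∈ Icc (0:ℝ) 1 := ⟨h20.trans hx.1.le, hx.2.le.trans h21⟩
    have h2 := RR.pos_side hf hg hc (hβ x hx) hm2
    have h6 : H x - F x = (x - p) ^ k * (B x - A x) := by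
      have := hdB x; have := hd' x; linarith
    rw [← he, eF x hxI, eH x hxI, hd', h6] at h2
    have h3 : 0 < ((x - p) ^ k) ^ 2 * ((B x - A x) * A x) := by nlinarith
    have h4 : 0 < (B x - A x) * A x := by
      by_contra hh; push Not at hh
      nlinarith [mul_nonneg (sq_nonneg ((x - p) ^ k)) (neg_nonneg.2 hh)]
    have h5 : B x / A x = 1 + (B x - A x) * A x * (A x * A x)⁻¹ := by
      have : A x ≠ 0 := by rintro h; rw [h] at h4; simp at h4
      field_simp
      ring
    rw [h5]
    have := mul_nonneg h4.le (inv_nonneg.2 (mul_self_nonneg (A x)))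
    linarith
  linarith

/-- The nontrivial situation. -/
structure NT (f g : Equiv.Perm ℝ) (F Fi G Gi : ℝ → ℝ) : Prop extends Setup f g F Fi G Gi where
  f1 : f ≠ 1
  g1 : g ≠ 1

namespace NT
variable {f g : Equiv.Perm ℝ} {F Fi G Gi : ℝ → ℝ}

lemma symm (S : NT f g F Fi G Gi) : NT g f G Gi F Fi := ⟨S.toSetup.symm, S.g1, S.f1⟩

lemma notflat (S : NT f g F Fi G Gi) {x : ℝ} (hx : x ∈ Ioo (0:ℝ) 1) : ¬ Flat F x := fun h =>
  S.f1 (S.toSetup.eq_one hx h)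

lemma fix (S : NT f g F Fi G Gi) {x : ℝ} (hx : f x = x) : g x = x := by
  by_contra hgx
  obtain ⟨a, b, ha, hb, hxab, hcomp⟩ := S.hg.comp hgx
  have := hcomp.id_of_fix S.hf S.hg S.hc ha hb hxab hx
  refine S.notflat (S.hg.mem_of_ne hgx) (S.toSetup.ev_flat (S.hg.mem_of_ne hgx) ?_)
  filter_upwards [Ioo_mem_nhds hxab.1 hxab.2] with y hy using this y hy

lemma isol (S : NT f g F Fi G Gi) {p : ℝ} (hp : p ∈ Ioo (0:ℝ) 1) :
    ∃ l u, p ∈ Ioo l u ∧ Ioo l u ⊆ Ioo 0 1 ∧ ∀ y ∈ Ioo l u, f y = y → y = p := by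
  have h1 := isolated S.gf (S.notflat hp)
  rw [eventually_nhdsWithin_iff] at h1
  have h2 := h1.and (Ioo_mem_nhds hp.1 hp.2)
  obtain ⟨l, u, hlu, hs⟩ := mem_nhds_iff_exists_Ioo_subset.1 h2
  refine ⟨l, u, hlu, fun y hy => (hs hy).2, fun y hy hfy => ?_⟩
  by_contra hyp
  refine (hs hy).1 hyp ?_
  rw [← S.eF y (Ioo_subset_Icc_self (hs hy).2), hfy]

lemma right (S : NT f g F Fi G Gi) {p : ℝ} (hp : p ∈ Ioo (0:ℝ) 1) (hfp : f p = p) :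
    ∃ b, b ≤ 1 ∧ Comp f p b := by
  obtain ⟨l, u, hlu, hs, hiso⟩ := S.isol hp
  obtain ⟨y, hy1, hy2⟩ := exists_between hlu.2
  have hfy : f y ≠ y := fun h => hy1.ne' (hiso y ⟨hlu.1.trans hy1, hy2⟩ h)
  obtain ⟨a, b, ha, hb, hyab, hcomp⟩ := S.hf.comp hfy
  have hpa : p ≤ a := by
    by_contra hh; push Not at hh
    exact hcomp.ne p ⟨hh, hy1.trans hyab.2⟩ hfp
  have := hiso a ⟨hlu.1.trans_le hpa, hyab.1.trans hy2⟩ hcomp.fa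
  exact ⟨b, hb, this ▸ hcomp⟩

lemma left (S : NT f g F Fi G Gi) {p : ℝ} (hp : p ∈ Ioo (0:ℝ) 1) (hfp : f p = p) :
    ∃ a, 0 ≤ a ∧ Comp f a p := by
  obtain ⟨l, u, hlu, hs, hiso⟩ := S.isol hp
  obtain ⟨y, hy1, hy2⟩ := exists_between hlu.1
  have hfy : f y ≠ y := fun h => hy2.ne (hiso y ⟨hy1, hy2.trans hlu.2⟩ h)
  obtain ⟨a, b, ha, hb, hyab, hcomp⟩ := S.hf.comp hfy
  have hpa : b ≤ p := by
    by_contra hh; push Not at hh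
    exact hcomp.ne p ⟨hyab.1.trans hy2, hh⟩ hfp
  have := hiso b ⟨hy1.trans hyab.2, hpa.trans_lt hlu.2⟩ hcomp.fb
  exact ⟨a, ha, this ▸ hcomp⟩

lemma local_alpha (S : NT f g F Fi G Gi) {p : ℝ} (hp : p ∈ Ioo (0:ℝ) 1) :
    ∃ α, ∀ᶠ z in 𝓝 p, f z ≠ z → RR f g α z := by
  by_cases hfp : f p = p
  · obtain ⟨b, hb, hR⟩ := S.right hp hfp
    obtain ⟨a, ha, hL⟩ := S.left hp hfp
    obtain ⟨α, hα⟩ := hR.exists_rr S.hf S.hg S.hc hp.1.le hb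
    obtain ⟨β, hβ⟩ := hL.exists_rr S.hf S.hg S.hc ha hp.2.le
    have h1 := match_lt S.hf S.hg S.hc S.gf S.eF hp.1.le hb (S.notflat hp) hR hR.lt hL.lt
      hp.1.le hb ha hp.2.le (Or.inl rfl) (Or.inr rfl) hα hβ
    have h2 := match_lt S.hf S.hg S.hc S.gf S.eF hp.1.le hb (S.notflat hp) hR hL.lt hR.lt
      ha hp.2.le hp.1.le hb (Or.inr rfl) (Or.inl rfl) hβ hα
    have h3 : α = β := le_antisymm (not_lt.1 h2) (not_lt.1 h1)
    subst h3
    refine ⟨α, ?_⟩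
    filter_upwards [Ioo_mem_nhds hL.lt hR.lt] with z hz hfz
    rcases lt_trichotomy z p with h | h | h
    · exact hβ z ⟨hz.1, h⟩
    · exact absurd (by rw [h, hfp]) hfz
    · exact hα z ⟨h, hz.2⟩
  · obtain ⟨a, b, ha, hb, hxab, hcomp⟩ := S.hf.comp hfp
    obtain ⟨α, hα⟩ := hcomp.exists_rr S.hf S.hg S.hc ha hb
    refine ⟨α, ?_⟩
    filter_upwards [Ioo_mem_nhds hxab.1 hxab.2] with z hz _ using hα z hz

lemma local_unique (S : NT f g F Fi G Gi) {p α β : ℝ} (hp : p ∈ Ioo (0:ℝ) 1)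
    (h1 : ∀ᶠ z in 𝓝 p, f z ≠ z → RR f g α z) (h2 : ∀ᶠ z in 𝓝 p, f z ≠ z → RR f g β z) : α = β := by
  have h3 : ∃ᶠ z in 𝓝 p, f z ≠ z := by
    intro h
    refine S.notflat hp (S.toSetup.ev_flat hp ?_)
    filter_upwards [h] with z hz using not_not.1 hz
  obtain ⟨z, hz, hz1, hz2⟩ := (h3.and_eventually (h1.and h2)).exists
  exact RR.unique S.hf S.hg S.hc (hz1 hz) (hz2 hz)

lemma global_alpha (S : NT f g F Fi G Gi) : ∃ α, ∀ z, f z ≠ z → RR f g α z := by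
  have h2 : (1/2 : ℝ) ∈ Ioo (0:ℝ) 1 := by norm_num
  obtain ⟨α, hα⟩ := S.local_alpha h2
  refine ⟨α, fun z hz => ?_⟩
  let V : ℝ → Set ℝ := fun α => interior {z | f z ≠ z → RR f g α z}
  have hV : ∀ α p, p ∈ V α ↔ ∀ᶠ z in 𝓝 p, f z ≠ z → RR f g α z := fun α p => mem_interior_iff_mem_nhds
  have hsub : Ioo (0:ℝ) 1 ⊆ V α ∩ Ioo 0 1 := by
    refine isPreconnected_Ioo.subset_of_closure_inter_subset (isOpen_interior.inter isOpen_Ioo)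
      ⟨1/2, h2, (hV _ _).2 hα, h2⟩ ?_
    rintro w ⟨hw1, hw2⟩
    obtain ⟨β, hβ⟩ := S.local_alpha hw2
    obtain ⟨v, hv1, hv2, hv3⟩ := mem_closure_iff.1 hw1 (V β) isOpen_interior ((hV _ _).2 hβ)
    have := S.local_unique hv3 ((hV _ _).1 hv2) ((hV _ _).1 hv1)
    subst this
    exact ⟨(hV _ _).2 hβ, hw2⟩
  exact ((hV _ _).1 (hsub (S.hf.mem_of_ne hz)).1).self_of_nhds hz

lemma rational (S : NT f g F Fi G Gi) (q : ℚ) (hq : ∀ z, f z ≠ z → RR f g q z) :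
    ∃ h, IsD h ∧ ∃ n m : ℤ, f = h ^ n ∧ g = h ^ m := by
  have key : f ^ q.num = g ^ (q.den : ℤ) := by
    refine (S.hf.zpow _).ext (S.hg.zpow _) fun x hx => ?_
    by_cases hfx : f x = x
    · rw [Equiv.Perm.zpow_apply_eq_self_of_apply_eq_self hfx,
        Equiv.Perm.zpow_apply_eq_self_of_apply_eq_self (S.fix hfx)]
    · refine ((hq x hfx).2 _ _).2 ?_
      have : (q.den : ℚ) * q = q.num := Rat.den_mul_eq_num q
      exact_mod_cast congrArg (Rat.cast (K := ℝ)) this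
  obtain ⟨u, v, huv⟩ : IsCoprime q.num (q.den : ℤ) := by
    rw [Int.isCoprime_iff_gcd_eq_one, Int.gcd]
    simpa using q.reduced
  set n : ℤ := (q.den : ℤ)
  set m := q.num
  have hcc := S.hc.symm.zpow_zpow u v
  refine ⟨g ^ u * f ^ v, (S.hg.zpow u).mul (S.hf.zpow v), n, m, ?_, ?_⟩
  · rw [hcc.mul_zpow, ← zpow_mul, mul_comm u n, zpow_mul, ← key, ← zpow_mul, ← zpow_mul, ← zpow_add]
    rw [show m * u + v * n = 1 by linarith, zpow_one]
  · rw [hcc.mul_zpow, ← zpow_mul, ← zpow_mul, mul_comm v m, zpow_mul f, key, ← zpow_mul, ← zpow_add]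
    rw [show u * m + n * v = 1 by linarith, zpow_one]

end NT

/-- irrational situation -/
structure IRR (f g : Equiv.Perm ℝ) (F Fi G Gi : ℝ → ℝ) (α : ℝ) : Prop extends NT f g F Fi G Gi where
  irr : Irrational α
  rr : ∀ z, f z ≠ z → RR f g α z

namespace IRR
variable {f g : Equiv.Perm ℝ} {F Fi G Gi : ℝ → ℝ} {α : ℝ}

lemma tau_g (S : IRR f g F Fi G Gi α) {a b p T : ℝ} {ξ τ : ℝ → ℝ} (h : CD f F Fi a b p ξ τ T) :
    ∀ x ∈ Ioo a b, τ (g x) = τ x + α := by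
  obtain ⟨ga, gb⟩ := h.cp.fixed S.hf S.hg S.hc
  obtain ⟨β, hβ⟩ := h.trans S.hg S.hc ga gb
  intro x hx
  have h1 := h.rr S.hg ga gb hβ hx
  have h2 := S.rr x (h.cp.ne x hx)
  rw [hβ x hx, RR.unique S.hf S.hg S.hc h1 h2]

lemma delta_const (S : IRR f g F Fi G Gi α) {a b p p' T T' : ℝ} {ξ τ ξ' τ' : ℝ → ℝ}
    (h : CD f F Fi a b p ξ τ T) (h' : CD f F Fi a b p' ξ' τ' T') {x y : ℝ} (hx : x ∈ Ioo a b)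
    (hy : y ∈ Ioo a b) : τ' y - τ y = τ' x - τ x := by
  obtain ⟨ga, gb⟩ := h.cp.fixed S.hf S.hg S.hc
  by_contra hne
  have hcont : ContinuousAt (fun z => τ' z - τ z) y :=
    (h'.ed.tau y hy).continuousAt.sub (h.ed.tau y hy).continuousAt
  have hev : ∀ᶠ z in 𝓝 y, (τ' z - τ z ≠ τ' x - τ x) ∧ z ∈ Ioo a b :=
    (hcont.eventually_ne hne).and (isOpen_Ioo.mem_nhds hy)
  obtain ⟨l, u, hlu, hs⟩ := mem_nhds_iff_exists_Ioo_subset.1 hev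
  obtain ⟨y1, hy1, hy1'⟩ := exists_between hlu.1
  obtain ⟨y2, hy2, hy2'⟩ := exists_between hlu.2
  have m1 := (hs ⟨hy1, hy1'.trans hlu.2⟩).2
  have m2 := (hs ⟨hlu.1.trans hy2, hy2'⟩).2
  have hd : Dense (AddSubgroup.closure {α, 1} : Set ℝ) := by
    rw [dense_addSubgroupClosure_pair_iff, div_one]; exact S.irr
  have key : ∀ c ∈ (AddSubgroup.closure {α, 1} : Set ℝ), ∃ z ∈ Ioo a b, τ z = τ x + c ∧
      τ' z = τ' x + c := by
    intro c hc
    obtain ⟨m, n, rfl⟩ := AddSubgroup.mem_closure_pair.1 hc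
    have e1 := CD.zpow_mem S.hf h.cp.fa h.cp.fb n hx
    refine ⟨(g ^ m) ((f ^ n) x), CD.zpow_mem S.hg ga gb m e1, ?_, ?_⟩
    · rw [CD.zpow_tau S.hg ga gb (S.tau_g h) m e1,
        CD.zpow_tau S.hf h.cp.fa h.cp.fb (fun x hx => h.tf hx) n hx]
      simp; ring
    · rw [CD.zpow_tau S.hg ga gb (S.tau_g h') m e1,
        CD.zpow_tau S.hf h.cp.fa h.cp.fb (fun x hx => h'.tf hx) n hx]
      simp; ring
  have fin : ∃ z ∈ Ioo y1 y2, τ' z - τ z = τ' x - τ x := by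
    rcases h.ed.mono with ⟨hm, -⟩ | ⟨hm, -⟩
    · have hlt : τ y1 - τ x < τ y2 - τ x := sub_lt_sub_right (hm m1 m2 (hy1'.trans hy2)) _
      obtain ⟨c, hc, hc1, hc2⟩ := hd.exists_between hlt
      obtain ⟨z, hz, t1, t2⟩ := key c hc
      refine ⟨z, ⟨(hm.lt_iff_lt m1 hz).1 (by linarith), (hm.lt_iff_lt hz m2).1 (by linarith)⟩, by linarith⟩
    · have hlt : τ y2 - τ x < τ y1 - τ x := sub_lt_sub_right (hm m1 m2 (hy1'.trans hy2)) _
      obtain ⟨c, hc, hc1, hc2⟩ := hd.exists_between hlt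
      obtain ⟨z, hz, t1, t2⟩ := key c hc
      refine ⟨z, ⟨(hm.lt_iff_gt hz m1).1 (by linarith), (hm.lt_iff_gt m2 hz).1 (by linarith)⟩, by linarith⟩
  obtain ⟨z, hz, hz2⟩ := fin
  exact (hs ⟨hy1.trans hz.1, hz.2.trans hy2'⟩).1 hz2

lemma uniq (S : IRR f g F Fi G Gi α) {a b p p' T T' : ℝ} {ξ τ ξ' τ' : ℝ → ℝ}
    (h : CD f F Fi a b p ξ τ T) (h' : CD f F Fi a b p' ξ' τ' T') {x : ℝ} (hx : x ∈ Ioo a b) :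
    ξ x = ξ' x := by
  have h1 : τ' =ᶠ[𝓝 x] fun y => τ y + (τ' x - τ x) := by
    filter_upwards [isOpen_Ioo.mem_nhds hx] with y hy
    have := S.delta_const h h' hx hy
    linarith
  have h2 := ((h.ed.tau x hx).add_const (τ' x - τ x)).congr_of_eventuallyEq h1
  have := h2.unique (h'.ed.tau x hx)
  exact inv_injective this

lemma comp_unique {a b a' b' x : ℝ} (h : Comp f a b) (h' : Comp f a' b') (hx : x ∈ Ioo a b)
    (hx' : x ∈ Ioo a' b') : a = a' ∧ b = b' := by
  constructor
  · rcases lt_trichotomy a a' with h1 | h1 | h1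
    · exact absurd h'.fa (h.ne a' ⟨h1, hx'.1.trans hx.2⟩)
    · exact h1
    · exact absurd h.fa (h'.ne a ⟨h1, hx.1.trans hx'.2⟩)
  · rcases lt_trichotomy b b' with h1 | h1 | h1
    · exact absurd h.fb (h'.ne b ⟨hx'.1.trans hx.2, h1⟩)
    · exact h1
    · exact absurd h'.fb (h.ne b' ⟨hx.1.trans hx'.2, h1⟩)

lemma exists_Xi (S : IRR f g F Fi G Gi α) : ∃ Ξ : ℝ → ℝ, (∀ x, f x = x → Ξ x = 0) ∧
    ∀ (a b p : ℝ) (ξ τ : ℝ → ℝ) (T : ℝ), CD f F Fi a b p ξ τ T → ∀ x ∈ Ioo a b, Ξ x = ξ x := by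
  have : ∀ x, ∃ v : ℝ, (f x = x → v = 0) ∧
      ∀ (a b p : ℝ) (ξ τ : ℝ → ℝ) (T : ℝ), CD f F Fi a b p ξ τ T → x ∈ Ioo a b → v = ξ x := by
    intro x
    by_cases hx : f x = x
    · exact ⟨0, fun _ => rfl, fun a b p ξ τ T h hxx => absurd hx (h.cp.ne x hxx)⟩
    · obtain ⟨a, b, ha, hb, hxab, hcomp⟩ := S.hf.comp hx
      obtain ⟨ξ, τ, T, hcd⟩ := S.hf.cd S.gf S.eF S.eFi hcomp ha hb (Or.inl rfl)
      refine ⟨ξ x, fun h => absurd h hx, fun a' b' p' ξ' τ' T' h' hx' => ?_⟩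
      obtain ⟨rfl, rfl⟩ := comp_unique hcomp h'.cp hxab hx'
      exact S.uniq hcd h' hxab
  choose Ξ h1 h2 using this
  exact ⟨Ξ, h1, fun a b p ξ τ T h x hx => h2 x a b p ξ τ T h hx⟩

end IRR

/-- the vector field in the irrational situation -/
structure VF (f g : Equiv.Perm ℝ) (F Fi G Gi : ℝ → ℝ) (α : ℝ) (Ξ : ℝ → ℝ) : Prop
    extends IRR f g F Fi G Gi α where
  fx : ∀ x, f x = x → Ξ x = 0
  eq : ∀ (a b p : ℝ) (ξ τ : ℝ → ℝ) (T : ℝ), CD f F Fi a b p ξ τ T → ∀ x ∈ Ioo a b, Ξ x = ξ x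

lemma glue (a b p : ℝ) (hp : p ∈ Ioo a b) (r : ℕ) : ∀ η : ℝ → ℝ, η p = 0 →
    ContDiffOn ℝ ∞ η (Ioo a b \ {p}) → (∀ j ≤ r, Tendsto (iteratedDeriv j η) (𝓝[≠] p) (𝓝 0)) →
    ContDiffOn ℝ r η (Ioo a b) := by
  have hop : IsOpen (Ioo a b \ {p}) := isOpen_Ioo.sdiff isClosed_singleton
  have hcp : ∀ η : ℝ → ℝ, η p = 0 → Tendsto (iteratedDeriv 0 η) (𝓝[≠] p) (𝓝 0) → ContinuousAt η p := by
    intro η h0 h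
    rw [iteratedDeriv_zero] at h
    rw [continuousAt_iff_punctured_nhds, h0]
    exact h
  induction r with
  | zero =>
    intro η h0 hs ht
    rw [Nat.cast_zero, contDiffOn_zero]
    intro x hx
    by_cases hxp : x = p
    · subst hxp; exact (hcp η h0 (ht 0 le_rfl)).continuousWithinAt
    · exact (hs.continuousOn.continuousAt (hop.mem_nhds ⟨hx, hxp⟩)).continuousWithinAt
  | succ r ih =>
    intro η h0 hs ht
    have hd : DifferentiableOn ℝ η (Ioo a b \ {p}) := hs.differentiableOn (by simp)
    have hc := hcp η h0 (ht 0 (Nat.zero_le _))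
    have h1 : Tendsto (deriv η) (𝓝[≠] p) (𝓝 0) := by
      have := ht 1 (by omega)
      rwa [iteratedDeriv_one] at this
    have hR : HasDerivWithinAt η 0 (Ici p) p := by
      refine hasDerivWithinAt_Ici_of_tendsto_deriv (s := Ioo p b) (hd.mono fun x hx => ?_)
        hc.continuousWithinAt (Ioo_mem_nhdsGT hp.2) (h1.mono_left (nhdsWithin_mono _ fun x hx => ?_))
      · exact ⟨⟨hp.1.trans hx.1, hx.2⟩, hx.1.ne'⟩
      · exact (ne_of_gt hx : x ≠ p)
    have hL : HasDerivWithinAt η 0 (Iic p) p := by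
      refine hasDerivWithinAt_Iic_of_tendsto_deriv (s := Ioo a p) (hd.mono fun x hx => ?_)
        hc.continuousWithinAt (Ioo_mem_nhdsLT hp.1) (h1.mono_left (nhdsWithin_mono _ fun x hx => ?_))
      · exact ⟨⟨hx.1, hx.2.trans hp.2⟩, hx.2.ne⟩
      · exact (ne_of_lt hx : x ≠ p)
    have hD : HasDerivAt η 0 p := by
      have := hL.union hR
      rw [Iic_union_Ici] at this
      exact hasDerivWithinAt_univ.1 this
    rw [Nat.cast_succ, contDiffOn_succ_iff_deriv_of_isOpen isOpen_Ioo]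
    refine ⟨fun x hx => ?_, by simp, ih (deriv η) hD.deriv ?_ fun j hj => ?_⟩
    · by_cases hxp : x = p
      · subst hxp; exact hD.differentiableAt.differentiableWithinAt
      · exact (hd.differentiableAt (hop.mem_nhds ⟨hx, hxp⟩)).differentiableWithinAt
    · exact ((contDiffOn_infty_iff_deriv_of_isOpen hop).1 hs).2
    · rw [← iteratedDeriv_succ']
      exact ht (j+1) (by omega)

/-- the formal vector field at a general point -/
lemma formal_vf_at {F Fi : ℝ → ℝ} (gf : GD F Fi) (p : ℝ) (A : ℝ → ℝ) (k n : ℕ) (hA : ContDiff ℝ ∞ A)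
    (hF : ∀ x, F x = x + (x - p) ^ (k+1) * A x) (hA0 : A p ≠ 0) :
    ∃ X1 E : ℝ → ℝ, ContDiff ℝ ∞ X1 ∧ X1 p ≠ 0 ∧ ContDiff ℝ ∞ E ∧
      ∀ x, (F x - p) ^ (k+1) * X1 (F x) - deriv F x * ((x - p) ^ (k+1) * X1 x) =
        (x - p) ^ (2*k+2+n) * E x := by
  obtain ⟨X, E, hX, hX0, hE, h⟩ := formal_vf (fun x => F (x + p) - p) (fun x => A (x + p)) k
    (hA.comp (contDiff_id.add contDiff_const)) (fun x => by rw [hF]; ring)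
    (by simpa using hA0) (by
      rintro rfl
      have h1 : HasDerivAt (fun x => x + (x - p) ^ (0+1) * A x) (1 + A p) p := by
        have h2 := (contDiff_infty_iff_deriv.1 hA).1.differentiableAt (x := p) |>.hasDerivAt
        have := (hasDerivAt_id p).add (((hasDerivAt_id p).sub_const p).mul h2)
        refine (this.congr_deriv (by simp)).congr_of_eventuallyEq (Eventually.of_forall fun x => ?_)
        simp
      have h3 : F = fun x => x + (x - p) ^ (0+1) * A x := funext hF
      have := gf.dpos p
      rw [h3, h1.deriv] at this
      simpa using this) n
  refine ⟨fun x => X (x - p), fun x => E (x - p), hX.comp (contDiff_id.sub contDiff_const),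
    by simp [hX0], hE.comp (contDiff_id.sub contDiff_const), fun x => ?_⟩
  have h1 := h (x - p)
  have h2 : deriv (fun x => F (x + p) - p) (x - p) = deriv F x := by
    have := (gf.hasD (x - p + p)).comp_add_const (x - p) p
    have := (this.sub_const p).deriv
    simpa using this
  rw [h2] at h1
  simpa using h1

lemma notflat_order {F : ℝ → ℝ} (hF : ContDiff ℝ ∞ F) {p : ℝ} (hp : F p = p) (h : ¬ Flat F p) :
    ∃ (k : ℕ) (A : ℝ → ℝ), ContDiff ℝ ∞ A ∧ A p ≠ 0 ∧ ∀ x, F x = x + (x - p) ^ (k+1) * A x := by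
  unfold Flat at h
  push Not at h
  obtain ⟨n, hn⟩ := h
  obtain ⟨k, B, hB, h1, h2⟩ := finite_order p n (fun x => F x - x) (hF.sub contDiff_id) hn
  rcases k with _ | k
  · have := h1 p
    simp [hp] at this
    exact absurd this.symm h2
  · exact ⟨k, B, hB, h2, fun x => by have := h1 x; linarith⟩

namespace VF
variable {f g : Equiv.Perm ℝ} {F Fi G Gi : ℝ → ℝ} {α : ℝ} {Ξ : ℝ → ℝ}

lemma smooth_off (V : VF f g F Fi G Gi α Ξ) {a b p T : ℝ} {ξ τ : ℝ → ℝ} (h : CD f F Fi a b p ξ τ T) :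
    ContDiffOn ℝ ∞ Ξ (Ioo a b) := h.ed.sm.congr fun x hx => V.eq a b p ξ τ T h x hx

lemma smooth_fix (V : VF f g F Fi G Gi α Ξ) {a b p : ℝ} (hp : p ∈ Ioo (0:ℝ) 1) (ha : 0 ≤ a) (hb : b ≤ 1)
    (h1 : Comp f a p) (h2 : Comp f p b) (r : ℕ) : ContDiffOn ℝ r Ξ (Ioo a b) := by
  obtain ⟨ξ, τ, T, c1⟩ := V.hf.cd V.gf V.eF V.eFi h1 ha hp.2.le (Or.inr rfl)
  obtain ⟨ξ', τ', T', c2⟩ := V.hf.cd V.gf V.eF V.eFi h2 hp.1.le hb (Or.inl rfl)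
  have hT : T = T' := Tspec_unique c1.ed.Tlog c1.ed.T1 c2.ed.Tlog c2.ed.T1
  subst hT
  obtain ⟨k, A, hA, hA0, hF⟩ := notflat_order V.gf.smooth c1.ed.fp (V.notflat hp)
  obtain ⟨X1, E, hX, hX0, hE, hXE⟩ := formal_vf_at V.gf p A k ((r+1)*(k+1)) hA hF hA0
  have hXE' : ∀ x, (F x - p) ^ (k+1) * X1 (F x) - deriv F x * ((x - p) ^ (k+1) * X1 x) =
      (x - p) ^ ((r+1) * (k+1) + 2 * (k+1)) * E x := fun x => by
    rw [hXE x]; congr 2; ring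
  have t1 := c1.ed.tak k r A X1 E hA hA0 hF hX hX0 hE hXE'
  have t2 := c2.ed.tak k r A X1 E hA hA0 hF hX hX0 hE hXE'
  set W : ℝ → ℝ := fun x => T * A p / X1 p * ((x - p) ^ (k+1) * X1 x) with hW
  have hWs : ContDiff ℝ ∞ W :=
    contDiff_const.mul (((contDiff_id.sub contDiff_const).pow _).mul hX)
  have hpab : p ∈ Ioo a b := ⟨h1.lt, h2.lt⟩
  have hs1 := V.smooth_off c1
  have hs2 := V.smooth_off c2
  have key : ContDiffOn ℝ r (fun x => Ξ x - W x) (Ioo a b) := by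
    refine glue a b p hpab r _ ?_ ?_ ?_
    · simp [hW, V.fx p h2.fa]
    · refine ContDiffOn.sub ?_ hWs.contDiffOn
      rintro x ⟨hx, hxp⟩
      rcases lt_or_gt_of_ne (hxp : x ≠ p) with h | h
      · exact (hs1.contDiffAt (isOpen_Ioo.mem_nhds ⟨hx.1, h⟩)).contDiffWithinAt
      · exact (hs2.contDiffAt (isOpen_Ioo.mem_nhds ⟨h, hx.2⟩)).contDiffWithinAt
    · intro j hj
      rw [← nhdsLT_sup_nhdsGT, ← nhdsWithin_Ioo_eq_nhdsLT h1.lt, ← nhdsWithin_Ioo_eq_nhdsGT h2.lt]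
      refine Tendsto.sup ((t1 j hj).congr' ?_) ((t2 j hj).congr' ?_)
      · filter_upwards [self_mem_nhdsWithin] with x hx
        refine Filter.EventuallyEq.iteratedDeriv_eq j ?_
        filter_upwards [isOpen_Ioo.mem_nhds hx] with y hy
        rw [V.eq _ _ _ _ _ _ c1 y hy]
      · filter_upwards [self_mem_nhdsWithin] with x hx
        refine Filter.EventuallyEq.iteratedDeriv_eq j ?_
        filter_upwards [isOpen_Ioo.mem_nhds hx] with y hy
        rw [V.eq _ _ _ _ _ _ c2 y hy]
  have := key.add ((hWs.of_le (m := r) (by exact_mod_cast le_top)).contDiffOn (s := Ioo a b))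
  exact this.congr fun x hx => by simp

lemma smooth (V : VF f g F Fi G Gi α Ξ) : ContDiffOn ℝ ∞ Ξ (Ioo 0 1) := by
  rw [contDiffOn_infty]
  intro r x hx
  by_cases hfx : f x = x
  · obtain ⟨b, hb, h2⟩ := V.right hx hfx
    obtain ⟨a, ha, h1⟩ := V.left hx hfx
    exact ((V.smooth_fix hx ha hb h1 h2 r).contDiffAt
      (isOpen_Ioo.mem_nhds ⟨h1.lt, h2.lt⟩)).contDiffWithinAt
  · obtain ⟨a, b, ha, hb, hxab, hcomp⟩ := V.hf.comp hfx
    obtain ⟨ξ, τ, T, hcd⟩ := V.hf.cd V.gf V.eF V.eFi hcomp ha hb (Or.inl rfl)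
    exact (((V.smooth_off hcd).contDiffAt (isOpen_Ioo.mem_nhds hxab)).of_le
      (by exact_mod_cast le_top)).contDiffWithinAt

end VF

lemma T_bound {T l m M : ℝ} (hm : 0 < m) (hl : m ≤ l) (hM : l ≤ M) (h1 : T * (l - 1) = Real.log l)
    (h2 : l = 1 → T = 1) : max T (T * l) ≤ 1 + 1 / m + M := by
  have hl0 : 0 < l := hm.trans_le hl
  have hm' : 0 < 1 / m := by positivity
  have key : T ≤ max 1 (1 / l) := by
    rcases lt_trichotomy l 1 with h | h | h
    · refine le_max_of_le_right ?_
      have h3 := Real.log_le_sub_one_of_pos (inv_pos.2 hl0)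
      rw [Real.log_inv, ← h1] at h3
      rw [le_div_iff₀ hl0]
      have h4 : T * (1 - l) ≤ l⁻¹ - 1 := by linarith
      have h5 : l⁻¹ - 1 = (1 - l) / l := by field_simp
      rw [h5, le_div_iff₀ hl0] at h4
      nlinarith
    · exact le_max_of_le_left (h2 h).le
    · refine le_max_of_le_left ?_
      have h3 := Real.log_le_sub_one_of_pos hl0
      rw [← h1] at h3
      nlinarith
  have e1 : 1 / l ≤ 1 / m := one_div_le_one_div_of_le hm hl
  have e2 : T * l ≤ max l 1 := by
    have := mul_le_mul_of_nonneg_right key hl0.le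
    rw [max_mul_of_nonneg _ _ hl0.le, one_mul, one_div, inv_mul_cancel₀ hl0.ne'] at this
    exact this
  refine max_le (key.trans (max_le (by linarith) (by linarith))) (e2.trans (max_le ?_ ?_)) <;> linarith

lemma GD.ctrF_bound {F Fi : ℝ → ℝ} (h : GD F Fi) : ∃ K, 0 ≤ K ∧ ∀ x ∈ Icc (0:ℝ) 1, |Ctr.F F x| ≤ K := by
  have h1 := (contDiff_infty_iff_deriv.1 h.smooth).2
  have h2 := (contDiff_infty_iff_deriv.1 h1).2
  have hc : Continuous (Ctr.F F) := by
    unfold Ctr.F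
    exact h2.continuous.div h1.continuous fun x => (h.dpos x).ne'
  obtain ⟨K, hK⟩ := isCompact_Icc.exists_bound_of_continuousOn (s := Icc (0:ℝ) 1) hc.continuousOn
  refine ⟨K, ?_, fun x hx => hK x hx⟩
  exact (norm_nonneg _).trans (hK 0 (by simp))

namespace VF
variable {f g : Equiv.Perm ℝ} {F Fi G Gi : ℝ → ℝ} {α : ℝ} {Ξ : ℝ → ℝ}

lemma deriv_eq (V : VF f g F Fi G Gi α Ξ) {a b p T : ℝ} {ξ τ : ℝ → ℝ} (h : CD f F Fi a b p ξ τ T) {x : ℝ}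
    (hx : x ∈ Ioo a b) : deriv Ξ x = deriv ξ x := by
  refine Filter.EventuallyEq.deriv_eq ?_
  filter_upwards [isOpen_Ioo.mem_nhds hx] with y hy using V.eq _ _ _ _ _ _ h y hy

lemma der (V : VF f g F Fi G Gi α Ξ) {a b p T : ℝ} {ξ τ : ℝ → ℝ} (h : CD f F Fi a b p ξ τ T) :
    Tendsto (deriv Ξ) (𝓝[Ioo a b] p) (𝓝 (Real.log (deriv F p))) := by
  refine h.ed.der.congr' ?_
  filter_upwards [self_mem_nhdsWithin] with x hx using (V.deriv_eq h hx).symm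

lemma deriv_cont (V : VF f g F Fi G Gi α Ξ) : ContinuousOn (deriv Ξ) (Ioo 0 1) :=
  ((contDiffOn_infty_iff_deriv_of_isOpen isOpen_Ioo).1 V.smooth).2.continuousOn

lemma diffAt (V : VF f g F Fi G Gi α Ξ) {x : ℝ} (hx : x ∈ Ioo (0:ℝ) 1) : DifferentiableAt ℝ Ξ x :=
  ((contDiffOn_infty_iff_deriv_of_isOpen isOpen_Ioo).1 V.smooth).1.differentiableAt
    (isOpen_Ioo.mem_nhds hx)

lemma deriv_fix (V : VF f g F Fi G Gi α Ξ) {x : ℝ} (hx : x ∈ Ioo (0:ℝ) 1) (hfx : f x = x) :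
    deriv Ξ x = Real.log (deriv F x) := by
  obtain ⟨b, hb, h2⟩ := V.right hx hfx
  obtain ⟨ξ, τ, T, c⟩ := V.hf.cd V.gf V.eF V.eFi h2 hx.1.le hb (Or.inl rfl)
  have := nebot_end h2.lt (Or.inl rfl : x = x ∨ x = b)
  exact tendsto_nhds_unique ((V.deriv_cont.continuousAt (isOpen_Ioo.mem_nhds hx)).tendsto.mono_left
    nhdsWithin_le_nhds) (V.der c)

lemma bound (V : VF f g F Fi G Gi α Ξ) : ∃ C, 0 ≤ C ∧ ∀ a b x, 0 ≤ a → b ≤ 1 → Comp f a b → x ∈ Ioo a b →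
    |deriv Ξ x - Real.log (deriv F a)| ≤ C * (b - a) := by
  obtain ⟨K1, hK1, h1⟩ := V.gf.ctrF_bound
  obtain ⟨K2, hK2, h2⟩ := V.gf.symm.ctrF_bound
  have hcF : Continuous (deriv F) := (contDiff_infty_iff_deriv.1 V.gf.smooth).2.continuous
  obtain ⟨y1, hy1, hm⟩ := isCompact_Icc.exists_isMinOn (s := Icc (0:ℝ) 1) ⟨0, by simp⟩ hcF.continuousOn
  obtain ⟨y2, hy2, hM⟩ := isCompact_Icc.exists_isMaxOn (s := Icc (0:ℝ) 1) ⟨0, by simp⟩ hcF.continuousOn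
  have hmp := V.gf.dpos y1
  have hMp := V.gf.dpos y2
  set K := max K1 K2
  set B := 1 + 1 / deriv F y1 + deriv F y2 with hB
  have hK0 : 0 ≤ K := le_max_of_le_left hK1
  have hB0 : 0 ≤ B := by positivity
  refine ⟨B * (K * Real.exp K), by positivity, fun a b x ha hb hc hx => ?_⟩
  obtain ⟨ξ, τ, T, c⟩ := V.hf.cd V.gf V.eF V.eFi hc ha hb (Or.inl rfl)
  have hsub : closure (Ioo a b) ⊆ Icc 0 1 := by
    rw [closure_Ioo hc.lt.ne]; exact Icc_subset_Icc ha hb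
  have hbd := c.ed.bd K hK0 (fun x hx => (h1 x (hsub hx)).trans (le_max_left _ _))
    (fun x hx => (h2 x (hsub hx)).trans (le_max_right _ _)) x hx
  rw [V.deriv_eq c hx]
  refine hbd.trans ?_
  have haI : a ∈ Icc (0:ℝ) 1 := ⟨ha, hc.lt.le.trans hb⟩
  have e1 := T_bound hmp (hm haI) (hM haI) c.ed.Tlog c.ed.T1
  have hL0 : 0 ≤ b - a := sub_nonneg.2 hc.lt.le
  have e2 : K * Real.exp (K * (b - a)) * (b - a) ≤ K * Real.exp K * (b - a) := by
    have : K * (b - a) ≤ K := by nlinarith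
    gcongr
  calc _ ≤ B * (K * Real.exp K * (b - a)) := by
        apply mul_le_mul e1 e2 (by positivity) hB0
    _ = _ := by ring

/-- alternative at an endpoint of the unit interval -/
lemma end_cases (V : VF f g F Fi G Gi α Ξ) {e : ℝ} (he : e = 0 ∨ e = 1) :
    (∃ a b, 0 ≤ a ∧ b ≤ 1 ∧ Comp f a b ∧ (e = a ∨ e = b) ∧ 𝓝[Ioo a b] e = 𝓝[Ioo 0 1] e) ∨
    ∀ δ > 0, ∃ q ∈ Ioo (0:ℝ) 1, |q - e| < δ ∧ f q = q := by
  by_contra! hcon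
  obtain ⟨hcon, δ, hδ, hq⟩ := hcon
  rcases he with rfl | rfl
  · have hx : min (δ/2) (1/2) ∈ Ioo (0:ℝ) 1 := ⟨by positivity, by
      have := min_le_right (δ/2) (1/2); linarith⟩
    have hxδ : min (δ/2) (1/2) < δ := by have := min_le_left (δ/2) (1/2); linarith
    obtain ⟨a, b, ha, hb, hxab, hcomp⟩ := V.hf.comp (hq _ hx (by
      rw [sub_zero, abs_of_pos hx.1]; exact hxδ))
    have ha0 : a = 0 := by
      by_contra hne
      have hapos : 0 < a := lt_of_le_of_ne ha (Ne.symm hne)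
      exact hq a ⟨hapos, hxab.1.trans hx.2⟩ (by
        rw [sub_zero, abs_of_pos hapos]; exact hxab.1.trans hxδ) hcomp.fa
    subst ha0
    refine hcon 0 b le_rfl hb hcomp (Or.inl rfl) ?_
    rw [nhdsWithin_Ioo_eq_nhdsGT hcomp.lt, nhdsWithin_Ioo_eq_nhdsGT one_pos]
  · have hx : 1 - min (δ/2) (1/2) ∈ Ioo (0:ℝ) 1 := ⟨by
      have := min_le_right (δ/2) (1/2); linarith, by
      have : 0 < min (δ/2) (1/2) := by positivity
      linarith⟩
    have hxδ : min (δ/2) (1/2) < δ := by have := min_le_left (δ/2) (1/2); linarith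
    obtain ⟨a, b, ha, hb, hxab, hcomp⟩ := V.hf.comp (hq _ hx (by
      rw [abs_sub_comm, abs_of_pos (by linarith [hx.2])]; linarith))
    have hb0 : b = 1 := by
      by_contra hne
      have hbpos : b < 1 := lt_of_le_of_ne hb hne
      exact hq b ⟨hx.1.trans hxab.2, hbpos⟩ (by
        rw [abs_sub_comm, abs_of_pos (by linarith)]; linarith [hxab.2]) hcomp.fb
    subst hb0
    refine hcon a 1 ha le_rfl hcomp (Or.inr rfl) ?_
    rw [nhdsWithin_Ioo_eq_nhdsLT hcomp.lt, nhdsWithin_Ioo_eq_nhdsLT one_pos]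

lemma deriv_end (V : VF f g F Fi G Gi α Ξ) {e : ℝ} (he : e = 0 ∨ e = 1) :
    Tendsto (deriv Ξ) (𝓝[Ioo 0 1] e) (𝓝 (Real.log (deriv F e))) := by
  rcases V.end_cases he with ⟨a, b, ha, hb, hc, hp, hn⟩ | hq
  · obtain ⟨ξ, τ, T, c⟩ := V.hf.cd V.gf V.eF V.eFi hc ha hb hp
    rw [← hn]; exact V.der c
  · obtain ⟨C, hC, hbd⟩ := V.bound
    have hcF : Continuous fun x => Real.log (deriv F x) :=
      (contDiff_infty_iff_deriv.1 V.gf.smooth).2.continuous.log fun x => (V.gf.dpos x).ne'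
    rw [Metric.tendsto_nhdsWithin_nhds]
    intro ε hε
    obtain ⟨δ, hδ, hlog⟩ := Metric.continuousAt_iff.1 (hcF.continuousAt (x := e)) (ε/2) (by positivity)
    have hC1 : 0 < ε / (2 * (C + 1)) := by positivity
    obtain ⟨q, hq01, hqe, hfq⟩ := hq (min δ (ε / (2 * (C + 1)))) (lt_min hδ hC1)
    have hqd := hqe.trans_le (min_le_left _ _)
    have hqC := hqe.trans_le (min_le_right _ _)
    have hqC' : C * |q - e| < ε / 2 := by
      rw [lt_div_iff₀ (by positivity)] at hqC
      nlinarith [abs_nonneg (q - e)]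
    have hqpos : 0 < |q - e| := by
      rcases he with rfl | rfl
      · exact abs_pos.2 (sub_ne_zero.2 hq01.1.ne')
      · exact abs_pos.2 (sub_ne_zero.2 hq01.2.ne)
    refine ⟨|q - e|, hqpos, fun x hx hxe => ?_⟩
    rw [Real.dist_eq] at hxe ⊢
    by_cases hfx : f x = x
    · rw [V.deriv_fix hx hfx]
      have := hlog (x := x) (by rw [Real.dist_eq]; linarith)
      rw [Real.dist_eq] at this
      linarith
    · obtain ⟨a, b, ha, hb, hxab, hc⟩ := V.hf.comp hfx
      have h1 := hbd a b x ha hb hc hxab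
      have h2 : |a - e| ≤ |q - e| ∧ b - a ≤ |q - e| := by
        rcases he with rfl | rfl
        · rw [sub_zero, sub_zero, abs_of_pos hq01.1, abs_of_nonneg (by linarith)]
          rw [sub_zero, sub_zero, abs_of_pos hq01.1, abs_of_pos hx.1] at hxe
          have : b ≤ q := by
            by_contra! hlt
            exact hc.ne q ⟨hxab.1.trans hxe, hlt⟩ hfq
          constructor <;> linarith [hc.lt]
        · have ha1 : a < 1 := hxab.1.trans hx.2
          rw [abs_sub_comm, abs_sub_comm q, abs_of_pos (sub_pos.2 hq01.2), abs_of_pos (sub_pos.2 ha1)]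
          rw [abs_sub_comm, abs_sub_comm q, abs_of_pos (sub_pos.2 hq01.2), abs_of_pos (sub_pos.2 hx.2)] at hxe
          have : q ≤ a := by
            by_contra! hlt
            exact hc.ne q ⟨hlt, by linarith [hxab.2]⟩ hfq
          constructor <;> linarith
      have h3 := hlog (x := a) (by rw [Real.dist_eq]; linarith [h2.1])
      rw [Real.dist_eq] at h3
      have h4 : C * (b - a) ≤ C * |q - e| := mul_le_mul_of_nonneg_left h2.2 hC
      have h5 := abs_sub_le (deriv Ξ x) (Real.log (deriv F a)) (Real.log (deriv F e))
      linarith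

lemma f_end (V : VF f g F Fi G Gi α Ξ) {e : ℝ} (he : e = 0 ∨ e = 1) : f e = e := by
  by_contra h
  have := V.hf.mem_of_ne h
  rcases he with rfl | rfl
  · exact lt_irrefl _ this.1
  · exact lt_irrefl _ this.2

lemma cont_end (V : VF f g F Fi G Gi α Ξ) {e : ℝ} (he : e = 0 ∨ e = 1) :
    Tendsto Ξ (𝓝[Ioo 0 1] e) (𝓝 0) := by
  have heI : e ∈ Icc (0:ℝ) 1 := by rcases he with rfl | rfl <;> simp
  rcases V.end_cases he with ⟨a, b, ha, hb, hc, hp, hn⟩ | hq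
  · obtain ⟨ξ, τ, T, c⟩ := V.hf.cd V.gf V.eF V.eFi hc ha hb hp
    rw [← hn]
    have h1 : Tendsto (fun x => F x - x) (𝓝[Ioo a b] e) (𝓝 0) := by
      have : Tendsto (fun x => F x - x) (𝓝 e) (𝓝 (F e - e)) :=
        (V.gf.cont.sub continuous_id).tendsto e
      rw [c.ed.fp, sub_self] at this
      exact this.mono_left nhdsWithin_le_nhds
    have h2 := c.ed.ratio.mul h1
    rw [mul_zero] at h2
    refine h2.congr' ?_
    filter_upwards [self_mem_nhdsWithin] with x hx
    rw [V.eq _ _ _ _ _ _ c x hx, div_mul_cancel₀ _ (sub_ne_zero.2 (c.ed.nofix x hx))]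
  · set l := Real.log (deriv F e)
    have hev := Metric.tendsto_nhdsWithin_nhds.1 (V.deriv_end he) 1 one_pos
    obtain ⟨δ, hδ, hb⟩ := hev
    rw [Metric.tendsto_nhdsWithin_nhds]
    intro ε hε
    set M := |l| + 1 with hM
    have hM0 : 0 < M := by positivity
    have hD : ∀ x ∈ Ioo (0:ℝ) 1 ∩ Metric.ball e δ, ‖deriv Ξ x‖ ≤ M := by
      rintro x ⟨hx, hxe⟩
      have := hb hx hxe
      rw [Real.dist_eq] at this
      rw [Real.norm_eq_abs]
      have := abs_sub_abs_le_abs_sub (deriv Ξ x) l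
      linarith
    obtain ⟨q, hq01, hqe, hfq⟩ := hq (min δ (ε / (2 * M))) (lt_min hδ (by positivity))
    have hqd := hqe.trans_le (min_le_left _ _)
    have hqM := hqe.trans_le (min_le_right _ _)
    refine ⟨min δ (ε / (2 * M)), lt_min hδ (by positivity), fun x hx hxe => ?_⟩
    have hxd := hxe.trans_le (min_le_left _ _)
    have hxM := hxe.trans_le (min_le_right _ _)
    have key := Convex.norm_image_sub_le_of_norm_deriv_le (f := Ξ) (fun x hx => V.diffAt hx.1) hD
      ((convex_Ioo (0:ℝ) 1).inter (convex_ball e δ)) (x := q) (y := x)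
      ⟨hq01, by rw [Metric.mem_ball, Real.dist_eq]; exact hqd⟩ ⟨hx, hxd⟩
    rw [V.fx q hfq, sub_zero, Real.norm_eq_abs, Real.norm_eq_abs] at key
    rw [Real.dist_eq, sub_zero]
    rw [Real.dist_eq] at hxM
    have h1 := abs_sub_le x e q
    rw [abs_sub_comm e q] at h1
    have h2 : |x - q| < ε / (2 * M) + ε / (2 * M) := by linarith
    have h3 : M * |x - q| < M * (ε / (2 * M) + ε / (2 * M)) := mul_lt_mul_of_pos_left h2 hM0
    have h4 : M * (ε / (2 * M) + ε / (2 * M)) = ε := by field_simp; ring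
    linarith

lemma c1 (V : VF f g F Fi G Gi α Ξ) : ContDiffOn ℝ 1 Ξ (Icc 0 1) := by
  have d0 := V.deriv_end (Or.inl rfl : (0:ℝ) = 0 ∨ (0:ℝ) = 1)
  have d1 := V.deriv_end (Or.inr rfl : (1:ℝ) = 0 ∨ (1:ℝ) = 1)
  have c0 := V.cont_end (Or.inl rfl : (0:ℝ) = 0 ∨ (0:ℝ) = 1)
  have c1 := V.cont_end (Or.inr rfl : (1:ℝ) = 0 ∨ (1:ℝ) = 1)
  have x0 := V.fx 0 (V.f_end (Or.inl rfl))
  have x1 := V.fx 1 (V.f_end (Or.inr rfl))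
  have hdiff : DifferentiableOn ℝ Ξ (Ioo 0 1) := fun x hx => (V.diffAt hx).differentiableWithinAt
  have k0 : HasDerivWithinAt Ξ (Real.log (deriv F 0)) (Icc 0 1) 0 := by
    refine (hasDerivWithinAt_Ici_of_tendsto_deriv hdiff ?_ (Ioo_mem_nhdsGT one_pos) ?_).mono Icc_subset_Ici_self
    · rw [ContinuousWithinAt, x0]; exact c0
    · rw [← nhdsWithin_Ioo_eq_nhdsGT (one_pos : (0:ℝ) < 1)]; exact d0
  have k1 : HasDerivWithinAt Ξ (Real.log (deriv F 1)) (Icc 0 1) 1 := by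
    refine (hasDerivWithinAt_Iic_of_tendsto_deriv hdiff ?_ (Ioo_mem_nhdsLT one_pos) ?_).mono Icc_subset_Iic_self
    · rw [ContinuousWithinAt, x1]; exact c1
    · rw [← nhdsWithin_Ioo_eq_nhdsLT (one_pos : (0:ℝ) < 1)]; exact d1
  set D := extendFrom (Ioo (0:ℝ) 1) (deriv Ξ) with hD
  have hDc : ContinuousOn D (Icc 0 1) := by
    refine continuousOn_Icc_extendFrom_Ioo V.deriv_cont (la := Real.log (deriv F 0))
      (lb := Real.log (deriv F 1)) ?_ ?_
    · rw [← nhdsWithin_Ioo_eq_nhdsGT (one_pos : (0:ℝ) < 1)]; exact d0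
    · rw [← nhdsWithin_Ioo_eq_nhdsLT (one_pos : (0:ℝ) < 1)]; exact d1
  have hall : ∀ x ∈ Icc (0:ℝ) 1, HasDerivWithinAt Ξ (D x) (Icc 0 1) x := by
    intro x hx
    have hcl : closure (Ioo (0:ℝ) 1) = Icc 0 1 := closure_Ioo one_pos.ne
    rcases eq_endpoints_or_mem_Ioo_of_mem_Icc hx with rfl | rfl | hx'
    · rw [hD, extendFrom_eq (by rw [hcl]; exact hx) d0]; exact k0
    · rw [hD, extendFrom_eq (by rw [hcl]; exact hx) d1]; exact k1
    · rw [hD, extendFrom_extends V.deriv_cont x hx']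
      exact (V.diffAt hx').hasDerivAt.hasDerivWithinAt
  have hu : UniqueDiffOn ℝ (Icc (0:ℝ) 1) := uniqueDiffOn_Icc one_pos
  rw [contDiffOn_one_iff_derivWithin hu]
  refine ⟨fun x hx => (hall x hx).differentiableWithinAt, hDc.congr fun x hx => ?_⟩
  exact (hall x hx).derivWithin (hu x hx)

end VF

lemma inv_cont_mono {a b : ℝ} {τ σ : ℝ → ℝ} (hm : StrictMonoOn τ (Ioo a b)) (hσ : ∀ v, σ v ∈ Ioo a b)
    (hτ : ∀ v, τ (σ v) = v) (v : ℝ) : ContinuousAt σ v := by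
  refine tendsto_order.2 ⟨fun l hl => ?_, fun u hu => ?_⟩
  · obtain ⟨y, hy1, hy2⟩ := exists_between (max_lt hl (hσ v).1)
    have hyI : y ∈ Ioo a b := ⟨(le_max_right _ _).trans_lt hy1, hy2.trans (hσ v).2⟩
    have h1 : τ y < v := by have := hm hyI (hσ v) hy2; rwa [hτ] at this
    filter_upwards [lt_mem_nhds h1] with w hw
    rw [← hτ w, hm.lt_iff_lt hyI (hσ w)] at hw
    exact ((le_max_left _ _).trans_lt hy1).trans hw
  · obtain ⟨y, hy1, hy2⟩ := exists_between (lt_min hu (hσ v).2)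
    have hyI : y ∈ Ioo a b := ⟨(hσ v).1.trans hy1, hy2.trans_le (min_le_right _ _)⟩
    have h1 : v < τ y := by have := hm (hσ v) hyI hy1; rwa [hτ] at this
    filter_upwards [gt_mem_nhds h1] with w hw
    rw [← hτ w, hm.lt_iff_lt (hσ w) hyI] at hw
    exact hw.trans (hy2.trans_le (min_le_left _ _))

lemma inv_cont_anti {a b : ℝ} {τ σ : ℝ → ℝ} (hm : StrictAntiOn τ (Ioo a b)) (hσ : ∀ v, σ v ∈ Ioo a b)
    (hτ : ∀ v, τ (σ v) = v) (v : ℝ) : ContinuousAt σ v := by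
  have h1 : ContinuousAt (fun w => σ (-w)) (-v) :=
    inv_cont_mono (a := a) (b := b) (τ := fun y => - τ y) (fun x hx y hy hxy => neg_lt_neg (hm hx hy hxy))
      (fun w => hσ _) (fun w => by simp [hτ]) (-v)
  have h2 : ContinuousAt (fun w : ℝ => -w) v := continuous_neg.continuousAt
  have := ContinuousAt.comp (f := fun w : ℝ => -w) (g := fun w => σ (-w)) (x := v) h1 h2
  simpa [Function.comp_def] using this

lemma CD.surj {f : Equiv.Perm ℝ} {F Fi : ℝ → ℝ} {a b p T : ℝ} {ξ τ : ℝ → ℝ} (h : CD f F Fi a b p ξ τ T)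
    (v : ℝ) : ∃ y ∈ Ioo a b, τ y = v := by
  obtain ⟨x, hx⟩ : (Ioo a b).Nonempty := nonempty_Ioo.2 h.cp.lt
  have hc : ContinuousOn τ (Ioo a b) := fun x hx => (h.ed.tau x hx).continuousAt.continuousWithinAt
  have hz : ∀ n : ℤ, τ x + n ∈ τ '' Ioo a b := fun n =>
    ⟨(f ^ n) x, CD.zpow_mem h.D h.cp.fa h.cp.fb n hx, by
      rw [CD.zpow_tau h.D h.cp.fa h.cp.fb (fun x hx => h.tf hx) n hx, mul_one]⟩
  have hcon := (isPreconnected_Ioo.image τ hc).Icc_subset (hz ⌊v - τ x⌋) (hz (⌊v - τ x⌋ + 1))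
  have := hcon (a := v) ⟨by have := Int.floor_le (v - τ x); linarith, by
    have := Int.lt_floor_add_one (v - τ x); push_cast; linarith⟩
  exact this

namespace VF
variable {f g : Equiv.Perm ℝ} {F Fi G Gi : ℝ → ℝ} {α : ℝ} {Ξ : ℝ → ℝ}

lemma curve (V : VF f g F Fi G Gi α Ξ) {x : ℝ} (hx : x ∈ Icc (0:ℝ) 1) : ∃ c : ℝ → ℝ, c 0 = x ∧
    (∀ t, c t ∈ Icc (0:ℝ) 1 ∧ HasDerivAt c (Ξ (c t)) t) ∧ c 1 = f x ∧ c α = g x := by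
  by_cases hfx : f x = x
  · refine ⟨fun _ => x, rfl, fun t => ⟨hx, ?_⟩, hfx.symm, (V.fix hfx).symm⟩
    rw [V.fx x hfx]
    exact hasDerivAt_const _ _
  · obtain ⟨a, b, ha, hb, hxab, hcomp⟩ := V.hf.comp hfx
    obtain ⟨ξ, τ, T, h⟩ := V.hf.cd V.gf V.eF V.eFi hcomp ha hb (Or.inl rfl)
    obtain ⟨ga, gb⟩ := h.cp.fixed V.hf V.hg V.hc
    choose σ hσ hτ using h.surj
    have hinj := h.ed.inj
    have hσx : ∀ y ∈ Ioo a b, σ (τ y) = y := fun y hy => hinj (hσ _) hy (hτ _)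
    have hcont : ∀ v, ContinuousAt σ v := by
      rcases h.ed.mono with ⟨hm, -⟩ | ⟨hm, -⟩
      · exact inv_cont_mono hm hσ hτ
      · exact inv_cont_anti hm hσ hτ
    have hder : ∀ v, HasDerivAt σ (ξ (σ v)) v := by
      intro v
      have := HasDerivAt.of_local_left_inverse (hcont v) (h.ed.tau _ (hσ v))
        (inv_ne_zero (h.ed.ne _ (hσ v))) (Eventually.of_forall hτ)
      rwa [inv_inv] at this
    refine ⟨fun t => σ (τ x + t), ?_, fun t => ⟨h.icc (hσ _), ?_⟩, ?_, ?_⟩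
    · simp only [add_zero]; exact hσx x hxab
    · rw [V.eq _ _ _ _ _ _ h _ (hσ _)]
      exact (hder (τ x + t)).comp_const_add (τ x) t
    · simp only [← h.tf hxab]
      exact hσx _ (V.hf.ioo h.cp.fa h.cp.fb hxab)
    · simp only [← V.tau_g h x hxab]
      exact hσx _ (V.hg.ioo ga gb hxab)

lemma flow (V : VF f g F Fi G Gi α Ξ) : ∃ φ : ℝ → ℝ → ℝ, IsFlowOn Ξ φ 0 1 ∧
    (∀ x ∈ Icc (0:ℝ) 1, f x = φ 1 x) ∧ ∀ x ∈ Icc (0:ℝ) 1, g x = φ α x := by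
  have : ∀ x : ℝ, ∃ c : ℝ → ℝ, x ∈ Icc (0:ℝ) 1 → c 0 = x ∧
    (∀ t, c t ∈ Icc (0:ℝ) 1 ∧ HasDerivAt c (Ξ (c t)) t) ∧ c 1 = f x ∧ c α = g x := by
    intro x
    by_cases hx : x ∈ Icc (0:ℝ) 1
    · obtain ⟨c, hc⟩ := V.curve hx
      exact ⟨c, fun _ => hc⟩
    · exact ⟨fun _ => 0, fun h => absurd h hx⟩
  choose c hc using this
  exact ⟨fun t x => c x t, ⟨fun x hx => (hc x hx).1, fun x hx t => (hc x hx).2.1 t⟩,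
    fun x hx => (hc x hx).2.2.1.symm, fun x hx => (hc x hx).2.2.2.symm⟩

end VF

lemma zpowIter_eq {h : Equiv.Perm ℝ} (D : IsD h) {H Hi : ℝ → ℝ} (eH : ∀ x ∈ Icc (0:ℝ) 1, h x = H x)
    (eHi : ∀ x ∈ Icc (0:ℝ) 1, h⁻¹ x = Hi x) (n : ℤ) {x : ℝ} (hx : x ∈ Icc (0:ℝ) 1) :
    (h ^ n) x = zpowIter H Hi n x := by
  have key : ∀ (e : Equiv.Perm ℝ) (E : ℝ → ℝ), IsD e → (∀ x ∈ Icc (0:ℝ) 1, e x = E x) → ∀ k : ℕ,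
      ∀ x ∈ Icc (0:ℝ) 1, (e ^ k) x = E^[k] x := by
    intro e E he hE k
    induction k with
    | zero => intro x hx; simp
    | succ k ih =>
      intro x hx
      rw [pow_succ, Equiv.Perm.mul_apply, Function.iterate_succ_apply, ih _ (he.maps hx), hE x hx]
  unfold zpowIter
  split_ifs with hn
  · rw [← key h H D eH _ x hx, ← zpow_natCast, Int.toNat_of_nonneg hn]
  · rw [← key h⁻¹ Hi D.inv eHi _ x hx, ← zpow_natCast, Int.toNat_of_nonneg (by omega), inv_zpow', neg_neg]

lemma cyclic_case {h ef eg : Equiv.Perm ℝ} (D : IsD h) {f g : ℝ → ℝ} (hf : ∀ x ∈ Icc (0:ℝ) 1, ef x = f x)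
    (hg : ∀ x ∈ Icc (0:ℝ) 1, eg x = g x) {n m : ℤ} (hn : ef = h ^ n) (hm : eg = h ^ m) :
    ∃ h hinv : ℝ → ℝ, SmoothDiffeoI h ∧ IsInverseOn hinv h (Icc (0 : ℝ) 1) ∧
      ∃ p q : ℤ, (∀ x ∈ Icc (0 : ℝ) 1, f x = zpowIter h hinv q x) ∧
        ∀ x ∈ Icc (0 : ℝ) 1, g x = zpowIter h hinv p x := by
  obtain ⟨H, Hi, gd, eH, eHi⟩ := D.rep
  refine ⟨H, Hi, ⟨gd.smooth, ?_, ?_, fun x _ => gd.dpos x, fun x hx => ?_⟩,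
    ⟨fun x _ => gd.li x, fun x _ => gd.ri x⟩, m, n, fun x hx => ?_, fun x hx => ?_⟩
  · rw [← eH 0 (by simp), D.zero]
  · rw [← eH 1 (by simp), D.one]
  · rw [← eH x hx]; exact D.maps hx
  · rw [← zpowIter_eq D eH eHi n hx, ← hn, hf x hx]
  · rw [← zpowIter_eq D eH eHi m hx, ← hm, hg x hx]

lemma flat_iti {f F : ℝ → ℝ} (h : ∀ x ∈ Icc (0:ℝ) 1, f x = F x) {x : ℝ} (hx : x ∈ Ioo (0:ℝ) 1)
    (hF : Flat F x) : ITIat f x := by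
  have h1 : (fun y => f y - y) =ᶠ[𝓝 x] fun y => F y - y := by
    filter_upwards [isOpen_Ioo.mem_nhds hx] with y hy
    rw [h y (Ioo_subset_Icc_self hy)]
  refine ⟨?_, fun n _ => ?_⟩
  · have := hF 0
    rw [iteratedDeriv_zero] at this
    rw [h x (Ioo_subset_Icc_self hx)]; linarith
  · rw [h1.iteratedDeriv_eq n]; exact hF n

/-- Commuting orientation-preserving `C^∞` diffeomorphisms of `[0,1]` with no common
infinitely-tangent-to-the-identity fixed point in `(0,1)` belong either to a common
infinite cyclic group generated by a `C^∞` diffeomorphism of `[0,1]`, or to a common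
`C¹` flow (`C^∞` on `(0,1)`). -/
theorem cyclic_or_flow (f g : ℝ → ℝ)
    (hf : SmoothDiffeoI f) (hg : SmoothDiffeoI g)
    (hcomm : ∀ x ∈ Icc (0 : ℝ) 1, f (g x) = g (f x))
    (hnd : ∀ x ∈ Ioo (0 : ℝ) 1, ¬ (ITIat f x ∧ ITIat g x)) :
    (∃ h hinv : ℝ → ℝ, SmoothDiffeoI h ∧ IsInverseOn hinv h (Icc (0 : ℝ) 1) ∧
      ∃ p q : ℤ, (∀ x ∈ Icc (0 : ℝ) 1, f x = zpowIter h hinv q x) ∧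
        ∀ x ∈ Icc (0 : ℝ) 1, g x = zpowIter h hinv p x) ∨
    (∃ ξ : ℝ → ℝ, ∃ φ : ℝ → ℝ → ℝ, ∃ α : ℝ,
      ContDiffOn ℝ 1 ξ (Icc (0 : ℝ) 1) ∧ ContDiffOn ℝ (⊤ : ℕ∞) ξ (Ioo (0 : ℝ) 1) ∧
      IsFlowOn ξ φ 0 1 ∧
      (∀ x ∈ Icc (0 : ℝ) 1, f x = φ 1 x) ∧
      ∀ x ∈ Icc (0 : ℝ) 1, g x = φ α x) := by
  obtain ⟨ef, Df, hef⟩ := IsD.exists_of hf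
  obtain ⟨eg, Dg, heg⟩ := IsD.exists_of hg
  obtain ⟨F, Fi, gf, eF, eFi⟩ := Df.rep
  obtain ⟨G, Gi, gg, eG, eGi⟩ := Dg.rep
  have hc : Commute ef eg := by
    refine (Df.mul Dg).ext (Dg.mul Df) fun x hx => ?_
    have hx' := Ioo_subset_Icc_self hx
    rw [Equiv.Perm.mul_apply, Equiv.Perm.mul_apply, hef _ (Dg.maps hx'), heg _ (Df.maps hx'),
      hef x hx', heg x hx', hcomm x hx']
  have S : Setup ef eg F Fi G Gi := by
    refine ⟨Df, Dg, hc, gf, gg, eF, eFi, eG, eGi, fun x hx h => hnd x hx ⟨?_, ?_⟩⟩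
    · exact flat_iti (fun y hy => by rw [← hef y hy, eF y hy]) hx h.1
    · exact flat_iti (fun y hy => by rw [← heg y hy, eG y hy]) hx h.2
  by_cases f1 : ef = 1
  · exact Or.inl (cyclic_case Dg hef heg (n := 0) (m := 1) (by simpa using f1) (by simp))
  by_cases g1 : eg = 1
  · exact Or.inl (cyclic_case Df hef heg (n := 1) (m := 0) (by simp) (by simpa using g1))
  have N : NT ef eg F Fi G Gi := ⟨S, f1, g1⟩
  obtain ⟨α, hα⟩ := N.global_alpha
  by_cases hirr : Irrational α
  · right
    have I : IRR ef eg F Fi G Gi α := ⟨N, hirr, hα⟩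
    obtain ⟨Ξ, h1, h2⟩ := I.exists_Xi
    have V : VF ef eg F Fi G Gi α Ξ := ⟨I, h1, h2⟩
    obtain ⟨φ, p1, p2, p3⟩ := V.flow
    exact ⟨Ξ, φ, α, V.c1, V.smooth, p1, fun x hx => by rw [← hef x hx, p2 x hx],
      fun x hx => by rw [← heg x hx, p3 x hx]⟩
  · left
    unfold Irrational at hirr
    push Not at hirr
    obtain ⟨q, rfl⟩ := hirr
    obtain ⟨h, D, n, m, e1, e2⟩ := N.rational q hα
    exact cyclic_case D hef heg e1 e2
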